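/- Let U be an unbounded plane domain with smooth boundary that is not strictly convex. Then U is not uniquely determined in the class of all plane domains with smooth boundaries by the condition of local isometry of boundaries in the relative metrics: there exists a plane domain V with smooth boundary such that ∂U and ∂V are locally isometric in the relative metrics of the boundaries, yet there is no Euclidean isometry J: ℝ² → ℝ² with J(U) = V. -/

import Mathlib

open Set Filter Metric Topology ENNReal

noncomputable section

/-- A domain in `ℝⁿ`: a nonempty open connected set. -/
def IsDomainSet {n : ℕ} (U : Set (EuclideanSpace ℝ (Fin n))) : Prop :=
  IsOpen U ∧ IsConnected U

/-- The infimum of lengths of smooth paths joining `a` and `b` inside `U`. -/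
def smoothPathInf {n : ℕ} (U : Set (EuclideanSpace ℝ (Fin n)))
    (a b : EuclideanSpace ℝ (Fin n)) : ℝ≥0∞ :=
  ⨅ (γ : ℝ → EuclideanSpace ℝ (Fin n)) (_ : ContDiff ℝ 1 γ) (_ : γ 0 = a)
    (_ : γ 1 = b) (_ : ∀ t ∈ Icc (0:ℝ) 1, γ t ∈ U), eVariationOn γ (Icc 0 1)

/-- The relative metric `ρ_{∂U,U}`:
`ρ(x,y) = liminf_{x'→x, y'→y; x',y'∈U} inf{length γ : γ smooth path joining x',y' in U}`. -/
def relDist {n : ℕ} (U : Set (EuclideanSpace ℝ (Fin n)))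
    (x y : EuclideanSpace ℝ (Fin n)) : ℝ≥0∞ :=
  Filter.liminf (fun p : EuclideanSpace ℝ (Fin n) × EuclideanSpace ℝ (Fin n) =>
    smoothPathInf U p.1 p.2) ((𝓝[U] x) ×ˢ (𝓝[U] y))

/-- `f` is a bijection of `∂U` onto `∂V` which is a local isometry
in the relative metrics of the boundaries. -/
def IsBoundaryLocalIsometry {n : ℕ} (U V : Set (EuclideanSpace ℝ (Fin n)))
    (f : EuclideanSpace ℝ (Fin n) → EuclideanSpace ℝ (Fin n)) : Prop :=
  Set.BijOn f (frontier U) (frontier V) ∧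
  ∀ y ∈ frontier U, ∃ ε : ℝ≥0∞, 0 < ε ∧ ∀ a ∈ frontier U, ∀ b ∈ frontier U,
    relDist U a y < ε → relDist U b y < ε →
      relDist U a b = relDist V (f a) (f b)

/-- `U` has smooth boundary: `∂U` is an `(n-1)`-dimensional submanifold of
class `C¹` without boundary, i.e. near each of its points the frontier can be
mapped by a `C¹` diffeomorphism onto an open piece of a hyperplane. -/
def HasC1Boundary {n : ℕ} (U : Set (EuclideanSpace ℝ (Fin n))) : Prop :=
  ∀ x ∈ frontier U, ∃ (W W' : Set (EuclideanSpace ℝ (Fin n)))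
    (φ ψ : EuclideanSpace ℝ (Fin n) → EuclideanSpace ℝ (Fin n))
    (ℓ : EuclideanSpace ℝ (Fin n) →L[ℝ] ℝ),
    IsOpen W ∧ x ∈ W ∧ IsOpen W' ∧ ℓ ≠ 0 ∧
    ContDiffOn ℝ 1 φ W ∧ ContDiffOn ℝ 1 ψ W' ∧
    Set.MapsTo φ W W' ∧ Set.MapsTo ψ W' W ∧
    (∀ z ∈ W, ψ (φ z) = z) ∧ (∀ z ∈ W', φ (ψ z) = z) ∧
    φ '' (W ∩ frontier U) = W' ∩ {y | ℓ y = 0}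

/-- The intrinsic distance inside a set `S`: the infimum of lengths of
(continuous) paths joining `a` and `b` inside `S`. -/
def intrinsicDist {n : ℕ} (S : Set (EuclideanSpace ℝ (Fin n)))
    (a b : EuclideanSpace ℝ (Fin n)) : ℝ≥0∞ :=
  ⨅ (γ : ℝ → EuclideanSpace ℝ (Fin n)) (_ : ContinuousOn γ (Icc (0:ℝ) 1))
    (_ : γ 0 = a) (_ : γ 1 = b) (_ : ∀ t ∈ Icc (0:ℝ) 1, γ t ∈ S),
    eVariationOn γ (Icc 0 1)

/-- A strictly convex domain: convex, and the open segment joining any two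
distinct points of its closure is contained in the domain. -/
def IsStrictlyConvexDomain {n : ℕ} (U : Set (EuclideanSpace ℝ (Fin n))) : Prop :=
  Convex ℝ U ∧ ∀ a ∈ closure U, ∀ b ∈ closure U, a ≠ b → openSegment ℝ a b ⊆ U

section General

variable {X : Type*} [NormedAddCommGroup X] [NormedSpace ℝ X]

/-- The infimum of lengths of `C¹` paths from `a` to `b` inside `U`. -/
def pathInf (U : Set X) (a b : X) : ℝ≥0∞ :=
  ⨅ (γ : ℝ → X) (_ : ContDiff ℝ 1 γ) (_ : γ 0 = a)
    (_ : γ 1 = b) (_ : ∀ t ∈ Icc (0:ℝ) 1, γ t ∈ U), eVariationOn γ (Icc 0 1)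

/-- The relative metric of the boundary in a normed space. -/
def relMetric (U : Set X) (x y : X) : ℝ≥0∞ :=
  Filter.liminf (fun p : X × X => pathInf U p.1 p.2) ((𝓝[U] x) ×ˢ (𝓝[U] y))

/-- Boundary local isometry in a pair of normed spaces. -/
def BdryLocalIsometry (U V : Set X) (f : X → X) : Prop :=
  Set.BijOn f (frontier U) (frontier V) ∧
  ∀ y ∈ frontier U, ∃ ε : ℝ≥0∞, 0 < ε ∧ ∀ a ∈ frontier U, ∀ b ∈ frontier U,
    relMetric U a y < ε → relMetric U b y < ε →
      relMetric U a b = relMetric V (f a) (f b)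

/-- `C¹` boundary in a normed space. -/
def C1Bdry (U : Set X) : Prop :=
  ∀ x ∈ frontier U, ∃ (W W' : Set X) (φ ψ : X → X) (ℓ : X →L[ℝ] ℝ),
    IsOpen W ∧ x ∈ W ∧ IsOpen W' ∧ ℓ ≠ 0 ∧
    ContDiffOn ℝ 1 φ W ∧ ContDiffOn ℝ 1 ψ W' ∧
    Set.MapsTo φ W W' ∧ Set.MapsTo ψ W' W ∧
    (∀ z ∈ W, ψ (φ z) = z) ∧ (∀ z ∈ W', φ (ψ z) = z) ∧
    φ '' (W ∩ frontier U) = W' ∩ {y | ℓ y = 0}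

/-- `U` is a domain with `C¹` boundary. -/
def C1Domain (U : Set X) : Prop := IsOpen U ∧ IsConnected U ∧ C1Bdry U

/-- The failure of unique determination by the relative metric of the boundary. -/
def NotDetermined (U : Set X) : Prop :=
  ∃ V : Set X, C1Domain V ∧ (∃ f : X → X, BdryLocalIsometry U V f) ∧ ¬ ∃ J : X ≃ᵢ X, J '' U = V

end General

theorem notDetermined_iff (U : Set (EuclideanSpace ℝ (Fin 2))) : NotDetermined U ↔
    ∃ V : Set (EuclideanSpace ℝ (Fin 2)), IsDomainSet V ∧ HasC1Boundary V ∧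
      (∃ f : EuclideanSpace ℝ (Fin 2) → EuclideanSpace ℝ (Fin 2),
        IsBoundaryLocalIsometry U V f) ∧
      ¬ ∃ J : EuclideanSpace ℝ (Fin 2) ≃ᵢ EuclideanSpace ℝ (Fin 2), J '' U = V := by
  constructor
  · rintro ⟨V, ⟨h1, h2, h3⟩, h4, h5⟩
    exact ⟨V, ⟨h1, h2⟩, h3, h4, h5⟩
  · rintro ⟨V, ⟨h1, h2⟩, h3, h4, h5⟩
    exact ⟨V, ⟨h1, h2, h3⟩, h4, h5⟩

section Transport

variable {X Y : Type*} [NormedAddCommGroup X] [NormedSpace ℝ X]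
  [NormedAddCommGroup Y] [NormedSpace ℝ Y]

theorem pathInf_image_le (T : X ≃ᵃⁱ[ℝ] Y) (U : Set X) (a b : X) :
    pathInf (T '' U) (T a) (T b) ≤ pathInf U a b := by
  refine le_iInf fun γ => le_iInf fun h1 => le_iInf fun h2 => le_iInf fun h3 => le_iInf fun h4 => ?_
  refine (iInf_le_of_le (T ∘ γ) ?_)
  have hT : ContDiff ℝ 1 (T : X → Y) := T.toContinuousAffineEquiv.toContinuousAffineMap.contDiff
  refine iInf_le_of_le (hT.comp h1) (iInf_le_of_le (by simp [h2]) (iInf_le_of_le (by simp [h3])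
    (iInf_le_of_le (fun t ht => mem_image_of_mem _ (h4 t ht)) ?_)))
  refine le_of_eq ?_
  simp only [eVariationOn, Function.comp, T.isometry.edist_eq]

theorem pathInf_image (T : X ≃ᵃⁱ[ℝ] Y) (U : Set X) (a b : X) :
    pathInf (T '' U) (T a) (T b) = pathInf U a b := by
  refine le_antisymm (pathInf_image_le T U a b) ?_
  have := pathInf_image_le T.symm (T '' U) (T a) (T b)
  rwa [image_image, AffineIsometryEquiv.symm_apply_apply, AffineIsometryEquiv.symm_apply_apply,
    show (fun x => T.symm (T x)) '' U = U by simp] at this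

theorem nhdsWithin_image_equiv (T : X ≃ᵃⁱ[ℝ] Y) (U : Set X) (a : X) :
    𝓝[T '' U] (T a) = map T (𝓝[U] a) := by
  have := T.toHomeomorph.isEmbedding.map_nhdsWithin_eq U a
  exact this.symm

theorem relMetric_image (T : X ≃ᵃⁱ[ℝ] Y) (U : Set X) (a b : X) :
    relMetric (T '' U) (T a) (T b) = relMetric U a b := by
  unfold relMetric
  rw [nhdsWithin_image_equiv, nhdsWithin_image_equiv, Filter.prod_map_map_eq]
  simp only [Filter.liminf, Filter.map_map]
  congr 2
  funext p
  exact pathInf_image T U p.1 p.2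

theorem frontier_image_equiv (T : X ≃ᵃⁱ[ℝ] Y) (U : Set X) :
    frontier (T '' U) = T '' frontier U :=
  (T.toHomeomorph.image_frontier U).symm

theorem C1Domain.image (T : X ≃ᵃⁱ[ℝ] Y) {U : Set X} (hU : C1Domain U) : C1Domain (T '' U) := by
  obtain ⟨h1, h2, h3⟩ := hU
  have hT : ContDiff ℝ 1 (T : X → Y) := T.toContinuousAffineEquiv.toContinuousAffineMap.contDiff
  have hT' : ContDiff ℝ 1 (T.symm : Y → X) :=
    T.symm.toContinuousAffineEquiv.toContinuousAffineMap.contDiff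
  refine ⟨T.toHomeomorph.isOpenMap _ h1, h2.image _ T.continuous.continuousOn, ?_⟩
  rw [C1Bdry, frontier_image_equiv]
  rintro _ ⟨x, hx, rfl⟩
  obtain ⟨W, W', φ, ψ, ℓ, hW, hxW, hW', hℓ, hφ, hψ, m1, m2, i1, i2, e⟩ := h3 x hx
  let L : Y →L[ℝ] X := (T.symm.linearIsometryEquiv : Y →L[ℝ] X)
  have hL : ∀ y, L y = T.linearIsometryEquiv.symm y := fun y => rfl
  let S := T.linearIsometryEquiv
  have hS : ContDiff ℝ 1 (S : X → Y) := S.contDiff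
  have hS' : ContDiff ℝ 1 (S.symm : Y → X) := S.symm.contDiff
  refine ⟨T '' W, S '' W', fun y => S (φ (T.symm y)), fun y => T (ψ (S.symm y)), ℓ.comp L,
    T.toHomeomorph.isOpenMap _ hW, mem_image_of_mem _ hxW, S.toHomeomorph.isOpenMap _ hW', ?_,
    ?_, ?_, ?_, ?_, ?_, ?_, ?_⟩
  · intro h
    apply hℓ
    ext v
    have := DFunLike.congr_fun h (S v)
    simpa [hL, S] using this
  · refine hS.comp_contDiffOn (hφ.comp hT'.contDiffOn ?_)
    rintro _ ⟨w, hw, rfl⟩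
    simpa using hw
  · refine hT.comp_contDiffOn (hψ.comp hS'.contDiffOn ?_)
    rintro _ ⟨w, hw, rfl⟩
    simpa using hw
  · rintro _ ⟨w, hw, rfl⟩
    exact ⟨φ w, m1 hw, by simp⟩
  · rintro _ ⟨w, hw, rfl⟩
    exact ⟨ψ w, m2 hw, by simp⟩
  · rintro _ ⟨w, hw, rfl⟩
    simp [i1 w hw]
  · rintro _ ⟨w, hw, rfl⟩
    simp [i2 w hw]
  · have e1 : (fun y => S (φ (T.symm y))) '' (T '' W ∩ T '' frontier U)
        = S '' (φ '' (W ∩ frontier U)) := by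
      rw [← image_inter T.injective, image_image, image_image]
      simp
    rw [e1, e]
    ext y
    constructor
    · rintro ⟨w, ⟨hw, hw'⟩, rfl⟩
      exact ⟨mem_image_of_mem _ hw, by simpa [hL, S] using hw'⟩
    · rintro ⟨⟨w, hw, rfl⟩, hy⟩
      exact ⟨w, ⟨hw, by simpa [hL, S] using hy⟩, rfl⟩

theorem NotDetermined.of_image (T : X ≃ᵃⁱ[ℝ] Y) {U : Set X} (h : NotDetermined (T '' U)) :
    NotDetermined U := by
  obtain ⟨V, hV, ⟨f, hf, hloc⟩, hJ⟩ := h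
  have hTV : T '' (T.symm '' V) = V := by rw [image_image]; simp
  rw [frontier_image_equiv] at hf hloc
  refine ⟨T.symm '' V, hV.image T.symm, ⟨fun x => T.symm (f (T x)), ?_, ?_⟩, ?_⟩
  · rw [frontier_image_equiv]
    have b1 : BijOn T (frontier U) (T '' frontier U) := T.injective.injOn.bijOn_image
    have b2 : BijOn T.symm (frontier V) (T.symm '' frontier V) :=
      T.symm.injective.injOn.bijOn_image
    exact b2.comp (hf.comp b1)
  · intro y hy
    obtain ⟨ε, hε, h⟩ := hloc (T y) (mem_image_of_mem _ hy)
    refine ⟨ε, hε, fun a ha b hb h1 h2 => ?_⟩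
    rw [relMetric_image T.symm, ← relMetric_image T U]
    exact h _ (mem_image_of_mem _ ha) _ (mem_image_of_mem _ hb)
      (by rwa [relMetric_image]) (by rwa [relMetric_image])
  · rintro ⟨J, hJU⟩
    refine hJ ⟨(T.symm.toIsometryEquiv.trans J).trans T.toIsometryEquiv, ?_⟩
    have : (((T.symm.toIsometryEquiv.trans J).trans T.toIsometryEquiv : Y ≃ᵢ Y) : Y → Y)
      = fun y => T (J (T.symm y)) := rfl
    rw [this, image_image]
    simp only [AffineIsometryEquiv.symm_apply_apply]
    rw [← image_image T J, hJU, hTV]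

end Transport

section Paths

variable {X : Type*} [NormedAddCommGroup X] [NormedSpace ℝ X]

theorem eVariationOn_le_of_edist_le {Y Z : Type*} [PseudoEMetricSpace Y] [PseudoEMetricSpace Z]
    {f : ℝ → Y} {g : ℝ → Z} {s : Set ℝ}
    (h : ∀ a ∈ s, ∀ b ∈ s, a ≤ b → edist (f a) (f b) ≤ edist (g a) (g b)) :
    eVariationOn f s ≤ eVariationOn g s := by
  refine iSup_mono fun p => Finset.sum_le_sum fun i _ => ?_
  rw [edist_comm, edist_comm (g _)]
  exact h _ (p.2.2.2 i) _ (p.2.2.2 (i + 1)) (p.2.2.1 (Nat.le_succ i))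

theorem exists_uniform_partition {Y : Type*} [PseudoMetricSpace Y] {γ : ℝ → Y}
    (hγ : ContinuousOn γ (Icc 0 1)) {δ : ℝ} (hδ : 0 < δ) :
    ∃ N : ℕ, 0 < N ∧ ∀ s ∈ Icc (0:ℝ) 1, ∀ t ∈ Icc (0:ℝ) 1, |s - t| ≤ 1 / N →
      dist (γ s) (γ t) < δ := by
  have := isCompact_Icc.uniformContinuousOn_of_continuous hγ
  obtain ⟨η, hη, h⟩ := Metric.uniformContinuousOn_iff.1 this δ hδ
  obtain ⟨n, hn⟩ := exists_nat_one_div_lt hη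
  refine ⟨n + 1, n.succ_pos, fun s hs t ht hst => h s hs t ht ?_⟩
  rw [Real.dist_eq]
  push_cast at hst
  linarith

/-- A smooth reparametrised polygon with vertices `q 0, …, q N`. -/
def smoothPolygon (q : ℕ → X) (N : ℕ) (t : ℝ) : X :=
  q 0 + ∑ k ∈ Finset.range N, Real.smoothTransition (N * t - k) • (q (k + 1) - q k)

theorem smoothPolygon_contDiff (q : ℕ → X) (N : ℕ) : ContDiff ℝ 1 (smoothPolygon q N) := by
  unfold smoothPolygon
  refine contDiff_const.add (ContDiff.sum fun k _ => ContDiff.smul ?_ contDiff_const)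
  exact Real.smoothTransition.contDiff.comp (by fun_prop)

theorem smoothPolygon_eq (q : ℕ → X) {N k : ℕ} (hk : k < N) {t : ℝ} (h1 : (k : ℝ) ≤ N * t)
    (h2 : N * t ≤ k + 1) :
    smoothPolygon q N t = q k + Real.smoothTransition (N * t - k) • (q (k + 1) - q k) := by
  unfold smoothPolygon
  obtain ⟨m, rfl⟩ : ∃ m, N = k + (1 + m) := ⟨N - k - 1, by omega⟩
  rw [Finset.sum_range_add, Finset.sum_range_add]
  have e1 : ∑ j ∈ Finset.range k, Real.smoothTransition (((k + (1 + m) : ℕ) : ℝ) * t - j) •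
      (q (j + 1) - q j) = q k - q 0 := by
    rw [← Finset.sum_range_sub]
    refine Finset.sum_congr rfl fun j hj => ?_
    have : (j : ℝ) + 1 ≤ k := by exact_mod_cast Finset.mem_range.1 hj
    rw [Real.smoothTransition.one_of_one_le (by linarith), one_smul]
  have e2 : ∑ x ∈ Finset.range m, Real.smoothTransition
      (((k + (1 + m) : ℕ) : ℝ) * t - ((k + (1 + x) : ℕ) : ℝ)) •
      (q (k + (1 + x) + 1) - q (k + (1 + x))) = 0 := by
    refine Finset.sum_eq_zero fun j _ => ?_
    rw [Real.smoothTransition.zero_of_nonpos, zero_smul]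
    push_cast at h2 ⊢
    have : (0:ℝ) ≤ j := j.cast_nonneg
    linarith
  rw [e1, e2, add_zero, Finset.sum_range_one, add_zero, ← add_assoc, add_sub_cancel]

theorem pathInf_le_eVariationOn {U : Set X} (hU : IsOpen U) {γ : ℝ → X}
    (hγ : ContinuousOn γ (Icc 0 1)) (hγU : ∀ t ∈ Icc (0:ℝ) 1, γ t ∈ U) :
    pathInf U (γ 0) (γ 1) ≤ eVariationOn γ (Icc 0 1) := by
  have hK : IsCompact (γ '' Icc 0 1) := isCompact_Icc.image_of_continuousOn hγ
  obtain ⟨δ, hδ, hδU⟩ := hK.exists_thickening_subset_open hU (image_subset_iff.2 hγU)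
  obtain ⟨N, hN, hpart⟩ := exists_uniform_partition hγ hδ
  have hN' : (0:ℝ) < N := by exact_mod_cast hN
  set q : ℕ → X := fun k => γ (k / N) with hq
  have hmem : ∀ k : ℕ, k ≤ N → ((k:ℝ) / N) ∈ Icc (0:ℝ) 1 := fun k hk =>
    ⟨by positivity, (div_le_one hN').2 (by exact_mod_cast hk)⟩
  have hidx : ∀ t ∈ Icc (0:ℝ) 1, ∃ k < N, (k:ℝ) ≤ N * t ∧ N * t ≤ k + 1 := by
    intro t ht
    rcases eq_or_lt_of_le ht.2 with h | h
    · refine ⟨N - 1, by omega, ?_, ?_⟩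
      · rw [h, Nat.cast_sub hN]; simp
      · rw [h, Nat.cast_sub hN]; simp
    · have h0 : 0 ≤ N * t := mul_nonneg hN'.le ht.1
      refine ⟨⌊N * t⌋₊, (Nat.floor_lt h0).2 (by nlinarith), Nat.floor_le h0,
        (Nat.lt_floor_add_one _).le⟩
  have hstart : smoothPolygon q N 0 = γ 0 := by
    rw [smoothPolygon_eq q hN (by simp) (by simp)]
    simp [hq]
  have hend : smoothPolygon q N 1 = γ 1 := by
    have hNs : ((N - 1 : ℕ) : ℝ) = N - 1 := by rw [Nat.cast_sub hN]; simp
    rw [smoothPolygon_eq q (k := N - 1) (by omega) (by rw [hNs]; linarith) (by rw [hNs]; linarith),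
      hNs]
    rw [Real.smoothTransition.one_of_one_le (by linarith)]
    have : N - 1 + 1 = N := by omega
    simp [hq, this, hN'.ne']
  have hU' : ∀ t ∈ Icc (0:ℝ) 1, smoothPolygon q N t ∈ U := by
    intro t ht
    obtain ⟨k, hk, h1, h2⟩ := hidx t ht
    rw [smoothPolygon_eq q hk h1 h2]
    apply hδU
    rw [mem_thickening_iff]
    refine ⟨q k, mem_image_of_mem _ (hmem k hk.le), ?_⟩
    rw [dist_eq_norm, add_sub_cancel_left, norm_smul, Real.norm_eq_abs,
      abs_of_nonneg (Real.smoothTransition.nonneg _)]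
    have := hpart _ (hmem (k + 1) hk) _ (hmem k hk.le) (by
      push_cast
      rw [← sub_div, add_sub_cancel_left, abs_of_pos (by positivity)])
    rw [dist_eq_norm] at this
    calc _ ≤ 1 * ‖q (k + 1) - q k‖ :=
          mul_le_mul_of_nonneg_right (Real.smoothTransition.le_one _) (norm_nonneg _)
      _ < δ := by rw [one_mul]; exact this
  have hlen : eVariationOn (smoothPolygon q N) (Icc 0 1) ≤ eVariationOn γ (Icc 0 1) := by
    set G : ℝ → ℝ := fun t => ∑ k ∈ Finset.range N,
      Real.smoothTransition (N * t - k) * ‖q (k + 1) - q k‖ with hG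
    have hGm : Monotone G := fun s t hst => Finset.sum_le_sum fun k _ =>
      mul_le_mul_of_nonneg_right (Real.smoothTransition.monotone (by
        have := mul_le_mul_of_nonneg_left hst hN'.le
        linarith)) (norm_nonneg _)
    have hle : eVariationOn (smoothPolygon q N) (Icc 0 1) ≤ eVariationOn G (Icc 0 1) := by
      refine eVariationOn_le_of_edist_le fun a _ b _ hab => ?_
      rw [edist_dist, edist_dist]
      apply ENNReal.ofReal_le_ofReal
      rw [dist_comm, dist_eq_norm, dist_comm, Real.dist_eq, abs_of_nonneg (sub_nonneg.2 (hGm hab))]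
      simp only [smoothPolygon, hG, add_sub_add_left_eq_sub, ← Finset.sum_sub_distrib, ← sub_smul,
        ← sub_mul]
      refine (norm_sum_le _ _).trans (Finset.sum_le_sum fun k _ => ?_)
      rw [norm_smul, Real.norm_eq_abs, abs_of_nonneg]
      exact sub_nonneg.2 (Real.smoothTransition.monotone (by
        have := mul_le_mul_of_nonneg_left hab hN'.le
        linarith))
    have hGe : eVariationOn G (Icc 0 1) = ENNReal.ofReal (G 1 - G 0) := by
      have := (hGm.monotoneOn (Icc 0 1)).eVariationOn_eq (a := 0) (b := 1) (by simp) (by simp)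
      rwa [inter_self] at this
    have hG0 : G 0 = 0 := Finset.sum_eq_zero fun k _ => by
      rw [Real.smoothTransition.zero_of_nonpos (by simp), zero_mul]
    have hG1 : G 1 = ∑ k ∈ Finset.range N, ‖q (k + 1) - q k‖ := Finset.sum_congr rfl fun k hk => by
      have : (k:ℝ) + 1 ≤ N := by exact_mod_cast Finset.mem_range.1 hk
      rw [Real.smoothTransition.one_of_one_le (by linarith), one_mul]
    have hsum := eVariationOn.sum_le_of_monotoneOn_Icc (f := γ) (s := Icc 0 1) (m := 0) (n := N)
      (u := fun k : ℕ => (k:ℝ) / N) (fun a _ b _ hab => by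
        have : (a:ℝ) ≤ b := by exact_mod_cast hab
        exact div_le_div_of_nonneg_right this hN'.le) (fun i hi => hmem i hi.2)
    rw [← Finset.range_eq_Ico] at hsum
    refine hle.trans ?_
    rw [hGe, hG0, hG1, sub_zero, ENNReal.ofReal_sum_of_nonneg fun _ _ => norm_nonneg _]
    refine le_trans (le_of_eq (Finset.sum_congr rfl fun k _ => ?_)) hsum
    rw [← dist_eq_norm, ← edist_dist]
  refine le_trans ?_ hlen
  exact iInf_le_of_le _ (iInf_le_of_le (smoothPolygon_contDiff q N) (iInf_le_of_le hstart
    (iInf_le_of_le hend (iInf_le_of_le hU' le_rfl))))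

theorem eVariationOn_comp_le_of_local {Y Z : Type*} [PseudoMetricSpace Y] [PseudoMetricSpace Z]
    {S : Set Y} {Ψ : Y → Z} {γ : ℝ → Y} (hγ : ContinuousOn γ (Icc 0 1))
    (hS : ∀ t ∈ Icc (0:ℝ) 1, γ t ∈ S)
    (hΨ : ∀ ε : ℝ, 0 < ε → ∃ δ > 0, ∀ p ∈ S, ∀ q ∈ S, dist p q < δ →
      dist (Ψ p) (Ψ q) ≤ (1 + ε) * dist p q) :
    eVariationOn (Ψ ∘ γ) (Icc 0 1) ≤ eVariationOn γ (Icc 0 1) := by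
  have key : ∀ ε : ℝ, 0 < ε → eVariationOn (Ψ ∘ γ) (Icc 0 1) ≤
      ENNReal.ofReal (1 + ε) * eVariationOn γ (Icc 0 1) := by
    intro ε hε
    obtain ⟨δ, hδ, h⟩ := hΨ ε hε
    obtain ⟨N, hN, hpart⟩ := exists_uniform_partition hγ hδ
    have hN' : (0:ℝ) < N := by exact_mod_cast hN
    have hI : Monotone (fun k : ℕ => (k:ℝ) / N) := fun a b hab => by
      have : (a:ℝ) ≤ b := by exact_mod_cast hab
      exact div_le_div_of_nonneg_right this hN'.le
    have s1 := eVariationOn.sum' (Ψ ∘ γ) hI (n := N)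
    have s2 := eVariationOn.sum' γ hI (n := N)
    simp only [Nat.cast_zero, zero_div, div_self hN'.ne'] at s1 s2
    rw [← s1, ← s2, Finset.mul_sum]
    refine Finset.sum_le_sum fun k hk => ?_
    have hk1 : (k:ℝ) + 1 ≤ N := by exact_mod_cast Finset.mem_range.1 hk
    have hk0 : (0:ℝ) ≤ k := k.cast_nonneg
    have hsub : ∀ s ∈ Icc ((k:ℝ) / N) (((k + 1 : ℕ) : ℝ) / N), s ∈ Icc (0:ℝ) 1 := fun s hs =>
      ⟨le_trans (by positivity) hs.1, hs.2.trans (by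
        rw [div_le_one hN']; push_cast; exact hk1)⟩
    unfold eVariationOn
    rw [ENNReal.mul_iSup]
    refine iSup_mono fun p => ?_
    rw [Finset.mul_sum]
    refine Finset.sum_le_sum fun i _ => ?_
    have m1 := p.2.2.2 (i + 1)
    have m2 := p.2.2.2 i
    rw [edist_dist, edist_dist, ← ENNReal.ofReal_mul (by linarith)]
    apply ENNReal.ofReal_le_ofReal
    refine h _ (hS _ (hsub _ m1)) _ (hS _ (hsub _ m2)) (hpart _ (hsub _ m1) _ (hsub _ m2) ?_)
    have e : (((k + 1 : ℕ) : ℝ)) / N = k / N + 1 / N := by push_cast; ring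
    have m1' := m1.2.trans_eq e
    have m2' := m2.2.trans_eq e
    rw [abs_le]
    constructor <;> linarith [m1.1, m2.1]
  by_cases htop : eVariationOn γ (Icc 0 1) = ∞
  · rw [htop]; exact le_top
  have hlim : Tendsto (fun ε : ℝ => ENNReal.ofReal (1 + ε) * eVariationOn γ (Icc 0 1)) (𝓝[>] 0)
      (𝓝 (ENNReal.ofReal (1 + 0) * eVariationOn γ (Icc 0 1))) := by
    refine ENNReal.Tendsto.mul_const ?_ (Or.inr htop)
    refine (ENNReal.continuous_ofReal.tendsto _).comp ?_
    exact ((continuous_const.add continuous_id).tendsto (0:ℝ)).mono_left nhdsWithin_le_nhds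
  simp only [add_zero, ENNReal.ofReal_one, one_mul] at hlim
  exact ge_of_tendsto hlim (eventually_nhdsWithin_of_forall fun ε hε => key ε hε)

theorem edist_le_pathInf (U : Set X) (a b : X) : edist a b ≤ pathInf U a b := by
  refine le_iInf fun γ => le_iInf fun _ => le_iInf fun h2 => le_iInf fun h3 => le_iInf fun _ => ?_
  rw [← h2, ← h3]
  exact eVariationOn.edist_le _ (by simp) (by simp)

theorem edist_le_relMetric (U : Set X) (a b : X) : edist a b ≤ relMetric U a b := by
  refine le_of_forall_lt fun c hc => ?_
  obtain ⟨d, hcd, hd⟩ := exists_between hc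
  refine lt_of_lt_of_le hcd (le_liminf_of_le (by isBoundedDefault) ?_)
  have hlim : Tendsto (fun p : X × X => edist p.1 p.2) ((𝓝[U] a) ×ˢ (𝓝[U] b))
      (𝓝 (edist a b)) :=
    (continuous_edist.tendsto (a, b)).mono_left (by
      rw [nhds_prod_eq]; exact Filter.prod_mono nhdsWithin_le_nhds nhdsWithin_le_nhds)
  filter_upwards [hlim.eventually (lt_mem_nhds hd)] with p hp
  exact hp.le.trans (edist_le_pathInf U _ _)

theorem relMetric_transfer {U V : Set X} (hV : IsOpen V) {y : X} {R τ₀ : ℝ} (hR : 0 < R)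
    (hτ₀ : 0 < τ₀) {Ψ : X → X} {e : X}
    (hcont : ContinuousOn Ψ (closure U ∩ ball y R))
    (hlen : ∀ ε : ℝ, 0 < ε → ∃ δ > 0, ∀ p ∈ U ∩ ball y R, ∀ q ∈ U ∩ ball y R, dist p q < δ →
      dist (Ψ p) (Ψ q) ≤ (1 + ε) * dist p q)
    (hmem : ∀ p ∈ U ∩ ball y R, ∀ τ : ℝ, 0 < τ → τ < τ₀ → Ψ p + τ • e ∈ V)
    {a b : X} (ha : a ∈ closure U) (ha' : dist a y < R / 4) (hb : b ∈ closure U)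
    (hb' : dist b y < R / 4)
    (hab : relMetric U a b < ENNReal.ofReal (R / 4)) :
    relMetric V (Ψ a) (Ψ b) ≤ relMetric U a b := by
  refine le_of_forall_gt_imp_ge_of_dense fun c₀ hc₀ => ?_
  set c := min c₀ (ENNReal.ofReal (R / 4)) with hc
  have hcab : relMetric U a b < c := lt_min hc₀ hab
  refine le_trans ?_ (min_le_left c₀ (ENNReal.ofReal (R / 4)))
  rw [← hc]
  refine Filter.liminf_le_of_frequently_le' ?_
  have hfreq := Filter.frequently_lt_of_liminf_lt (by isBoundedDefault) hcab
  rw [Filter.frequently_iff]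
  intro S hS
  obtain ⟨S1, hS1, S2, hS2, hSS⟩ := Filter.mem_prod_iff.1 hS
  obtain ⟨r1, hr1, hr1S⟩ := Metric.mem_nhdsWithin_iff.1 hS1
  obtain ⟨r2, hr2, hr2S⟩ := Metric.mem_nhdsWithin_iff.1 hS2
  have nb : ∀ z ∈ closure U, dist z y < R / 4 → ∀ r > 0,
      {p | p ∈ U ∧ dist p y < R / 4 ∧ dist (Ψ p) (Ψ z) < r} ∈ 𝓝[U] z := by
    intro z hz hz' r hr
    have h1 : {p | dist p y < R / 4} ∈ 𝓝 z := isOpen_ball.mem_nhds hz'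
    have hzb : z ∈ closure U ∩ ball y R := ⟨hz, by rw [mem_ball]; linarith⟩
    have h2 : Tendsto Ψ (𝓝[U] z) (𝓝 (Ψ z)) := by
      refine (hcont z hzb).mono_left ?_
      rw [inter_comm, nhdsWithin_inter_of_mem (mem_nhdsWithin_of_mem_nhds (isOpen_ball.mem_nhds hzb.2))]
      exact nhdsWithin_mono _ subset_closure
    filter_upwards [self_mem_nhdsWithin, mem_nhdsWithin_of_mem_nhds h1,
      h2 (ball_mem_nhds _ hr)] with p hp1 hp2 hp3 using ⟨hp1, hp2, hp3⟩
  obtain ⟨⟨p, q⟩, ⟨⟨hpU, hpy, hpΨ⟩, ⟨hqU, hqy, hqΨ⟩⟩, hpq⟩ := (Filter.frequently_iff.1 hfreq)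
    (Filter.prod_mem_prod (nb a ha ha' (r1 / 2) (half_pos hr1)) (nb b hb hb' (r2 / 2)
      (half_pos hr2)))
  simp only at hpU hpy hpΨ hqU hqy hqΨ hpq
  obtain ⟨τ, hτ, hτ2, hτ1, hτ3⟩ : ∃ τ : ℝ, 0 < τ ∧ τ < τ₀ ∧ τ * ‖e‖ < r1 / 2 ∧ τ * ‖e‖ < r2 / 2 := by
    have h1 : ∀ᶠ τ : ℝ in 𝓝[>] 0, τ < τ₀ :=
      mem_nhdsWithin_of_mem_nhds (Iio_mem_nhds hτ₀)
    have h2 : Tendsto (fun τ : ℝ => τ * ‖e‖) (𝓝[>] 0) (𝓝 0) := by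
      have : Tendsto (fun τ : ℝ => τ * ‖e‖) (𝓝 0) (𝓝 (0 * ‖e‖)) :=
        (continuous_id.mul continuous_const).tendsto 0
      rw [zero_mul] at this
      exact this.mono_left nhdsWithin_le_nhds
    have h0 : ∀ᶠ τ : ℝ in 𝓝[>] 0, 0 < τ := self_mem_nhdsWithin
    exact (h0.and (h1.and ((h2.eventually (gt_mem_nhds (half_pos hr1))).and
      (h2.eventually (gt_mem_nhds (half_pos hr2)))))).exists
  obtain ⟨γ, hγ⟩ := iInf_lt_iff.1 hpq
  obtain ⟨h1, hγ⟩ := iInf_lt_iff.1 hγ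
  obtain ⟨h2, hγ⟩ := iInf_lt_iff.1 hγ
  obtain ⟨h3, hγ⟩ := iInf_lt_iff.1 hγ
  obtain ⟨h4, hγ⟩ := iInf_lt_iff.1 hγ
  have hball : ∀ t ∈ Icc (0:ℝ) 1, γ t ∈ U ∩ ball y R := by
    intro t ht
    refine ⟨h4 t ht, ?_⟩
    have : edist (γ t) (γ 0) < ENNReal.ofReal (R / 4) :=
      ((eVariationOn.edist_le γ ht (by simp)).trans_lt hγ).trans_le (min_le_right _ _)
    rw [edist_dist, ENNReal.ofReal_lt_ofReal_iff (by linarith), h2] at this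
    rw [mem_ball]
    linarith [dist_triangle (γ t) p y]
  have hΨc : ContinuousOn (Ψ ∘ γ) (Icc 0 1) :=
    (hcont.mono (inter_subset_inter_left _ subset_closure)).comp h1.continuous.continuousOn hball
  have hpath := pathInf_le_eVariationOn hV (γ := fun t => Ψ (γ t) + τ • e)
    (hΨc.add continuousOn_const) (fun t ht => hmem _ (hball t ht) τ hτ hτ2)
  refine ⟨(Ψ p + τ • e, Ψ q + τ • e), hSS ⟨hr1S ⟨?_, ?_⟩, hr2S ⟨?_, ?_⟩⟩, ?_⟩
  · rw [mem_ball, dist_eq_norm]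
    have : Ψ p + τ • e - Ψ a = (Ψ p - Ψ a) + τ • e := by abel
    rw [this]
    refine (norm_add_le _ _).trans_lt ?_
    rw [norm_smul, Real.norm_of_nonneg hτ.le, ← dist_eq_norm]
    linarith
  · exact hmem _ ⟨hpU, by rw [mem_ball]; linarith⟩ τ hτ hτ2
  · rw [mem_ball, dist_eq_norm]
    have : Ψ q + τ • e - Ψ b = (Ψ q - Ψ b) + τ • e := by abel
    rw [this]
    refine (norm_add_le _ _).trans_lt ?_
    rw [norm_smul, Real.norm_of_nonneg hτ.le, ← dist_eq_norm]
    linarith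
  · exact hmem _ ⟨hqU, by rw [mem_ball]; linarith⟩ τ hτ hτ2
  · simp only
    rw [h2, h3] at hpath
    refine hpath.trans (le_trans ?_ hγ.le)
    have hv : eVariationOn (fun t => Ψ (γ t) + τ • e) (Icc 0 1) ≤
        eVariationOn (Ψ ∘ γ) (Icc 0 1) :=
      eVariationOn_le_of_edist_le fun s _ t _ _ => by
        rw [edist_add_right]; rfl
    exact hv.trans (eVariationOn_comp_le_of_local h1.continuous.continuousOn hball hlen)

end Paths

section SmallDistance

variable {X : Type*} [NormedAddCommGroup X] [NormedSpace ℝ X]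

theorem pathInf_image_segment_le {U : Set X} (hU : IsOpen U) {ψ : X → X} {S : Set X}
    (hS : Convex ℝ S) {K : NNReal} (hψ : LipschitzOnWith K ψ S) (hSU : MapsTo ψ S U)
    {z w : X} (hz : z ∈ S) (hw : w ∈ S) :
    pathInf U (ψ z) (ψ w) ≤ ENNReal.ofReal (K * ‖w - z‖) := by
  have hmem : ∀ t ∈ Icc (0:ℝ) 1, z + t • (w - z) ∈ S := fun t ht =>
    hS.add_smul_sub_mem hz hw ht
  have hc : Continuous fun t : ℝ => z + t • (w - z) := by fun_prop
  have h := pathInf_le_eVariationOn hU (γ := fun t : ℝ => ψ (z + t • (w - z)))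
    (hψ.continuousOn.comp hc.continuousOn hmem) (fun t ht => hSU (hmem t ht))
  simp only [zero_smul, add_zero, one_smul, add_sub_cancel] at h
  refine h.trans ?_
  have hm : Monotone fun t : ℝ => t * (K * ‖w - z‖) := fun s t hst =>
    mul_le_mul_of_nonneg_right hst (by positivity)
  have he := (hm.monotoneOn (Icc 0 1)).eVariationOn_eq (a := 0) (b := 1) (by simp) (by simp)
  rw [inter_self, one_mul, zero_mul, sub_zero] at he
  rw [← he]
  refine eVariationOn_le_of_edist_le fun s hs t ht hst => ?_
  refine (hψ (hmem s hs) (hmem t ht)).trans ?_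
  rw [edist_dist, edist_dist, dist_eq_norm, Real.dist_eq, ← ENNReal.ofReal_coe_nnreal,
    ← ENNReal.ofReal_mul K.coe_nonneg]
  apply ENNReal.ofReal_le_ofReal
  rw [add_sub_add_left_eq_sub, ← sub_smul, norm_smul, ← sub_mul, abs_mul,
    abs_of_nonneg (by positivity : 0 ≤ K * ‖w - z‖), Real.norm_eq_abs]
  linarith

theorem relMetric_le_of_tendsto {ι : Type*} {l : Filter ι} [l.NeBot] {U : Set X} {a b : X}
    {P Q : ι → X} (hP : Tendsto P l (𝓝[U] a)) (hQ : Tendsto Q l (𝓝[U] b)) {c : ℝ≥0∞}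
    (h : ∀ᶠ i in l, pathInf U (P i) (Q i) ≤ c) : relMetric U a b ≤ c :=
  Filter.liminf_le_of_frequently_le' ((hP.prodMk hQ).frequently h.frequently)

theorem subset_or_subset_compl_of_disjoint_frontier {Z : Type*} [TopologicalSpace Z] {S U : Set Z} (hS : IsPreconnected S)
    (h : Disjoint S (frontier U)) : S ⊆ U ∨ S ⊆ Uᶜ := by
  by_contra! hn
  obtain ⟨⟨x, hx, hxU⟩, ⟨z, hz, hzU⟩⟩ := And.intro (not_subset.1 hn.1) (not_subset.1 hn.2)
  have hd : ∀ w ∈ S, w ∈ closure U → w ∈ interior U := fun w hw hc =>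
    not_not.1 fun hi => disjoint_left.1 h hw ⟨hc, hi⟩
  obtain ⟨w, -, h1, h2⟩ := hS (interior U) (closure U)ᶜ isOpen_interior isClosed_closure.isOpen_compl
    (fun w hw => or_iff_not_imp_right.2 fun hc => hd w hw (not_not.1 hc))
    ⟨z, hz, hd z hz (subset_closure (not_not.1 hzU))⟩
    ⟨x, hx, fun hc => hxU (interior_subset (hd x hx hc))⟩
  exact h2 (subset_closure (interior_subset h1))

theorem exists_relMetric_lt_near {U : Set X} (hUo : IsOpen U) (hU : C1Bdry U) {y : X}
    (hy : y ∈ frontier U) {η : ℝ≥0∞} (hη : 0 < η) :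
    ∃ s > 0, ∀ a ∈ frontier U, ∀ b ∈ frontier U, dist a y < s → dist b y < s →
      relMetric U a b < η := by
  obtain ⟨W, W', φ, ψ, ℓ, hW, hyW, hW', hℓ, hφ, hψ, m1, m2, i1, i2, e⟩ := hU y hy
  have hzero : ∀ z ∈ W, z ∈ frontier U ↔ ℓ (φ z) = 0 := by
    intro z hz
    constructor
    · intro h
      have : φ z ∈ W' ∩ {y | ℓ y = 0} := e ▸ mem_image_of_mem φ ⟨hz, h⟩
      exact this.2
    · intro h
      have : φ z ∈ φ '' (W ∩ frontier U) := e ▸ ⟨m1 hz, h⟩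
      obtain ⟨w, ⟨hw, hwf⟩, hwz⟩ := this
      rw [← i1 z hz, ← hwz, i1 w hw]
      exact hwf
  obtain ⟨v, hv⟩ : ∃ v, ℓ v ≠ 0 := by
    by_contra! h
    exact hℓ (ContinuousLinearMap.ext h)
  have hz0 : φ y ∈ W' := m1 hyW
  have hψat : ContDiffAt ℝ 1 ψ (φ y) := hψ.contDiffAt (hW'.mem_nhds hz0)
  obtain ⟨K, t, ht, hK⟩ := hψat.exists_lipschitzOnWith
  obtain ⟨ρ, hρ, hρt⟩ := Metric.mem_nhds_iff.1 (inter_mem ht (hW'.mem_nhds hz0))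
  have hφc : ContinuousAt φ y := (hφ.continuousOn).continuousAt (hW.mem_nhds hyW)
  obtain ⟨u, ⟨huW, hub⟩, huU⟩ : ((W ∩ φ ⁻¹' ball (φ y) ρ) ∩ U).Nonempty :=
    mem_closure_iff_nhds.1 (frontier_subset_closure hy) _
      (inter_mem (hW.mem_nhds hyW) (hφc (ball_mem_nhds _ hρ)))
  have huf : u ∉ frontier U := fun h => (hUo.inter_frontier_eq.subset ⟨huU, h⟩ : u ∈ (∅ : Set X))
  have hune : ℓ (φ u) ≠ 0 := fun h => huf ((hzero u huW).2 h)
  set H : Set X := ball (φ y) ρ ∩ {z | 0 < ℓ (φ u) * ℓ z} with hH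
  have hHc : Convex ℝ H := (convex_ball _ _).inter
    (convex_halfSpace_gt (ℓ (φ u) • ℓ : X →L[ℝ] ℝ).toLinearMap.isLinear 0)
  have hHW' : H ⊆ W' := fun z hz => (hρt hz.1).2
  have hψH : IsPreconnected (ψ '' H) :=
    hHc.isPreconnected.image ψ (hψ.continuousOn.mono hHW')
  have hHU : ψ '' H ⊆ U := by
    rcases subset_or_subset_compl_of_disjoint_frontier (U := U) hψH (by
      rw [disjoint_left]
      rintro _ ⟨z, hz, rfl⟩ hf
      have := (hzero _ (m2 (hHW' hz))).1 hf
      rw [i2 z (hHW' hz)] at this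
      have h2 := hz.2
      simp [this] at h2) with h | h
    · exact h
    · exact absurd huU (h ⟨φ u, ⟨hub, by simpa using mul_self_pos.2 hune⟩, i1 u huW⟩)
  set n : X := (ℓ (φ u) * (ℓ v)⁻¹) • v with hn
  have hℓn : ℓ n = ℓ (φ u) := by simp [hn, hv]
  obtain ⟨η', hη'0, hη'⟩ : ∃ η' : ℝ, 0 < η' ∧ ENNReal.ofReal η' < η := by
    obtain ⟨c, hc0, hc⟩ := ENNReal.lt_iff_exists_real_btwn.1 hη
    refine ⟨c, ?_, hc.2⟩
    have := hc.1
    simpa using this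
  set ρ' := min ρ (η' / (2 * (K + 1))) with hρ'
  have hρ'0 : 0 < ρ' := lt_min hρ (by positivity)
  obtain ⟨s, hs, hsb⟩ := Metric.mem_nhds_iff.1
    (inter_mem (hW.mem_nhds hyW) (hφc (ball_mem_nhds _ hρ'0)))
  refine ⟨s, hs, fun a ha b hb has hbs => lt_of_le_of_lt ?_ hη'⟩
  have pt : ∀ a ∈ frontier U, dist a y < s → Tendsto (fun τ : ℝ => φ a + τ • n) (𝓝[>] 0)
      (𝓝 (φ a)) := by
    intro a _ _
    have : Tendsto (fun τ : ℝ => φ a + τ • n) (𝓝 0) (𝓝 (φ a + (0:ℝ) • n)) :=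
      (by fun_prop : Continuous fun τ : ℝ => φ a + τ • n).tendsto 0
    rw [zero_smul, add_zero] at this
    exact this.mono_left nhdsWithin_le_nhds
  have pin : ∀ a ∈ frontier U, dist a y < s → ∀ᶠ τ : ℝ in 𝓝[>] 0, φ a + τ • n ∈ H := by
    intro a ha has
    have h1 : φ a ∈ ball (φ y) ρ := ball_subset_ball (min_le_left _ _) (hsb has).2
    filter_upwards [(pt a ha has).eventually (isOpen_ball.mem_nhds h1), self_mem_nhdsWithin]
      with τ hτ1 hτ2
    refine ⟨hτ1, ?_⟩
    have : ℓ (φ a) = 0 := (hzero a (hsb has).1).1 ha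
    simp only [mem_ofPred_eq, map_add, this, map_smul, hℓn, zero_add, smul_eq_mul]
    have := mul_pos (mem_Ioi.1 hτ2) (mul_self_pos.2 hune)
    linarith
  have pψ : ∀ a ∈ frontier U, dist a y < s →
      Tendsto (fun τ : ℝ => ψ (φ a + τ • n)) (𝓝[>] 0) (𝓝[U] a) := by
    intro a ha has
    refine tendsto_nhdsWithin_iff.2 ⟨?_, ?_⟩
    · have h1 : ContinuousAt ψ (φ a) :=
        hψ.continuousOn.continuousAt (hW'.mem_nhds (m1 (hsb has).1))
      have := h1.tendsto.comp (pt a ha has)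
      rwa [i1 a (hsb has).1] at this
    · filter_upwards [pin a ha has] with τ hτ using hHU (mem_image_of_mem _ hτ)
  refine relMetric_le_of_tendsto (pψ a ha has) (pψ b hb hbs) ?_
  filter_upwards [pin a ha has, pin b hb hbs] with τ hτa hτb
  refine (pathInf_image_segment_le hUo hHc (hK.mono fun z hz => (hρt hz.1).1)
    (mapsTo_iff_image_subset.2 hHU) hτa hτb).trans (ENNReal.ofReal_le_ofReal ?_)
  rw [add_sub_add_right_eq_sub]
  have h1 : dist (φ a) (φ y) < ρ' := (hsb has).2
  have h2 : dist (φ b) (φ y) < ρ' := (hsb hbs).2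
  have h3 : ‖φ b - φ a‖ ≤ 2 * (η' / (2 * (K + 1))) := by
    rw [← dist_eq_norm]
    have := dist_triangle_right (φ b) (φ a) (φ y)
    have := min_le_right ρ (η' / (2 * (K + 1)))
    linarith
  have hK0 : (0:ℝ) ≤ K := K.coe_nonneg
  calc (K:ℝ) * ‖φ b - φ a‖ ≤ (K + 1) * (2 * (η' / (2 * (K + 1)))) :=
        mul_le_mul (by linarith) h3 (norm_nonneg _) (by linarith)
    _ = η' := by field_simp

/-- `f` does not increase the relative metric of the boundary near `y`. -/
def RelContracts (U V : Set X) (f : X → X) (y : X) : Prop :=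
  ∃ r : ℝ, 0 < r ∧ ∀ a ∈ frontier U, ∀ b ∈ frontier U, dist a y < r → dist b y < r →
    relMetric U a b < ENNReal.ofReal r → relMetric V (f a) (f b) ≤ relMetric U a b

theorem bdryLocalIsometry_of_relContracts {U V : Set X} (hUo : IsOpen U) (hU : C1Bdry U)
    {f g : X → X} (hf : BijOn f (frontier U) (frontier V))
    (hg : ∀ a ∈ frontier U, g (f a) = a)
    (hcont : ContinuousOn f (frontier U))
    (h1 : ∀ y ∈ frontier U, RelContracts U V f y)
    (h2 : ∀ y ∈ frontier U, RelContracts V U g (f y)) : BdryLocalIsometry U V f := by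
  refine ⟨hf, fun y hy => ?_⟩
  obtain ⟨r1, hr1, H1⟩ := h1 y hy
  obtain ⟨r2, hr2, H2⟩ := h2 y hy
  set r := min r1 r2 with hr
  have hr0 : 0 < r := lt_min hr1 hr2
  obtain ⟨s, hs, H3⟩ := exists_relMetric_lt_near hUo hU hy (η := ENNReal.ofReal r)
    (ENNReal.ofReal_pos.2 hr0)
  obtain ⟨s', hs', H4⟩ := Metric.continuousWithinAt_iff.1 (hcont y hy) r2 hr2
  refine ⟨ENNReal.ofReal (min s (min s' r)), ENNReal.ofReal_pos.2 (by positivity),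
    fun a ha b hb ha' hb' => ?_⟩
  have conv : ∀ a, relMetric U a y < ENNReal.ofReal (min s (min s' r)) →
      dist a y < min s (min s' r) := by
    intro a h
    have := (edist_le_relMetric U a y).trans_lt h
    rwa [edist_dist, ENNReal.ofReal_lt_ofReal_iff (by positivity)] at this
  have da := conv a ha'
  have db := conv b hb'
  simp only [lt_min_iff] at da db
  have hab := H3 a ha b hb da.1 db.1
  have hle := H1 a ha b hb (da.2.2.trans_le (min_le_left _ _)) (db.2.2.trans_le (min_le_left _ _))
    (hab.trans_le (ENNReal.ofReal_le_ofReal (min_le_left _ _)))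
  refine le_antisymm ?_ hle
  have := H2 (f a) (hf.mapsTo ha) (f b) (hf.mapsTo hb) (H4 ha da.2.1) (H4 hb db.2.1)
    ((hle.trans_lt hab).trans_le (ENNReal.ofReal_le_ofReal (min_le_right _ _)))
  rwa [hg a ha, hg b hb] at this

end SmallDistance

section Diffeo

variable {X : Type*} [NormedAddCommGroup X] [NormedSpace ℝ X]

/-- `Φ` restricts to a `C¹` diffeomorphism of the open set `O` onto its image. -/
structure DiffeoOn (Φ : X → X) (O : Set X) : Prop where
  isOpen : IsOpen O
  contDiffOn : ContDiffOn ℝ 1 Φ O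
  injOn : InjOn Φ O
  deriv : ∀ z ∈ O, ∃ e : X ≃L[ℝ] X, HasFDerivAt Φ (e : X →L[ℝ] X) z

theorem DiffeoOn.map_nhds [CompleteSpace X] {Φ : X → X} {O : Set X} (h : DiffeoOn Φ O) {z : X} (hz : z ∈ O) :
    map Φ (𝓝 z) = 𝓝 (Φ z) := by
  obtain ⟨e, he⟩ := h.deriv z hz
  exact ((h.contDiffOn.contDiffAt (h.isOpen.mem_nhds hz)).hasStrictFDerivAt' he
    one_ne_zero).map_nhds_eq_of_equiv

theorem DiffeoOn.isOpen_image [CompleteSpace X] {Φ : X → X} {O S : Set X} (h : DiffeoOn Φ O) (hS : IsOpen S)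
    (hSO : S ⊆ O) : IsOpen (Φ '' S) := by
  rw [isOpen_iff_mem_nhds]
  rintro _ ⟨z, hz, rfl⟩
  rw [← h.map_nhds (hSO hz)]
  exact image_mem_map (hS.mem_nhds hz)

theorem DiffeoOn.leftInv {Φ : X → X} {O : Set X} (h : DiffeoOn Φ O) {z : X} (hz : z ∈ O) :
    Function.invFunOn Φ O (Φ z) = z :=
  h.injOn.leftInvOn_invFunOn hz

theorem DiffeoOn.contDiffOn_inv [CompleteSpace X] {Φ : X → X} {O : Set X} (h : DiffeoOn Φ O) :
    ContDiffOn ℝ 1 (Function.invFunOn Φ O) (Φ '' O) := by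
  rcases O.eq_empty_or_nonempty with rfl | hne
  · simp
  obtain ⟨o, -⟩ := hne
  have : Nonempty X := ⟨o⟩
  let P : PartialEquiv X X := h.injOn.toPartialEquiv
  have hopen : IsOpenMap (P.source.domRestrict P) := by
    intro S hS
    have : P.source.domRestrict P '' S = Φ '' (Subtype.val '' S) := by
      rw [image_image]; rfl
    rw [this]
    exact h.isOpen_image (h.isOpen.isOpenMap_subtype_val S hS) (by
      rintro _ ⟨s, -, rfl⟩; exact s.2)
  let Q := OpenPartialHomeomorph.ofContinuousOpenRestrict P h.contDiffOn.continuousOn hopen h.isOpen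
  rintro _ ⟨z, hz, rfl⟩
  have hsymm : Q.symm (Φ z) = z := h.leftInv hz
  obtain ⟨e, he⟩ := h.deriv z hz
  refine ContDiffAt.contDiffWithinAt ?_
  refine Q.contDiffAt_symm (f₀' := e) (mem_image_of_mem _ hz) ?_ ?_
  · rw [hsymm]; exact he
  · rw [hsymm]; exact h.contDiffOn.contDiffAt (h.isOpen.mem_nhds hz)

theorem DiffeoOn.closure_image {Φ : X → X} {O U : Set X} (h : DiffeoOn Φ O)
    (hUO : closure U ⊆ O) (hcl : IsClosed (Φ '' closure U)) :
    closure (Φ '' U) = Φ '' closure U := by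
  refine subset_antisymm (closure_minimal (image_mono subset_closure) hcl) ?_
  exact (h.contDiffOn.continuousOn.mono hUO).image_closure

theorem DiffeoOn.frontier_image [CompleteSpace X] {Φ : X → X} {O U : Set X} (h : DiffeoOn Φ O)
    (hU : IsOpen U) (hUO : closure U ⊆ O) (hcl : IsClosed (Φ '' closure U)) :
    frontier (Φ '' U) = Φ '' frontier U := by
  rw [(h.isOpen_image hU (subset_closure.trans hUO)).frontier_eq, h.closure_image hUO hcl,
    hU.frontier_eq, (h.injOn.mono hUO).image_sdiff_subset subset_closure]

theorem DiffeoOn.c1Domain_image [CompleteSpace X] {Φ : X → X} {O U : Set X} (h : DiffeoOn Φ O)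
    (hU : C1Domain U) (hUO : closure U ⊆ O) (hcl : IsClosed (Φ '' closure U)) :
    C1Domain (Φ '' U) := by
  obtain ⟨h1, h2, h3⟩ := hU
  have hO := h.contDiffOn.continuousOn
  refine ⟨h.isOpen_image h1 (subset_closure.trans hUO),
    h2.image _ (hO.mono (subset_closure.trans hUO)), ?_⟩
  rw [C1Bdry, h.frontier_image h1 hUO hcl]
  rintro _ ⟨x, hx, rfl⟩
  obtain ⟨W, W', φ, ψ, ℓ, hW, hxW, hW', hℓ, hφ, hψ, m1, m2, i1, i2, e⟩ := h3 x hx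
  have hfO : frontier U ⊆ O := frontier_subset_closure.trans hUO
  set g := Function.invFunOn Φ O with hg
  have hgΦ : ∀ z ∈ O, g (Φ z) = z := fun z hz => h.leftInv hz
  refine ⟨Φ '' (W ∩ O), W' ∩ ψ ⁻¹' O, φ ∘ g, Φ ∘ ψ, ℓ,
    h.isOpen_image (hW.inter h.isOpen) inter_subset_right, ⟨x, ⟨hxW, hfO hx⟩, rfl⟩,
    hψ.continuousOn.isOpen_inter_preimage hW' h.isOpen, hℓ, ?_, ?_, ?_, ?_, ?_, ?_, ?_⟩
  · refine hφ.comp (h.contDiffOn_inv.mono (image_mono inter_subset_right)) ?_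
    rintro _ ⟨z, hz, rfl⟩
    rw [hgΦ z hz.2]
    exact hz.1
  · exact h.contDiffOn.comp (hψ.mono inter_subset_left) fun z hz => hz.2
  · rintro _ ⟨z, hz, rfl⟩
    simp only [Function.comp, hgΦ z hz.2, mem_inter_iff, mem_preimage, i1 z hz.1]
    exact ⟨m1 hz.1, hz.2⟩
  · intro z hz
    exact ⟨ψ z, ⟨m2 hz.1, hz.2⟩, rfl⟩
  · rintro _ ⟨z, hz, rfl⟩
    simp only [Function.comp, hgΦ z hz.2, i1 z hz.1]
  · intro z hz
    simp only [Function.comp, hgΦ _ hz.2, i2 z hz.1]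
  · have key : φ '' (W ∩ frontier U) = W' ∩ ψ ⁻¹' O ∩ {y | ℓ y = 0} := by
      rw [e]
      ext w
      constructor
      · rintro ⟨hw, hw0⟩
        have : w ∈ φ '' (W ∩ frontier U) := e ▸ ⟨hw, hw0⟩
        obtain ⟨z, ⟨hz, hzf⟩, rfl⟩ := this
        exact ⟨⟨hw, by simpa [i1 z hz] using hfO hzf⟩, hw0⟩
      · rintro ⟨⟨hw, -⟩, hw0⟩
        exact ⟨hw, hw0⟩
    rw [← key]
    ext w
    constructor
    · rintro ⟨_, ⟨⟨z, hz, rfl⟩, ⟨z', hz', hzz⟩⟩, rfl⟩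
      have : z' = z := h.injOn (hfO hz') hz.2 hzz
      subst this
      exact ⟨z', ⟨hz.1, hz'⟩, by simp [hgΦ z' hz.2]⟩
    · rintro ⟨z, hz, rfl⟩
      exact ⟨Φ z, ⟨⟨z, ⟨hz.1, hfO hz.2⟩, rfl⟩, ⟨z, hz.2, rfl⟩⟩, by simp [hgΦ z (hfO hz.2)]⟩

end Diffeo

section Shear

theorem exists_equiv_of_injective (L : ℂ →L[ℝ] ℂ) (hL : ∀ v, L v = 0 → v = 0) :
    ∃ e : ℂ ≃L[ℝ] ℂ, (e : ℂ →L[ℝ] ℂ) = L := by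
  have hinj : Function.Injective (L : ℂ →ₗ[ℝ] ℂ) := (injective_iff_map_eq_zero _).2 hL
  refine ⟨(LinearEquiv.ofInjectiveEndo (L : ℂ →ₗ[ℝ] ℂ) hinj).toContinuousLinearEquiv, ?_⟩
  exact ContinuousLinearMap.ext fun v => rfl

/-- The vertical shear `(x, y) ↦ (x, y + χ(y) h(x))`. -/
def shear (χ h : ℝ → ℝ) (z : ℂ) : ℂ := z + ((χ z.im * h z.re : ℝ) : ℂ) * Complex.I

@[simp] theorem shear_re (χ h : ℝ → ℝ) (z : ℂ) : (shear χ h z).re = z.re := by simp [shear]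

@[simp] theorem shear_im (χ h : ℝ → ℝ) (z : ℂ) :
    (shear χ h z).im = z.im + χ z.im * h z.re := by
  simp [shear]

variable {χ h : ℝ → ℝ}

theorem hasFDerivAt_shear {z : ℂ} {a b : ℝ} (hχ : HasDerivAt χ a z.im) (hh : HasDerivAt h b z.re) :
    HasFDerivAt (shear χ h) (ContinuousLinearMap.id ℝ ℂ +
      (χ z.im • (b • Complex.reCLM) + h z.re • (a • Complex.imCLM)).smulRight Complex.I) z := by
  have h1 : HasFDerivAt (fun w : ℂ => χ w.im) (a • Complex.imCLM) z :=
    hχ.comp_hasFDerivAt z (f := fun w : ℂ => w.im) Complex.imCLM.hasFDerivAt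
  have h2 : HasFDerivAt (fun w : ℂ => h w.re) (b • Complex.reCLM) z :=
    hh.comp_hasFDerivAt z (f := fun w : ℂ => w.re) Complex.reCLM.hasFDerivAt
  have h3 := (h1.mul h2).smul_const Complex.I
  have h4 := (hasFDerivAt_id z).add h3
  refine h4.congr_of_eventuallyEq (Eventually.of_forall fun w => ?_)
  simp [shear]

theorem shear_section_strictMono (hχ : ContDiff ℝ 1 χ)
    (hpos : ∀ x y, 0 < 1 + deriv χ y * h x) (x : ℝ) : StrictMono fun y => y + χ y * h x := by
  refine strictMono_of_deriv_pos fun y => ?_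
  have : HasDerivAt (fun y => y + χ y * h x) (1 + deriv χ y * h x) y :=
    (hasDerivAt_id y).add (((hχ.differentiable one_ne_zero) y).hasDerivAt.mul_const _)
  rw [this.deriv]
  exact hpos x y

theorem shear_bijective (hχ : ContDiff ℝ 1 χ) (hb : ∀ y, |χ y| ≤ 1)
    (hpos : ∀ x y, 0 < 1 + deriv χ y * h x) : Function.Bijective (shear χ h) := by
  constructor
  · intro z w hzw
    have h1 : z.re = w.re := by simpa using congrArg Complex.re hzw
    have h2 := congrArg Complex.im hzw
    simp only [shear_im, h1] at h2
    exact Complex.ext h1 ((shear_section_strictMono hχ hpos w.re).injective h2)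
  · intro w
    have hc : Continuous fun y => y + χ y * h w.re :=
      continuous_id.add (hχ.continuous.mul continuous_const)
    have hbd : ∀ y, |χ y * h w.re| ≤ |h w.re| := fun y => by
      rw [abs_mul]
      exact mul_le_of_le_one_left (abs_nonneg _) (hb y)
    have ht : Tendsto (fun y => y + χ y * h w.re) atTop atTop :=
      tendsto_atTop_mono (fun y => by have := abs_le.1 (hbd y); simp only [id]; linarith)
        (tendsto_atTop_add_const_right _ (-|h w.re|) tendsto_id)
    have hbot : Tendsto (fun y => y + χ y * h w.re) atBot atBot :=
      tendsto_atBot_mono (fun y => by have := abs_le.1 (hbd y); simp only [id]; linarith)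
        (tendsto_atBot_add_const_right _ (|h w.re|) tendsto_id)
    obtain ⟨y, hy⟩ := hc.surjective ht hbot w.im
    refine ⟨⟨w.re, y⟩, Complex.ext (by simp) ?_⟩
    simpa using hy

theorem shear_diffeoOn (hχ : ContDiff ℝ 1 χ) (hh : ContDiff ℝ 1 h) (hb : ∀ y, |χ y| ≤ 1)
    (hpos : ∀ x y, 0 < 1 + deriv χ y * h x) : DiffeoOn (shear χ h) univ := by
  refine ⟨isOpen_univ, ?_, (shear_bijective hχ hb hpos).1.injOn, fun z _ => ?_⟩
  · refine ContDiff.contDiffOn ?_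
    unfold shear
    refine contDiff_id.add (ContDiff.mul ?_ contDiff_const)
    refine Complex.ofRealCLM.contDiff.comp (ContDiff.mul ?_ ?_)
    · exact hχ.comp Complex.imCLM.contDiff
    · exact hh.comp Complex.reCLM.contDiff
  · have hd := hasFDerivAt_shear ((hχ.differentiable one_ne_zero) z.im).hasDerivAt
      ((hh.differentiable one_ne_zero) z.re).hasDerivAt
    obtain ⟨e, he⟩ := exists_equiv_of_injective _ (fun v hv => by
      have h1 := congrArg Complex.re hv
      have h2 := congrArg Complex.im hv
      simp at h1 h2
      rw [h1] at h2
      have h3 : v.im * (1 + deriv χ z.im * h z.re) = 0 := by linarith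
      rcases mul_eq_zero.1 h3 with h4 | h4
      · exact Complex.ext h1 h4
      · exact absurd h4 (hpos _ _).ne' : ∀ v, (ContinuousLinearMap.id ℝ ℂ +
      (χ z.im • (deriv h z.re • Complex.reCLM) + h z.re • (deriv χ z.im • Complex.imCLM)).smulRight
        Complex.I) v = 0 → v = 0)
    exact ⟨e, he ▸ hd⟩

theorem shear_image_isClosed (hχ : ContDiff ℝ 1 χ) (hh : ContDiff ℝ 1 h) (hb : ∀ y, |χ y| ≤ 1)
    (hpos : ∀ x y, 0 < 1 + deriv χ y * h x) {C : Set ℂ} (hC : IsClosed C) :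
    IsClosed (shear χ h '' C) := by
  rw [← isOpen_compl_iff, ← image_compl_eq (shear_bijective hχ hb hpos)]
  exact (shear_diffeoOn hχ hh hb hpos).isOpen_image hC.isOpen_compl (subset_univ _)

theorem c1Domain_shear (hχ : ContDiff ℝ 1 χ) (hh : ContDiff ℝ 1 h) (hb : ∀ y, |χ y| ≤ 1)
    (hpos : ∀ x y, 0 < 1 + deriv χ y * h x) {U : Set ℂ} (hU : C1Domain U) :
    C1Domain (shear χ h '' U) ∧ frontier (shear χ h '' U) = shear χ h '' frontier U :=
  have hd := shear_diffeoOn hχ hh hb hpos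
  have hc := shear_image_isClosed hχ hh hb hpos (C := closure U) isClosed_closure
  ⟨hd.c1Domain_image hU (subset_univ _) hc, hd.frontier_image hU.1 (subset_univ _) hc⟩

end Shear

section OneSided

theorem notMem_frontier_iff_eventually {Z : Type*} [TopologicalSpace Z] {A : Set Z} {x : Z} :
    x ∉ frontier A ↔ ∀ᶠ z in 𝓝 x, (z ∈ A ↔ x ∈ A) := by
  rw [frontier, Set.mem_sdiff, not_and_not_right, mem_closure_iff_frequently, mem_interior_iff_mem_nhds]
  constructor
  · intro h
    by_cases hx : ∃ᶠ z in 𝓝 x, z ∈ A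
    · have := h hx
      filter_upwards [this] with z hz using iff_of_true hz (mem_of_mem_nhds this)
    · have := not_frequently.1 hx
      filter_upwards [this] with z hz using iff_of_false hz this.self_of_nhds
  · intro h hf
    obtain ⟨z, hz, hzx⟩ := (hf.and_eventually h).exists
    filter_upwards [h] with w hw using hw.2 (hzx.1 hz)

variable {X : Type*} [NormedAddCommGroup X] [NormedSpace ℝ X]

/-- A boundary chart flattens the boundary. -/
theorem C1Bdry.exists_chart {U : Set X} (hU : C1Bdry U) {x : X} (hx : x ∈ frontier U) :
    ∃ (W W' : Set X) (φ ψ : X → X) (ℓ : X →L[ℝ] ℝ) (n : X),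
      IsOpen W ∧ x ∈ W ∧ IsOpen W' ∧ ℓ n = 1 ∧ ContDiffOn ℝ 1 φ W ∧ ContDiffOn ℝ 1 ψ W' ∧
      MapsTo φ W W' ∧ MapsTo ψ W' W ∧ (∀ z ∈ W, ψ (φ z) = z) ∧ (∀ z ∈ W', φ (ψ z) = z) ∧
      ∀ z ∈ W, z ∈ frontier U ↔ ℓ (φ z) = 0 := by
  obtain ⟨W, W', φ, ψ, ℓ, hW, hxW, hW', hℓ, hφ, hψ, m1, m2, i1, i2, e⟩ := hU x hx
  obtain ⟨v, hv⟩ : ∃ v, ℓ v ≠ 0 := by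
    by_contra! h
    exact hℓ (ContinuousLinearMap.ext h)
  refine ⟨W, W', φ, ψ, ℓ, (ℓ v)⁻¹ • v, hW, hxW, hW', by simp [hv], hφ, hψ, m1, m2, i1, i2, ?_⟩
  intro z hz
  constructor
  · intro h
    have : φ z ∈ W' ∩ {y | ℓ y = 0} := e ▸ mem_image_of_mem φ ⟨hz, h⟩
    exact this.2
  · intro h
    have : φ z ∈ φ '' (W ∩ frontier U) := e ▸ ⟨m1 hz, h⟩
    obtain ⟨w, ⟨hw, hwf⟩, hwz⟩ := this
    rw [← i1 z hz, ← hwz, i1 w hw]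
    exact hwf

theorem C1Bdry.exists_local_sides {U : Set X} (hU : C1Bdry U) {x : X} (hx : x ∈ frontier U)
    {N : Set X} (hN : N ∈ 𝓝 x) :
    ∃ S₁ S₂ : Set X, IsPreconnected S₁ ∧ IsPreconnected S₂ ∧ S₁ ⊆ N \ frontier U ∧
      S₂ ⊆ N \ frontier U ∧ ∀ᶠ z in 𝓝[(frontier U)ᶜ] x, z ∈ S₁ ∪ S₂ := by
  obtain ⟨W, W', φ, ψ, ℓ, n, hW, hxW, hW', hn, hφ, hψ, m1, m2, i1, i2, e⟩ := hU.exists_chart hx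
  have hψc : ContinuousAt ψ (φ x) := hψ.continuousOn.continuousAt (hW'.mem_nhds (m1 hxW))
  have hφc : ContinuousAt φ x := hφ.continuousOn.continuousAt (hW.mem_nhds hxW)
  have hN' : ψ ⁻¹' N ∈ 𝓝 (φ x) := hψc (by rwa [i1 x hxW])
  obtain ⟨ρ, hρ, hρN⟩ := Metric.mem_nhds_iff.1 (inter_mem hN' (hW'.mem_nhds (m1 hxW)))
  have main : ∀ ℓ' : X →L[ℝ] ℝ, (ℓ' = ℓ ∨ ℓ' = -ℓ) →
      IsPreconnected (ψ '' (ball (φ x) ρ ∩ {z | 0 < ℓ' z})) ∧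
      ψ '' (ball (φ x) ρ ∩ {z | 0 < ℓ' z}) ⊆ N \ frontier U := by
    intro ℓ' hℓ'
    constructor
    · exact ((convex_ball _ _).inter
        (convex_halfSpace_gt ℓ'.toLinearMap.isLinear 0)).isPreconnected.image ψ
        (hψ.continuousOn.mono fun z hz => (hρN hz.1).2)
    · rintro _ ⟨z, hz, rfl⟩
      refine ⟨(hρN hz.1).1, fun h => ?_⟩
      have h0 := (e _ (m2 (hρN hz.1).2)).1 h
      rw [i2 z (hρN hz.1).2] at h0
      have h1 := hz.2
      rcases hℓ' with rfl | rfl <;> simp [h0] at h1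
  refine ⟨_, _, (main ℓ (Or.inl rfl)).1, (main (-ℓ) (Or.inr rfl)).1, (main ℓ (Or.inl rfl)).2,
    (main (-ℓ) (Or.inr rfl)).2, ?_⟩
  filter_upwards [self_mem_nhdsWithin, mem_nhdsWithin_of_mem_nhds (inter_mem (hW.mem_nhds hxW)
    (hφc (ball_mem_nhds _ hρ)))] with z hz hzW
  have hne : ℓ (φ z) ≠ 0 := fun h => hz ((e z hzW.1).2 h)
  rcases lt_or_gt_of_ne hne with h | h
  · exact Or.inr ⟨φ z, ⟨hzW.2, by simpa using h⟩, i1 z hzW.1⟩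
  · exact Or.inl ⟨φ z, ⟨hzW.2, h⟩, i1 z hzW.1⟩

/-- `A` switches exactly along `M` within `Q`. -/
def IsCut {Z : Type*} [TopologicalSpace Z] (M A Q : Set Z) : Prop :=
  Q ∩ frontier A ⊆ M ∧ ∀ x ∈ Q ∩ M, (∃ᶠ z in 𝓝[Mᶜ] x, z ∈ A) ∧ ∃ᶠ z in 𝓝[Mᶜ] x, z ∉ A

theorem IsCut.mono {Z : Type*} [TopologicalSpace Z] {M A Q Q' : Set Z} (h : IsCut M A Q)
    (hQ : Q' ⊆ Q) : IsCut M A Q' :=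
  ⟨(inter_subset_inter_left _ hQ).trans h.1, fun x hx => h.2 x ⟨hQ hx.1, hx.2⟩⟩

theorem IsCut.compl {Z : Type*} [TopologicalSpace Z] {M A Q : Set Z} (h : IsCut M A Q) :
    IsCut M Aᶜ Q := by
  refine ⟨by rw [frontier_compl]; exact h.1, fun x hx => ⟨(h.2 x hx).2, ?_⟩⟩
  simpa using (h.2 x hx).1

theorem IsCut.congr {Z : Type*} [TopologicalSpace Z] {M A B Q : Set Z} (hQ : IsOpen Q)
    (hM : IsClosed M) (h : IsCut M A Q) (hAB : ∀ z ∈ Q, z ∉ M → (z ∈ A ↔ z ∈ B)) :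
    IsCut M B Q := by
  constructor
  · rintro x ⟨hxQ, hxB⟩
    by_contra hxM
    have hA : x ∉ frontier A := fun hA => hxM (h.1 ⟨hxQ, hA⟩)
    rw [notMem_frontier_iff_eventually] at hA
    refine notMem_frontier_iff_eventually.2 ?_ hxB
    filter_upwards [hA, hQ.mem_nhds hxQ, hM.isOpen_compl.mem_nhds hxM] with z h1 h2 h3
    rw [← hAB z h2 h3, ← hAB x hxQ hxM, h1]
  · intro x hx
    have hev : ∀ᶠ z in 𝓝[Mᶜ] x, (z ∈ A ↔ z ∈ B) := by
      filter_upwards [self_mem_nhdsWithin, mem_nhdsWithin_of_mem_nhds (hQ.mem_nhds hx.1)]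
        with z h1 h2 using hAB z h2 h1
    refine ⟨(h.2 x hx).1.mp ?_, (h.2 x hx).2.mp ?_⟩
    · filter_upwards [hev] with z hz using hz.1
    · filter_upwards [hev] with z hz h hB using h (hz.2 hB)

theorem IsCut.sides {Z : Type*} [TopologicalSpace Z] {M A I S₁ S₂ : Set Z} {x : Z}
    (hA : IsCut M A I) (hx : x ∈ I) (hxM : x ∈ M) (c1 : IsPreconnected S₁)
    (c2 : IsPreconnected S₂) (s1 : S₁ ⊆ I \ M) (s2 : S₂ ⊆ I \ M)
    (hS : ∀ᶠ z in 𝓝[Mᶜ] x, z ∈ S₁ ∪ S₂) : (S₁ ⊆ A ∧ S₂ ⊆ Aᶜ) ∨ (S₁ ⊆ Aᶜ ∧ S₂ ⊆ A) := by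
  have key : ∀ S : Set Z, IsPreconnected S → S ⊆ I \ M → S ⊆ A ∨ S ⊆ Aᶜ := fun S hc hs =>
    subset_or_subset_compl_of_disjoint_frontier hc
      (disjoint_left.2 fun z hz hf => (hs hz).2 (hA.1 ⟨(hs hz).1, hf⟩))
  obtain ⟨f1, f2⟩ := hA.2 x ⟨hx, hxM⟩
  rcases key S₁ c1 s1 with h1 | h1 <;> rcases key S₂ c2 s2 with h2 | h2
  · obtain ⟨z, hz, hz'⟩ := (f2.and_eventually hS).exists
    exact absurd (hz'.elim (fun h => h1 h) fun h => h2 h) hz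
  · exact Or.inl ⟨h1, h2⟩
  · exact Or.inr ⟨h1, h2⟩
  · obtain ⟨z, hz, hz'⟩ := (f1.and_eventually hS).exists
    exact absurd hz (hz'.elim (fun h => h1 h) fun h => h2 h)

theorem IsCut.agree_or_opposite {U A B I : Set X} (hU : C1Bdry U) (hI : IsOpen I)
    (hIc : IsPreconnected I) (hA : IsCut (frontier U) A I) (hB : IsCut (frontier U) B I) :
    (∀ z ∈ I, z ∉ frontier U → (z ∈ A ↔ z ∈ B)) ∨
      (∀ z ∈ I, z ∉ frontier U → (z ∈ A ↔ z ∉ B)) := by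
  set M := frontier U with hM
  have hop : ∀ p : X → Prop, IsOpen {x | ∀ᶠ z in 𝓝[Mᶜ] x, p z} := fun p =>
    isOpen_iff_mem_nhds.2 fun x hx => eventually_nhds_nhdsWithin.2 hx
  have hcov : I ⊆ {x | ∀ᶠ z in 𝓝[Mᶜ] x, (z ∈ A ↔ z ∈ B)} ∪
      {x | ∀ᶠ z in 𝓝[Mᶜ] x, (z ∈ A ↔ z ∉ B)} := by
    intro x hx
    by_cases hxM : x ∈ M
    · obtain ⟨S₁, S₂, c1, c2, s1, s2, hS⟩ := hU.exists_local_sides hxM (hI.mem_nhds hx)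
      rcases hA.sides hx hxM c1 c2 s1 s2 hS with ⟨a1, a2⟩ | ⟨a1, a2⟩ <;>
      rcases hB.sides hx hxM c1 c2 s1 s2 hS with ⟨b1, b2⟩ | ⟨b1, b2⟩
      · exact Or.inl (hS.mono fun z hz => hz.elim (fun h => iff_of_true (a1 h) (b1 h))
          fun h => iff_of_false (a2 h) (b2 h))
      · exact Or.inr (hS.mono fun z hz => hz.elim (fun h => iff_of_true (a1 h) (b1 h))
          fun h => iff_of_false (a2 h) (not_not.2 (b2 h)))
      · exact Or.inr (hS.mono fun z hz => hz.elim (fun h => iff_of_false (a1 h) (not_not.2 (b1 h)))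
          fun h => iff_of_true (a2 h) (b2 h))
      · exact Or.inl (hS.mono fun z hz => hz.elim (fun h => iff_of_false (a1 h) (b1 h))
          fun h => iff_of_true (a2 h) (b2 h))
    · have hA' := notMem_frontier_iff_eventually.1 fun h => hxM (hA.1 ⟨hx, h⟩)
      have hB' := notMem_frontier_iff_eventually.1 fun h => hxM (hB.1 ⟨hx, h⟩)
      by_cases h : x ∈ A ↔ x ∈ B
      · refine Or.inl (mem_nhdsWithin_of_mem_nhds ?_)
        filter_upwards [hA', hB'] with z h1 h2
        rw [h1, h2, h]
      · refine Or.inr (mem_nhdsWithin_of_mem_nhds ?_)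
        filter_upwards [hA', hB'] with z h1 h2
        rw [h1, h2]
        tauto
  by_contra! hn
  obtain ⟨⟨z, hz, hzM, hzn⟩, ⟨w, hw, hwM, hwn⟩⟩ := hn
  have pz : z ∈ {x | ∀ᶠ z in 𝓝[Mᶜ] x, (z ∈ A ↔ z ∉ B)} := by
    refine (hcov hz).resolve_left fun h => ?_
    have := Filter.Eventually.self_of_nhdsWithin h hzM
    tauto
  have pw : w ∈ {x | ∀ᶠ z in 𝓝[Mᶜ] x, (z ∈ A ↔ z ∈ B)} := by
    refine (hcov hw).resolve_right fun h => ?_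
    have := Filter.Eventually.self_of_nhdsWithin h hwM
    tauto
  obtain ⟨x, hx, h1, h2⟩ := hIc _ _ (hop _) (hop _) hcov ⟨w, hw, pw⟩ ⟨z, hz, pz⟩
  have hfalse : ∀ᶠ z in 𝓝[Mᶜ] x, False := by
    filter_upwards [h1, h2] with z hz1 hz2
    tauto
  by_cases hxM : x ∈ M
  · exact ((hA.2 x ⟨hx, hxM⟩).1.and_eventually hfalse).exists.elim fun _ h => h.2
  · exact Filter.Eventually.self_of_nhdsWithin hfalse hxM

theorem IsCut.union {U A B Q₁ Q₂ : Set X} (hU : C1Bdry U) (h1 : IsOpen Q₁) (h2 : IsOpen Q₂)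
    (hc : IsPreconnected (Q₁ ∩ Q₂)) (hA : IsCut (frontier U) A Q₁)
    (hB : IsCut (frontier U) B Q₂) : ∃ C, IsCut (frontier U) C (Q₁ ∪ Q₂) := by
  wlog hAB : ∀ z ∈ Q₁ ∩ Q₂, z ∉ frontier U → (z ∈ A ↔ z ∈ B) generalizing B
  · refine this hB.compl ?_
    rcases IsCut.agree_or_opposite hU (h1.inter h2) hc (hA.mono inter_subset_left)
      (hB.mono inter_subset_right) with h | h
    · exact absurd h hAB
    · exact h
  have e1 : IsCut (frontier U) (A ∩ Q₁ ∪ B ∩ Q₂) Q₁ := by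
    refine hA.congr h1 isClosed_frontier fun z hz hzM => ?_
    by_cases hz2 : z ∈ Q₂
    · simp [hz, hz2, hAB z ⟨hz, hz2⟩ hzM]
    · simp [hz, hz2]
  have e2 : IsCut (frontier U) (A ∩ Q₁ ∪ B ∩ Q₂) Q₂ := by
    refine hB.congr h2 isClosed_frontier fun z hz hzM => ?_
    by_cases hz1 : z ∈ Q₁
    · simp [hz, hz1, hAB z ⟨hz1, hz⟩ hzM]
    · simp [hz, hz1]
  refine ⟨A ∩ Q₁ ∪ B ∩ Q₂, fun x hx => ?_, fun x hx => ?_⟩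
  · rcases hx.1 with h | h
    · exact e1.1 ⟨h, hx.2⟩
    · exact e2.1 ⟨h, hx.2⟩
  · rcases hx.1 with h | h
    · exact e1.2 x ⟨h, hx.2⟩
    · exact e2.2 x ⟨h, hx.2⟩

theorem exists_local_cut {U : Set X} (hU : C1Bdry U) (x : X) :
    ∃ A Q, Q ∈ 𝓝 x ∧ IsCut (frontier U) A Q := by
  by_cases hx : x ∈ frontier U
  swap
  · exact ⟨∅, (frontier U)ᶜ, isClosed_frontier.isOpen_compl.mem_nhds hx, by simp, by simp⟩
  obtain ⟨W, W', φ, ψ, ℓ, n, hW, hxW, hW', hn, hφ, hψ, m1, m2, i1, i2, e⟩ := hU.exists_chart hx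
  have hφc : ∀ z ∈ W, ContinuousAt φ z := fun z hz =>
    hφ.continuousOn.continuousAt (hW.mem_nhds hz)
  refine ⟨{z | 0 < ℓ (φ z)}, W, hW.mem_nhds hxW, ?_, ?_⟩
  · rintro z ⟨hz, hf⟩
    by_contra hzM
    have hne : ℓ (φ z) ≠ 0 := fun h => hzM ((e z hz).2 h)
    refine notMem_frontier_iff_eventually.2 ?_ hf
    have hc : ContinuousAt (fun z => ℓ (φ z)) z := ℓ.continuous.continuousAt.comp (hφc z hz)
    rcases lt_or_gt_of_ne hne with h | h
    · filter_upwards [hc.eventually (gt_mem_nhds h)] with w hw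
      exact iff_of_false (not_lt.2 hw.le) (not_lt.2 h.le)
    · filter_upwards [hc.eventually (lt_mem_nhds h)] with w hw
      exact iff_of_true hw h
  · rintro z ⟨hz, hzM⟩
    have h0 : ℓ (φ z) = 0 := (e z hz).1 hzM
    have key : ∀ m : X, ℓ m ≠ 0 → Tendsto (fun τ : ℝ => ψ (φ z + τ • m)) (𝓝[>] 0)
        (𝓝[(frontier U)ᶜ] z) ∧ ∀ᶠ τ : ℝ in 𝓝[>] 0, ℓ (φ (ψ (φ z + τ • m))) = τ * ℓ m := by
      intro m hm
      have t0 : Tendsto (fun τ : ℝ => φ z + τ • m) (𝓝[>] 0) (𝓝 (φ z)) := by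
        have : Tendsto (fun τ : ℝ => φ z + τ • m) (𝓝 0) (𝓝 (φ z + (0:ℝ) • m)) :=
          (by fun_prop : Continuous fun τ : ℝ => φ z + τ • m).tendsto 0
        rw [zero_smul, add_zero] at this
        exact this.mono_left nhdsWithin_le_nhds
      have ev : ∀ᶠ τ : ℝ in 𝓝[>] 0, φ z + τ • m ∈ W' :=
        t0.eventually (hW'.mem_nhds (m1 hz))
      have ev2 : ∀ᶠ τ : ℝ in 𝓝[>] 0, ℓ (φ (ψ (φ z + τ • m))) = τ * ℓ m := by
        filter_upwards [ev] with τ hτ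
        rw [i2 _ hτ, map_add, h0, map_smul, zero_add, smul_eq_mul]
      refine ⟨tendsto_nhdsWithin_iff.2 ⟨?_, ?_⟩, ev2⟩
      · have hc : ContinuousAt ψ (φ z) := hψ.continuousOn.continuousAt (hW'.mem_nhds (m1 hz))
        have := hc.tendsto.comp t0
        rwa [i1 z hz] at this
      · filter_upwards [ev, ev2, self_mem_nhdsWithin] with τ h1 h2 h3 h4
        rw [e _ (m2 h1), h2] at h4
        exact (mul_ne_zero (ne_of_gt h3) hm) h4
    obtain ⟨p1, p2⟩ := key n (by rw [hn]; exact one_ne_zero)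
    obtain ⟨q1, q2⟩ := key (-n) (by rw [map_neg, hn]; norm_num)
    refine ⟨p1.frequently (Eventually.frequently ?_), q1.frequently (Eventually.frequently ?_)⟩
    · filter_upwards [p2, self_mem_nhdsWithin] with τ h1 h2
      rw [h1, hn, mul_one]
      exact h2
    · filter_upwards [q2, self_mem_nhdsWithin] with τ h1 h2
      rw [h1, map_neg, hn]
      have : (0:ℝ) < τ := h2
      linarith

theorem Icc_local_to_global {P : ℝ → ℝ → Prop}
    (hloc : ∀ x, ∃ ε > 0, ∀ a b, x - ε < a → a ≤ x → x ≤ b → b < x + ε → P a b)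
    (hglue : ∀ a b c, a ≤ b → b ≤ c → P a b → P b c → P a c) {a b : ℝ} (hab : a ≤ b) : P a b := by
  set S : Set ℝ := {t | a ≤ t ∧ t ≤ b ∧ P a t} with hS
  have haS : a ∈ S := by
    obtain ⟨ε, hε, h⟩ := hloc a
    exact ⟨le_rfl, hab, h a a (by linarith) le_rfl le_rfl (by linarith)⟩
  have hbd : BddAbove S := ⟨b, fun t ht => ht.2.1⟩
  set s := sSup S with hs
  have has : a ≤ s := le_csSup hbd haS
  have hsb : s ≤ b := csSup_le ⟨a, haS⟩ fun t ht => ht.2.1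
  obtain ⟨ε, hε, h⟩ := hloc s
  obtain ⟨t, ht, hts⟩ := exists_lt_of_lt_csSup ⟨a, haS⟩ (show s - ε < sSup S by linarith)
  have hts' : t ≤ s := le_csSup hbd ht
  have hmin : s ≤ min (s + ε / 2) b := le_min (by linarith) hsb
  have hP : P a (min (s + ε / 2) b) :=
    hglue _ t _ ht.1 (hts'.trans hmin) ht.2.2
      (h _ _ hts hts' hmin ((min_le_left _ _).trans_lt (by linarith)))
  have hmem : min (s + ε / 2) b ∈ S := ⟨has.trans hmin, min_le_right _ _, hP⟩
  have h1 := le_csSup hbd hmem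
  have h2 : min (s + ε / 2) b = b := by
    rcases le_total (s + ε / 2) b with h3 | h3
    · rw [min_eq_left h3] at h1
      linarith
    · exact min_eq_right h3
  rwa [h2] at hP

/-- An open coordinate rectangle. -/
def rect (a b c d : ℝ) : Set ℂ := {z | a < z.re ∧ z.re < b ∧ c < z.im ∧ z.im < d}

theorem isOpen_rect (a b c d : ℝ) : IsOpen (rect a b c d) := by
  have := ((isOpen_Ioo (a := a) (b := b)).preimage Complex.continuous_re).inter
    ((isOpen_Ioo (a := c) (b := d)).preimage Complex.continuous_im)
  convert this using 1
  ext z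
  simp [rect, and_assoc]

theorem convex_rect (a b c d : ℝ) : Convex ℝ (rect a b c d) := by
  intro z hz w hw s t hs ht hst
  have key : ∀ l x y u : ℝ, l < x → x < u → l < y → y < u →
      l < s * x + t * y ∧ s * x + t * y < u := by
    intro l x y u h1 h2 h3 h4
    have := convex_Ioo l u ⟨h1, h2⟩ ⟨h3, h4⟩ hs ht hst
    simpa using this
  obtain ⟨z1, z2, z3, z4⟩ := hz
  obtain ⟨w1, w2, w3, w4⟩ := hw
  have k1 := key _ _ _ _ z1 z2 w1 w2
  have k2 := key _ _ _ _ z3 z4 w3 w4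
  refine ⟨?_, ?_, ?_, ?_⟩ <;> simp [k1, k2]

theorem exists_rect_subset {z : ℂ} {Q : Set ℂ} (hQ : Q ∈ 𝓝 z) :
    ∃ ε > 0, rect (z.re - ε) (z.re + ε) (z.im - ε) (z.im + ε) ⊆ Q := by
  obtain ⟨ρ, hρ, h⟩ := Metric.mem_nhds_iff.1 hQ
  refine ⟨ρ / 2, half_pos hρ, fun w hw => h ?_⟩
  obtain ⟨h1, h2, h3, h4⟩ := hw
  rw [mem_ball, dist_eq_norm]
  have := Complex.norm_le_abs_re_add_abs_im (w - z)
  have e1 : |(w - z).re| < ρ / 2 := by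
    rw [Complex.sub_re, abs_lt]; constructor <;> linarith
  have e2 : |(w - z).im| < ρ / 2 := by
    rw [Complex.sub_im, abs_lt]; constructor <;> linarith
  linarith

theorem exists_cut_rect {U : Set ℂ} (hU : C1Bdry U) {a b c d : ℝ} (hab : a ≤ b) (hcd : c ≤ d) :
    ∃ A, IsCut (frontier U) A (rect a b c d) := by
  have col : ∀ x : ℝ, ∃ ε > 0, ∃ A, IsCut (frontier U) A (rect (x - ε) (x + ε) c d) := by
    intro x
    have := Icc_local_to_global (P := fun c d => ∃ ε > 0, ∃ A,
      IsCut (frontier U) A (rect (x - ε) (x + ε) (c - ε) (d + ε))) ?_ ?_ hcd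
    · obtain ⟨ε, hε, A, hA⟩ := this
      exact ⟨ε, hε, A, hA.mono fun z hz => ⟨hz.1, hz.2.1, by linarith [hz.2.2.1],
        by linarith [hz.2.2.2]⟩⟩
    · intro y
      obtain ⟨A, Q, hQ, hA⟩ := exists_local_cut hU (⟨x, y⟩ : ℂ)
      obtain ⟨ε, hε, hr⟩ := exists_rect_subset hQ
      refine ⟨ε / 2, half_pos hε, fun a b h1 h2 h3 h4 => ⟨ε / 2, half_pos hε, A, hA.mono
        (subset_trans ?_ hr)⟩⟩
      rintro z ⟨z1, z2, z3, z4⟩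
      exact ⟨by simp only; linarith, by simp only; linarith, by simp only; linarith,
        by simp only; linarith⟩
    · rintro a b c hab hbc ⟨ε₁, h1, A, hA⟩ ⟨ε₂, h2, B, hB⟩
      set ε := min ε₁ ε₂ with hε
      have l1 : ε ≤ ε₁ := min_le_left _ _
      have l2 : ε ≤ ε₂ := min_le_right _ _
      have h0 : 0 < ε := lt_min h1 h2
      have hA' : IsCut (frontier U) A (rect (x - ε) (x + ε) (a - ε) (b + ε)) :=
        hA.mono fun z ⟨z1, z2, z3, z4⟩ => ⟨by linarith, by linarith, by linarith, by linarith⟩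
      have hB' : IsCut (frontier U) B (rect (x - ε) (x + ε) (b - ε) (c + ε)) :=
        hB.mono fun z ⟨z1, z2, z3, z4⟩ => ⟨by linarith, by linarith, by linarith, by linarith⟩
      obtain ⟨C, hC⟩ := IsCut.union hU (isOpen_rect _ _ _ _) (isOpen_rect _ _ _ _)
        (((convex_rect _ _ _ _).inter (convex_rect _ _ _ _)).isPreconnected) hA' hB'
      refine ⟨ε, h0, C, hC.mono ?_⟩
      rintro z ⟨z1, z2, z3, z4⟩
      rcases lt_or_ge z.im (b + ε) with h | h
      · exact Or.inl ⟨z1, z2, z3, h⟩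
      · exact Or.inr ⟨z1, z2, by linarith, z4⟩
  have := Icc_local_to_global (P := fun a b => ∃ ε > 0, ∃ A,
      IsCut (frontier U) A (rect (a - ε) (b + ε) c d)) ?_ ?_ hab
  · obtain ⟨ε, hε, A, hA⟩ := this
    exact ⟨A, hA.mono fun z hz => ⟨by linarith [hz.1], by linarith [hz.2.1], hz.2.2⟩⟩
  · intro x
    obtain ⟨ε, hε, A, hA⟩ := col x
    refine ⟨ε / 2, half_pos hε, fun a b h1 h2 h3 h4 => ⟨ε / 2, half_pos hε, A, hA.mono ?_⟩⟩
    rintro z ⟨z1, z2, z3, z4⟩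
    exact ⟨by linarith, by linarith, z3, z4⟩
  · rintro a b e hab hbc ⟨ε₁, h1, A, hA⟩ ⟨ε₂, h2, B, hB⟩
    obtain ⟨C, hC⟩ := IsCut.union hU (isOpen_rect _ _ _ _) (isOpen_rect _ _ _ _)
      (((convex_rect _ _ _ _).inter (convex_rect _ _ _ _)).isPreconnected) hA hB
    set ε := min ε₁ ε₂ with hε
    have l1 : ε ≤ ε₁ := min_le_left _ _
    have l2 : ε ≤ ε₂ := min_le_right _ _
    have h0 : 0 < ε := lt_min h1 h2
    refine ⟨ε, h0, C, hC.mono ?_⟩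
    rintro z ⟨z1, z2, z3, z4⟩
    rcases lt_or_ge z.re (b + ε₁) with h | h
    · exact Or.inl ⟨by linarith, h, z3, z4⟩
    · exact Or.inr ⟨by linarith, by linarith, z3, z4⟩

/-- A connected open set with `C¹` boundary cannot lie on both sides of its boundary. -/
theorem not_both_sides {U : Set ℂ} (hU : C1Domain U) {p : ℂ} (hp : p ∈ frontier U)
    {S₁ S₂ : Set ℂ} (c1 : IsPreconnected S₁) (c2 : IsPreconnected S₂) (s1 : S₁ ⊆ U)
    (s2 : S₂ ⊆ U) (n1 : S₁.Nonempty) (n2 : S₂.Nonempty) (b1 : Bornology.IsBounded S₁)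
    (b2 : Bornology.IsBounded S₂)
    (hS : ∀ᶠ z in 𝓝[(frontier U)ᶜ] p, z ∈ S₁ ∪ S₂) : False := by
  obtain ⟨hUo, hUc, hUb⟩ := hU
  obtain ⟨x, hx⟩ := n1
  obtain ⟨y, hy⟩ := n2
  have hpath := (hUo.isConnected_iff_isPathConnected.1 hUc).joinedIn x (s1 hx) y (s2 hy)
  obtain ⟨γ, hγ⟩ := hpath
  have hKc : IsCompact (range γ) := isCompact_range γ.continuous
  have hKp : IsPreconnected (range γ) := isPreconnected_range γ.continuous
  have hx' : x ∈ range γ := ⟨0, γ.source⟩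
  have hy' : y ∈ S₁ ∪ range γ := Or.inr ⟨1, γ.target⟩
  have hT : IsPreconnected (S₁ ∪ range γ ∪ S₂) :=
    (c1.union x hx hx' hKp).union y hy' hy c2
  have hTU : S₁ ∪ range γ ∪ S₂ ⊆ U :=
    union_subset (union_subset s1 (range_subset_iff.2 hγ)) s2
  have hTb : Bornology.IsBounded (insert p (S₁ ∪ range γ ∪ S₂)) :=
    ((b1.union hKc.isBounded).union b2).insert p
  obtain ⟨R, hR⟩ := hTb.subset_closedBall 0
  have hsub : insert p (S₁ ∪ range γ ∪ S₂) ⊆ rect (-(|R| + 1)) (|R| + 1) (-(|R| + 1)) (|R| + 1) := by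
    intro z hz
    have h1 := hR hz
    rw [mem_closedBall, dist_zero_right] at h1
    have h2 := abs_le.1 ((Complex.abs_re_le_norm z).trans (h1.trans (le_abs_self R)))
    have h3 := abs_le.1 ((Complex.abs_im_le_norm z).trans (h1.trans (le_abs_self R)))
    exact ⟨by linarith, by linarith, by linarith, by linarith⟩
  have hR0 := abs_nonneg R
  obtain ⟨A, hA⟩ := exists_cut_rect hUb (show -(|R| + 1) ≤ |R| + 1 by linarith)
    (show -(|R| + 1) ≤ |R| + 1 by linarith)
  have hUf : ∀ z ∈ U, z ∉ frontier U := fun z hz h =>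
    (hUo.inter_frontier_eq.subset ⟨hz, h⟩ : z ∈ (∅ : Set ℂ))
  obtain ⟨f1, f2⟩ := hA.2 p ⟨hsub (mem_insert _ _), hp⟩
  have hST : S₁ ∪ S₂ ⊆ S₁ ∪ range γ ∪ S₂ := fun z hz => hz.elim (fun h => Or.inl (Or.inl h)) Or.inr
  rcases subset_or_subset_compl_of_disjoint_frontier (U := A) hT (disjoint_left.2 fun z hz hf =>
    hUf z (hTU hz) (hA.1 ⟨hsub (mem_insert_of_mem _ hz), hf⟩)) with h | h
  · obtain ⟨z, hz, hz'⟩ := (f2.and_eventually hS).exists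
    exact hz (h (hST hz'))
  · obtain ⟨z, hz, hz'⟩ := (f1.and_eventually hS).exists
    exact h (hST hz') hz

end OneSided

section BentCurve

open Complex (I)

/-- Nearest point projection onto a closed convex set. -/
theorem exists_convex_projection {K : Set ℂ} (ne : K.Nonempty) (hK : IsClosed K)
    (hc : Convex ℝ K) : ∃ P : ℂ → ℂ, LipschitzWith 1 P ∧ (∀ p, P p ∈ K) ∧ (∀ p ∈ K, P p = p) ∧
      ∀ p, P p ∈ interior K → P p = p := by
  have h1 : ∀ p : ℂ, ∃ q ∈ K, ∀ w ∈ K, inner ℝ (p - q) (w - q) ≤ 0 := by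
    intro p
    obtain ⟨q, hq, h⟩ := exists_norm_eq_iInf_of_complete_convex ne hK.isComplete hc p
    exact ⟨q, hq, (norm_eq_iInf_iff_real_inner_le_zero hc hq).1 h⟩
  choose P hP hPi using h1
  refine ⟨P, LipschitzWith.of_dist_le_mul fun p q => ?_, hP, fun p hp => ?_, fun p hp => ?_⟩
  · rw [NNReal.coe_one, one_mul, dist_eq_norm, dist_eq_norm]
    have e1 := hPi p (P q) (hP q)
    have e2 := hPi q (P p) (hP p)
    have e3 : inner ℝ (P p - P q) (P p - P q) ≤ inner ℝ (p - q) (P p - P q) := by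
      have : inner ℝ (p - q) (P p - P q) - inner ℝ (P p - P q) (P p - P q) =
          - inner ℝ (p - P p) (P q - P p) - inner ℝ (q - P q) (P p - P q) := by
        have a1 : P q - P p = -(P p - P q) := by abel
        rw [a1, inner_neg_right, neg_neg, ← inner_sub_left, ← inner_sub_left]
        congr 1
        abel
      linarith
    rw [real_inner_self_eq_norm_sq] at e3
    have e4 := real_inner_le_norm (p - q) (P p - P q)
    by_contra! h
    nlinarith [norm_nonneg (p - q), norm_nonneg (P p - P q)]
  · have := hPi p p hp
    rw [real_inner_self_eq_norm_sq] at this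
    have : ‖p - P p‖ = 0 := by nlinarith [norm_nonneg (p - P p)]
    rw [norm_eq_zero, sub_eq_zero] at this
    exact this.symm
  · have ht : Tendsto (fun ε : ℝ => P p + ε • (p - P p)) (𝓝[>] 0) (𝓝 (P p)) := by
      have : Tendsto (fun ε : ℝ => P p + ε • (p - P p)) (𝓝 0) (𝓝 (P p + (0:ℝ) • (p - P p))) :=
        (by fun_prop : Continuous fun ε : ℝ => P p + ε • (p - P p)).tendsto 0
      rw [zero_smul, add_zero] at this
      exact this.mono_left nhdsWithin_le_nhds
    obtain ⟨ε, hε, hε0⟩ := ((ht.eventually (isOpen_interior.mem_nhds hp)).and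
      self_mem_nhdsWithin).exists
    have hε0 : 0 < ε := hε0
    have := hPi p _ (interior_subset hε)
    rw [add_sub_cancel_left, real_inner_smul_right, real_inner_self_eq_norm_sq] at this
    have h2 : ‖p - P p‖ ^ 2 ≤ 0 := by
      by_contra! h
      have := mul_pos hε0 h
      linarith
    have : ‖p - P p‖ = 0 := by nlinarith [norm_nonneg (p - P p)]
    rw [norm_eq_zero, sub_eq_zero] at this
    exact this.symm

theorem hasDerivAt_re {c : ℝ → ℂ} {v : ℂ} {s : ℝ} (h : HasDerivAt c v s) :
    HasDerivAt (fun s => (c s).re) v.re s :=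
  Complex.reCLM.hasFDerivAt.comp_hasDerivAt s h

theorem hasDerivAt_im {c : ℝ → ℂ} {v : ℂ} {s : ℝ} (h : HasDerivAt c v s) :
    HasDerivAt (fun s => (c s).im) v.im s :=
  Complex.imCLM.hasFDerivAt.comp_hasDerivAt s h

theorem unit_near_bounds {z : ℂ} (h1 : ‖z‖ = 1) (h2 : ‖z - 1‖ ≤ 1 / 8) :
    7 / 8 ≤ z.re ∧ z.re ≤ 1 ∧ |z.im| ≤ 1 / 8 := by
  have a1 := abs_le.1 ((Complex.abs_re_le_norm (z - 1)).trans h2)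
  have a2 := (Complex.abs_im_le_norm (z - 1)).trans h2
  have a3 := (Complex.re_le_norm z).trans h1.le
  simp only [Complex.sub_re, Complex.one_re, Complex.sub_im, Complex.one_im, sub_zero] at a1 a2
  exact ⟨by linarith, a3, a2⟩

/-- The curve obtained from the graph with slope `k` by rotating the tangent by `ζ`. -/
structure BentCurve (k : ℝ → ℝ) (ζ c : ℝ → ℂ) : Prop where
  contk : Continuous k
  contζ : Continuous ζ
  k_le : ∀ s, |k s| ≤ 1 / 2
  norm_ζ : ∀ s, ‖ζ s‖ = 1
  ζ_near : ∀ s, ‖ζ s - 1‖ ≤ 1 / 8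
  hasDeriv : ∀ s, HasDerivAt c (ζ s * (1 + k s * I)) s

theorem rotated_slope_bounds {z : ℂ} (h1 : ‖z‖ = 1) (h2 : ‖z - 1‖ ≤ 1 / 8) {k : ℝ}
    (hk : |k| ≤ 1 / 2) : 13 / 16 ≤ (z * (1 + k * I)).re ∧ (z * (1 + k * I)).re ≤ 17 / 16 ∧
      |(z * (1 + k * I)).im| ≤ 5 / 8 := by
  obtain ⟨a, b, c⟩ := unit_near_bounds h1 h2
  have e1 : (z * (1 + k * I)).re = z.re - z.im * k := by simp
  have e2 : (z * (1 + k * I)).im = z.re * k + z.im := by simp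
  have f1 : |z.im * k| ≤ 1 / 8 * (1 / 2) := by
    rw [abs_mul]; exact mul_le_mul c hk (abs_nonneg _) (by norm_num)
  have f2 : |z.re * k| ≤ 1 * (1 / 2) := by
    rw [abs_mul, abs_of_nonneg (by linarith : 0 ≤ z.re)]
    exact mul_le_mul b hk (abs_nonneg _) (by norm_num)
  rw [e1, e2]
  have g1 := abs_le.1 f1
  refine ⟨by linarith, by linarith, (abs_add_le _ _).trans (by linarith)⟩

/-- The parameter of the point of the curve `c` with given abscissa. -/
def absInv (c : ℝ → ℂ) : ℝ → ℝ := Function.invFun fun s => (c s).re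

/-- The curve `c` as a graph. -/
def graphFn (c : ℝ → ℂ) (x : ℝ) : ℝ := (c (absInv c x)).im

namespace BentCurve

variable {k : ℝ → ℝ} {ζ c : ℝ → ℂ}

theorem vel (h : BentCurve k ζ c) (s : ℝ) : 13 / 16 ≤ (ζ s * (1 + k s * I)).re ∧
    (ζ s * (1 + k s * I)).re ≤ 17 / 16 ∧ |(ζ s * (1 + k s * I)).im| ≤ 5 / 8 :=
  rotated_slope_bounds (h.norm_ζ s) (h.ζ_near s) (h.k_le s)

theorem re_sub_ge (h : BentCurve k ζ c) {s t : ℝ} (hst : s ≤ t) :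
    13 / 16 * (t - s) ≤ (c t).re - (c s).re := by
  have hm : Monotone fun s => (c s).re - 13 / 16 * s :=
    monotone_of_hasDerivAt_nonneg
      (fun s => (hasDerivAt_re (h.hasDeriv s)).sub ((hasDerivAt_id s).const_mul (13 / 16)))
      (fun s => by simpa using (h.vel s).1)
  have := hm hst
  simp only at this
  linarith

theorem abs_im_sub_le (h : BentCurve k ζ c) {s t : ℝ} (hst : s ≤ t) :
    |(c t).im - (c s).im| ≤ 4 / 5 * ((c t).re - (c s).re) := by
  have hm : Monotone fun s => 4 / 5 * (c s).re - (c s).im :=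
    monotone_of_hasDerivAt_nonneg
      (fun s => ((hasDerivAt_re (h.hasDeriv s)).const_mul (4 / 5)).sub (hasDerivAt_im (h.hasDeriv s)))
      (fun s => by
        have h1 := (h.vel s).1
        have h2 := abs_le.1 (h.vel s).2.2
        simp only [Pi.zero_apply]
        linarith)
  have hp : Monotone fun s => 4 / 5 * (c s).re + (c s).im :=
    monotone_of_hasDerivAt_nonneg
      (fun s => ((hasDerivAt_re (h.hasDeriv s)).const_mul (4 / 5)).add (hasDerivAt_im (h.hasDeriv s)))
      (fun s => by
        have h1 := (h.vel s).1
        have h2 := abs_le.1 (h.vel s).2.2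
        simp only [Pi.zero_apply]
        linarith)
  have h1 := hm hst
  have h2 := hp hst
  simp only at h1 h2
  rw [abs_le]
  constructor <;> linarith

theorem continuous (h : BentCurve k ζ c) : Continuous c :=
  continuous_iff_continuousAt.2 fun s => (h.hasDeriv s).continuousAt

theorem re_strictMono (h : BentCurve k ζ c) : StrictMono fun s => (c s).re := fun s t hst => by
  have := h.re_sub_ge hst.le
  simp only
  linarith

theorem re_surjective (h : BentCurve k ζ c) : Function.Surjective fun s => (c s).re := by
  have hcont : Continuous fun s => (c s).re := Complex.continuous_re.comp h.continuous
  refine hcont.surjective ?_ ?_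
  · refine tendsto_atTop_mono' atTop (f₁ := fun s => (c 0).re + 13 / 16 * s) ?_ ?_
    · filter_upwards [eventually_ge_atTop 0] with s hs
      have := h.re_sub_ge hs
      linarith
    · exact tendsto_atTop_add_const_left _ _ (tendsto_id.const_mul_atTop (by norm_num))
  · refine tendsto_atBot_mono' atBot (f₁ := fun s => (c 0).re + 13 / 16 * s) ?_ ?_
    · filter_upwards [eventually_le_atBot 0] with s hs
      have := h.re_sub_ge hs
      linarith
    · exact tendsto_atBot_add_const_left _ _ (tendsto_id.const_mul_atBot (by norm_num))

theorem absInv_re (h : BentCurve k ζ c) (s : ℝ) : absInv c (c s).re = s :=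
  Function.leftInverse_invFun h.re_strictMono.injective s

theorem re_absInv (h : BentCurve k ζ c) (x : ℝ) : (c (absInv c x)).re = x :=
  Function.rightInverse_invFun h.re_surjective x

theorem continuous_absInv (h : BentCurve k ζ c) : Continuous (absInv c) := by
  refine (LipschitzWith.of_dist_le_mul (K := 2) fun x y => ?_).continuous
  wlog hxy : absInv c x ≤ absInv c y generalizing x y
  · rw [dist_comm, dist_comm x]
    exact this y x (le_of_not_ge hxy)
  have := h.re_sub_ge hxy
  rw [h.re_absInv, h.re_absInv] at this
  rw [dist_comm, dist_comm x, Real.dist_eq, Real.dist_eq, abs_of_nonneg (by linarith),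
    NNReal.coe_ofNat]
  have := le_abs_self (y - x)
  linarith

theorem graphFn_re (h : BentCurve k ζ c) (s : ℝ) : graphFn c (c s).re = (c s).im := by
  rw [graphFn, h.absInv_re]

theorem curve_absInv (h : BentCurve k ζ c) (x : ℝ) :
    c (absInv c x) = (x : ℂ) + graphFn c x * I := by
  apply Complex.ext <;> simp [graphFn, h.re_absInv]

theorem continuous_graphFn (h : BentCurve k ζ c) : Continuous (graphFn c) :=
  Complex.continuous_im.comp (h.continuous.comp h.continuous_absInv)

theorem hasDerivAt_graphFn (h : BentCurve k ζ c) (x : ℝ) :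
    HasDerivAt (graphFn c) ((ζ (absInv c x) * (1 + k (absInv c x) * I)).im /
      (ζ (absInv c x) * (1 + k (absInv c x) * I)).re) x := by
  have h1 : HasDerivAt (absInv c) ((ζ (absInv c x) * (1 + k (absInv c x) * I)).re)⁻¹ x :=
    HasDerivAt.of_local_left_inverse h.continuous_absInv.continuousAt
      (hasDerivAt_re (h.hasDeriv _)) (by linarith [(h.vel (absInv c x)).1])
      (Eventually.of_forall h.re_absInv)
  have h2 := (hasDerivAt_im (h.hasDeriv (absInv c x))).comp x h1
  rwa [← div_eq_mul_inv] at h2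

theorem contDiff_graphFn (h : BentCurve k ζ c) : ContDiff ℝ 1 (graphFn c) := by
  rw [contDiff_one_iff_deriv]
  refine ⟨fun x => (h.hasDerivAt_graphFn x).differentiableAt, ?_⟩
  have : deriv (graphFn c) = fun x => (ζ (absInv c x) * (1 + k (absInv c x) * I)).im /
      (ζ (absInv c x) * (1 + k (absInv c x) * I)).re :=
    funext fun x => (h.hasDerivAt_graphFn x).deriv
  rw [this]
  have hσ := h.continuous_absInv
  have hk := h.contk
  have hζ := h.contζ
  have hv : Continuous fun x => ζ (absInv c x) * (1 + k (absInv c x) * I) := by fun_prop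
  exact (Complex.continuous_im.comp hv).div (Complex.continuous_re.comp hv)
    fun x => by linarith [(h.vel (absInv c x)).1]

theorem abs_graphFn_sub_le (h : BentCurve k ζ c) (x y : ℝ) :
    |graphFn c x - graphFn c y| ≤ 4 / 5 * |x - y| := by
  wlog hxy : absInv c y ≤ absInv c x generalizing x y
  · rw [abs_sub_comm, abs_sub_comm x]
    exact this y x (le_of_not_ge hxy)
  have := h.abs_im_sub_le hxy
  rw [h.re_absInv, h.re_absInv] at this
  have h2 := le_abs_self (x - y)
  exact this.trans (by linarith)

/-- A vector in the upward cone points above the curve. -/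
theorem graphFn_add_le (h : BentCurve k ζ c) (s : ℝ) {w : ℂ} (hw : |w.re| ≤ w.im) :
    graphFn c (c s + w).re ≤ (c s + w).im := by
  have := h.abs_graphFn_sub_le (c s + w).re (c s).re
  rw [h.graphFn_re, Complex.add_re, add_sub_cancel_left] at this
  rw [Complex.add_re, Complex.add_im]
  have := (abs_le.1 this).2
  linarith [abs_nonneg w.re]

end BentCurve

end BentCurve

section HullWindow

open Complex (I)
open scoped ComplexConjugate

/-- `φ` is the height of a curve of slope `m` over a curve of slope `k`. -/
structure HullData (l r : ℝ) (k m φ : ℝ → ℝ) : Prop where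
  nonneg : ∀ s ∈ Icc l r, 0 ≤ φ s
  hasDeriv : ∀ s ∈ Icc l r, HasDerivAt φ (m s - k s) s
  m_le : ∀ s ∈ Icc l r, |m s| ≤ 1 / 2

/-- The rotation `ζ` is constant on the gaps and keeps the hull curve concave. -/
structure Bending (l r : ℝ) (m φ : ℝ → ℝ) (ζ : ℝ → ℂ) : Prop where
  loc : ∀ s ∈ Icc l r, ∀ u ∈ Icc l r, s ≤ u → (∀ x ∈ Icc s u, φ x ≠ 0) → ζ s = ζ u
  cross : ∀ s ∈ Icc l r, ∀ u ∈ Icc l r, s ≤ u →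
    (conj (ζ s * (1 + m s * I)) * (ζ u * (1 + m u * I))).im ≤ 0

variable {l r : ℝ} {k m φ : ℝ → ℝ} {ζ c : ℝ → ℂ}

theorem hasDerivAt_hullCurve (hc : BentCurve k ζ c) (hh : HullData l r k m φ)
    (hb : Bending l r m φ ζ) {s : ℝ} (hs : s ∈ Ioo l r) :
    HasDerivAt (fun s => c s + φ s * (I * ζ s)) (ζ s * (1 + m s * I)) s := by
  have hφ := hh.hasDeriv s (Ioo_subset_Icc_self hs)
  have hIoo : Ioo l r ∈ 𝓝 s := Ioo_mem_nhds hs.1 hs.2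
  by_cases h0 : φ s = 0
  · have hmin : IsLocalMin φ s := by
      filter_upwards [hIoo] with u hu
      rw [h0]
      exact hh.nonneg u (Ioo_subset_Icc_self hu)
    have hmk : m s - k s = 0 := hmin.hasDerivAt_eq_zero hφ
    have hmk' : m s = k s := by linarith
    rw [hmk] at hφ
    have h2 : HasDerivAt (fun s => (φ s : ℂ) * (I * ζ s)) 0 s := by
      rw [hasDerivAt_iff_isLittleO] at hφ ⊢
      simp only [h0, smul_zero, sub_zero, Complex.ofReal_zero, zero_mul] at hφ ⊢
      refine Asymptotics.IsLittleO.of_norm_left ?_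
      have : (fun x => ‖(φ x : ℂ) * (I * ζ x)‖) = fun x => ‖φ x‖ := by
        ext x
        simp [hc.norm_ζ]
      rw [this]
      exact hφ.norm_left
    have := (hc.hasDeriv s).add h2
    rw [add_zero] at this
    rw [hmk']
    exact this
  · have hne : ∀ᶠ u in 𝓝 s, φ u ≠ 0 := hφ.continuousAt.eventually_ne h0
    obtain ⟨δ, hδ, hball⟩ := Metric.eventually_nhds_iff_ball.1 (hne.and hIoo)
    have hζ : ∀ᶠ u in 𝓝 s, ζ u = ζ s := by
      filter_upwards [ball_mem_nhds s hδ] with u hu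
      have hseg : ∀ x ∈ uIcc s u, x ∈ ball s δ := fun x hx =>
        (convex_ball s δ).segment_subset (mem_ball_self hδ) hu (by rwa [segment_eq_uIcc])
      have hI : ∀ x ∈ ball s δ, x ∈ Icc l r := fun x hx =>
        Ioo_subset_Icc_self (hball x hx).2
      rcases le_total s u with h | h
      · rw [uIcc_of_le h] at hseg
        exact (hb.loc s (hI _ (mem_ball_self hδ)) u (hI _ hu) h
          fun x hx => (hball x (hseg x hx)).1).symm
      · rw [uIcc_of_ge h] at hseg
        exact hb.loc u (hI _ hu) s (hI _ (mem_ball_self hδ)) h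
          fun x hx => (hball x (hseg x hx)).1
    have h1 : HasDerivAt (fun u => c u + φ u * (I * ζ s)) (ζ s * (1 + m s * I)) s := by
      have := (hc.hasDeriv s).add (hφ.ofReal_comp.mul_const (I * ζ s))
      refine this.congr_deriv ?_
      push_cast
      ring
    exact h1.congr_of_eventuallyEq (hζ.mono fun u hu => by simp only [hu])

theorem continuousOn_hullCurve (hc : BentCurve k ζ c) (hh : HullData l r k m φ) :
    ContinuousOn (fun s => c s + φ s * (I * ζ s)) (Icc l r) := fun s hs => by
  refine ContinuousAt.continuousWithinAt ?_
  have h1 := hc.continuous.continuousAt (x := s)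
  have h2 := hc.contζ.continuousAt (x := s)
  have h3 : ContinuousAt (fun s => (φ s : ℂ)) s :=
    Complex.continuous_ofReal.continuousAt.comp (hh.hasDeriv s hs).continuousAt
  exact h1.add (h3.mul (continuousAt_const.mul h2))

theorem im_conj_mul_comm (a b : ℂ) : (conj a * b).im = -(conj b * a).im := by
  simp [Complex.mul_im]
  ring

/-- The region below all tangents of the hull curve. -/
def underHull (l r : ℝ) (m φ : ℝ → ℝ) (ζ c : ℝ → ℂ) : Set ℂ :=
  {z | ∀ s ∈ Icc l r, (conj (ζ s * (1 + m s * I)) * (z - (c s + φ s * (I * ζ s)))).im ≤ 0}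

theorem isClosed_underHull : IsClosed (underHull l r m φ ζ c) := by
  simp only [underHull, ofPred_forall]
  refine isClosed_biInter fun s _ => isClosed_le ?_ continuous_const
  fun_prop

theorem convex_underHull : Convex ℝ (underHull l r m φ ζ c) := by
  intro z hz w hw a b ha hb hab s hs
  have h1 := mul_nonpos_of_nonneg_of_nonpos ha (hz s hs)
  have h2 := mul_nonpos_of_nonneg_of_nonpos hb (hw s hs)
  have : ∀ d F : ℂ, (d * (a • z + b • w - F)).im = a * (d * (z - F)).im + b * (d * (w - F)).im := by
    intro d F
    have hb' : b = 1 - a := by linarith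
    subst hb'
    simp [Complex.mul_im]
    ring
  rw [this]
  linarith

theorem hullCurve_mem_underHull (hc : BentCurve k ζ c) (hh : HullData l r k m φ)
    (hb : Bending l r m φ ζ) {u : ℝ} (hu : u ∈ Icc l r) :
    c u + φ u * (I * ζ u) ∈ underHull l r m φ ζ c := by
  intro s hs
  set F : ℝ → ℂ := fun s => c s + φ s * (I * ζ s) with hF
  have hd : ∀ x ∈ Ioo l r, HasDerivAt (fun u => (conj (ζ s * (1 + m s * I)) * (F u - F s)).im)
      (conj (ζ s * (1 + m s * I)) * (ζ x * (1 + m x * I))).im x := fun x hx =>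
    hasDerivAt_im (((hasDerivAt_hullCurve hc hh hb hx).sub_const _).const_mul _)
  have hcont : ContinuousOn (fun u => (conj (ζ s * (1 + m s * I)) * (F u - F s)).im) (Icc l r) :=
    Complex.continuous_im.comp_continuousOn (continuousOn_const.mul
      ((continuousOn_hullCurve hc hh).sub continuousOn_const))
  have h0 : (conj (ζ s * (1 + m s * I)) * (F s - F s)).im = 0 := by simp
  rcases le_total s u with h | h
  · have sub : Icc s u ⊆ Icc l r := Icc_subset_Icc hs.1 hu.2
    have sub' : interior (Icc s u) ⊆ Ioo l r := by
      rw [interior_Icc]; exact Ioo_subset_Ioo hs.1 hu.2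
    have := antitoneOn_of_deriv_nonpos (convex_Icc s u) (hcont.mono sub)
      (fun x hx => (hd x (sub' hx)).differentiableAt.differentiableWithinAt)
      (fun x hx => by
        rw [(hd x (sub' hx)).deriv]
        exact hb.cross s hs x (Ioo_subset_Icc_self (sub' hx)) (interior_subset hx).1)
    have := this (left_mem_Icc.2 h) (right_mem_Icc.2 h) h
    simp only at this
    rw [h0] at this
    exact this
  · have sub : Icc u s ⊆ Icc l r := Icc_subset_Icc hu.1 hs.2
    have sub' : interior (Icc u s) ⊆ Ioo l r := by
      rw [interior_Icc]; exact Ioo_subset_Ioo hu.1 hs.2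
    have := monotoneOn_of_deriv_nonneg (convex_Icc u s) (hcont.mono sub)
      (fun x hx => (hd x (sub' hx)).differentiableAt.differentiableWithinAt)
      (fun x hx => by
        rw [(hd x (sub' hx)).deriv, im_conj_mul_comm]
        have := hb.cross x (Ioo_subset_Icc_self (sub' hx)) s hs (interior_subset hx).2
        linarith)
    have := this (left_mem_Icc.2 h) (right_mem_Icc.2 h) h
    simp only at this
    rw [h0] at this
    exact this

theorem underHull_sub_mem (hc : BentCurve k ζ c) (hh : HullData l r k m φ) {z w : ℂ}
    (hz : z ∈ underHull l r m φ ζ c) (hw : |w.re| ≤ w.im) : z - w ∈ underHull l r m φ ζ c := by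
  intro s hs
  obtain ⟨a, b, e⟩ := rotated_slope_bounds (hc.norm_ζ s) (hc.ζ_near s) (hh.m_le s hs)
  have h1 := hz s hs
  set d := ζ s * (1 + m s * I)
  set F := c s + φ s * (I * ζ s)
  have : (conj d * (z - w - F)).im = (conj d * (z - F)).im - (d.re * w.im - d.im * w.re) := by
    simp [Complex.mul_im]
    ring
  rw [this]
  have h2 : |d.im * w.re| ≤ 5 / 8 * w.im := by
    rw [abs_mul]
    exact mul_le_mul e hw (abs_nonneg _) (by norm_num)
  have h3 := (abs_le.1 h2).2
  have h4 : 0 ≤ w.im := (abs_nonneg _).trans hw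
  nlinarith

theorem curve_mem_underHull (hc : BentCurve k ζ c) (hh : HullData l r k m φ)
    (hb : Bending l r m φ ζ) {u : ℝ} (hu : u ∈ Icc l r) : c u ∈ underHull l r m φ ζ c := by
  have := underHull_sub_mem hc hh (w := φ u * (I * ζ u)) (hullCurve_mem_underHull hc hh hb hu) ?_
  · rwa [add_sub_cancel_right] at this
  · obtain ⟨a, b, e⟩ := unit_near_bounds (hc.norm_ζ u) (hc.ζ_near u)
    have h0 := hh.nonneg u hu
    simp only [Complex.mul_re, Complex.ofReal_re, Complex.I_re, zero_mul, Complex.I_im, one_mul,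
      zero_sub, Complex.ofReal_im, sub_zero, mul_neg, abs_neg, Complex.mul_im, zero_add, neg_zero, add_zero]
    rw [abs_mul, abs_of_nonneg h0]
    exact mul_le_mul_of_nonneg_left (e.trans (by linarith)) h0

theorem mem_interior_underHull (hc : BentCurve k ζ c) (hh : HullData l r k m φ)
    (hb : Bending l r m φ ζ) {z : ℂ} (hz : absInv c z.re ∈ Ioo l r) (hz' : z.im < graphFn c z.re) :
    z ∈ interior (underHull l r m φ ζ c) := by
  have c1 : Continuous fun z : ℂ => absInv c z.re :=
    hc.continuous_absInv.comp Complex.continuous_re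
  have c2 : Continuous fun z : ℂ => graphFn c z.re :=
    hc.continuous_graphFn.comp Complex.continuous_re
  rw [mem_interior_iff_mem_nhds]
  filter_upwards [c1.continuousAt.eventually (Ioo_mem_nhds hz.1 hz.2),
    (isOpen_lt Complex.continuous_im c2).mem_nhds hz'] with w h1 h2
  have h2 : w.im < graphFn c w.re := h2
  have := underHull_sub_mem hc hh (w := (graphFn c w.re - w.im : ℝ) * I)
    (curve_mem_underHull hc hh hb (Ioo_subset_Icc_self h1)) (by simpa using h2.le)
  convert this using 1
  rw [hc.curve_absInv]
  apply Complex.ext <;> simp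

/-- Points above the curve are retracted onto the part of the gaps between curve and hull. -/
theorem exists_hull_retraction (hc : BentCurve k ζ c) (hh : HullData l r k m φ)
    (hb : Bending l r m φ ζ) {s₀ : ℝ} (hs₀ : s₀ ∈ Ioo l r) :
    ∃ P : ℂ → ℂ, ∃ ρ > 0, LipschitzWith 1 P ∧ (∀ s ∈ Icc l r, P (c s) = c s) ∧
      ∀ p, dist p (c s₀) < ρ → graphFn c p.re ≤ p.im →
        ∃ s ∈ Ioo l r, ∃ v : ℝ, P p = c s + v * I ∧ 0 ≤ v ∧ v ≤ 2 * φ s := by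
  obtain ⟨P, hP1, hP2, hP3, hP4⟩ := exists_convex_projection
    ⟨_, curve_mem_underHull hc hh hb (Ioo_subset_Icc_self hs₀)⟩ isClosed_underHull convex_underHull
  have c1 : Continuous fun z : ℂ => absInv c z.re :=
    hc.continuous_absInv.comp Complex.continuous_re
  have hev : ∀ᶠ z : ℂ in 𝓝 (c s₀), absInv c z.re ∈ Ioo l r :=
    c1.continuousAt.eventually (by simp only [hc.absInv_re]; exact Ioo_mem_nhds hs₀.1 hs₀.2)
  obtain ⟨ρ, hρ, hball⟩ := Metric.eventually_nhds_iff_ball.1 hev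
  refine ⟨P, ρ, hρ, hP1, fun s hs => hP3 _ (curve_mem_underHull hc hh hb hs), fun p hp hpa => ?_⟩
  have hPc : P (c s₀) = c s₀ := hP3 _ (curve_mem_underHull hc hh hb (Ioo_subset_Icc_self hs₀))
  have hPb : P p ∈ ball (c s₀) ρ := by
    rw [mem_ball]
    have := hP1.dist_le_mul p (c s₀)
    rw [hPc, NNReal.coe_one, one_mul] at this
    exact this.trans_lt hp
  have hs := hball _ hPb
  set q := P p with hq
  set s := absInv c q.re with hsdef
  have hqe : q = c s + (q.im - graphFn c q.re : ℝ) * I := by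
    rw [hsdef, hc.curve_absInv]
    apply Complex.ext <;> simp
  refine ⟨s, hs, q.im - graphFn c q.re, hqe, ?_, ?_⟩
  · by_contra! hneg
    have hlt : q.im < graphFn c q.re := by linarith
    have := hP4 p (mem_interior_underHull hc hh hb hs hlt)
    rw [← hq] at this
    rw [this] at hlt
    exact absurd hlt (not_lt.2 hpa)
  · have hI := Ioo_subset_Icc_self hs
    have h1 := hP2 p s hI
    rw [← hq] at h1
    set v := q.im - graphFn c q.re with hv
    rw [hqe] at h1
    obtain ⟨a, b, e⟩ := rotated_slope_bounds (hc.norm_ζ s) (hc.ζ_near s) (hh.m_le s hI)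
    have hn : Complex.normSq (ζ s) = 1 := by
      rw [Complex.normSq_eq_norm_sq, hc.norm_ζ]; norm_num
    rw [Complex.normSq_apply] at hn
    have : (conj (ζ s * (1 + m s * I)) * (c s + v * I - (c s + φ s * (I * ζ s)))).im =
        v * (ζ s * (1 + m s * I)).re - φ s * ((ζ s).re * (ζ s).re + (ζ s).im * (ζ s).im) := by
      simp [Complex.mul_im]
      ring
    rw [this, hn] at h1
    have h0 := hh.nonneg s hI
    by_contra! h2
    nlinarith

end HullWindow

section WindowContraction

open Complex (I)
open scoped ComplexConjugate

variable {l r : ℝ} {k m φ : ℝ → ℝ} {ζ c ζ' c' : ℝ → ℂ}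

theorem HullData.height_le (hc : BentCurve k ζ c) (hh : HullData l r k m φ) {x s : ℝ}
    (hx : x ∈ Icc l r) (hs : s ∈ Icc l r) : |φ s - φ x| ≤ |s - x| := by
  have := (convex_Icc l r).norm_image_sub_le_of_norm_hasDerivWithin_le (C := 1)
    (fun y hy => (hh.hasDeriv y hy).hasDerivWithinAt) (fun y hy => ?_) hx hs
  · simpa using this
  · have h1 := abs_le.1 (hh.m_le y hy)
    have h2 := abs_le.1 (hc.k_le y)
    rw [Real.norm_eq_abs, abs_le]
    constructor <;> linarith

theorem exists_unrolling_estimate (hc : BentCurve k ζ c) (hc' : BentCurve k ζ' c')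
    (hh : HullData l r k m φ) (hb : Bending l r m φ ζ) (hb' : Bending l r m φ ζ')
    {ε : ℝ} (hε : 0 < ε) : ∃ δ > 0, ∀ s ∈ Icc l r, ∀ u ∈ Icc l r, ∀ v w : ℝ, 0 ≤ v → v ≤ 2 * φ s →
      0 ≤ w → w ≤ 2 * φ u → dist (c s + v * I) (c u + w * I) < δ →
      dist (c' s + v * (I * (ζ' s * conj (ζ s)))) (c' u + w * (I * (ζ' u * conj (ζ u)))) ≤
        (1 + ε) * dist (c s + v * I) (c u + w * I) := by
  set ρ : ℝ → ℂ := fun s => ζ' s * conj (ζ s) with hρ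
  have hρc : Continuous ρ := by
    have h1 := hc.contζ
    have h2 := hc'.contζ
    fun_prop
  have hρn : ∀ s, ‖ρ s‖ = 1 := fun s => by simp [hρ, hc.norm_ζ, hc'.norm_ζ]
  have huc := isCompact_Icc.uniformContinuousOn_of_continuous (s := Icc l r) hρc.continuousOn
  rw [Metric.uniformContinuousOn_iff] at huc
  obtain ⟨δ, hδ, hδρ⟩ := huc (ε / 8) (by positivity)
  refine ⟨δ / 2, half_pos hδ, ?_⟩
  intro s hs u hu v w hv0 hv hw0 hw hd
  wlog hsu : s ≤ u generalizing s u v w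
  · rw [dist_comm, dist_comm (c s + v * I)]
    rw [dist_comm] at hd
    exact this u hu s hs w v hw0 hw hv0 hv hd (le_of_not_ge hsu)
  have hre : 13 / 16 * (u - s) ≤ dist (c s + v * I) (c u + w * I) := by
    have h1 := hc.re_sub_ge hsu
    have h2 := Complex.abs_re_le_norm ((c u + w * I) - (c s + v * I))
    rw [← dist_eq_norm, dist_comm] at h2
    have h3 := le_abs_self ((c u + w * I) - (c s + v * I)).re
    have h4 : ((c u + w * I) - (c s + v * I)).re = (c u).re - (c s).re := by simp
    linarith
  have hus : u - s < δ := by linarith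
  have hsub : Icc s u ⊆ Icc l r := Icc_subset_Icc hs.1 hu.2
  have hclose : ∀ x ∈ Icc s u, ‖ρ x - ρ s‖ ≤ ε / 8 := fun x hx => by
    rw [← dist_eq_norm]
    refine (hδρ x (hsub hx) s hs ?_).le
    rw [Real.dist_eq, abs_of_nonneg (by linarith [hx.1])]
    linarith [hx.2]
  have e1 : ‖(c' u - ρ s * c u) - (c' s - ρ s * c s)‖ ≤ ε / 8 * 2 * ‖u - s‖ := by
    refine (convex_Icc s u).norm_image_sub_le_of_norm_hasDerivWithin_le
      (f := fun x => c' x - ρ s * c x)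
      (f' := fun x => (ρ x - ρ s) * (ζ x * (1 + k x * I)))
      (fun x hx => ?_) (fun x hx => ?_) (left_mem_Icc.2 hsu) (right_mem_Icc.2 hsu)
    · have := (hc'.hasDeriv x).sub ((hc.hasDeriv x).const_mul (ρ s))
      refine (this.congr_deriv ?_).hasDerivWithinAt
      have hn : ζ x * conj (ζ x) = 1 := by
        rw [Complex.mul_conj, Complex.normSq_eq_norm_sq, hc.norm_ζ]; norm_num
      have : ρ x * (ζ x * (1 + k x * I)) = ζ' x * (1 + k x * I) := by
        calc _ = ζ' x * (ζ x * conj (ζ x)) * (1 + k x * I) := by simp only [hρ]; ring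
          _ = _ := by rw [hn, mul_one]
      rw [sub_mul, this]
    · rw [norm_mul]
      refine mul_le_mul (hclose x hx) ?_ (norm_nonneg _) (by positivity)
      rw [norm_mul, hc.norm_ζ, one_mul]
      refine (norm_add_le _ _).trans ?_
      have := hc.k_le x
      rw [norm_mul, Complex.norm_I, mul_one, Complex.norm_real, norm_one, Real.norm_eq_abs]
      linarith
  have e2 : ‖(w : ℂ) * (I * (ρ u - ρ s))‖ ≤ 2 * (u - s) * (ε / 8) := by
    by_cases h : ∀ x ∈ Icc s u, φ x ≠ 0
    · have h1 := hb.loc s hs u hu hsu h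
      have h2 := hb'.loc s hs u hu hsu h
      have : ρ u - ρ s = 0 := by simp [hρ, h1, h2]
      rw [this, mul_zero, mul_zero, norm_zero]
      have : 0 ≤ u - s := by linarith
      positivity
    · push Not at h
      obtain ⟨x, hx, hx0⟩ := h
      have h1 := hh.height_le hc (hsub hx) hu
      rw [hx0, sub_zero, abs_of_nonneg (hh.nonneg u hu), abs_of_nonneg (by linarith [hx.2])] at h1
      rw [norm_mul, norm_mul, Complex.norm_I, one_mul, Complex.norm_real, Real.norm_eq_abs,
        abs_of_nonneg hw0]
      exact mul_le_mul (by linarith [hx.1]) (hclose u (right_mem_Icc.2 hsu)) (norm_nonneg _)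
        (by linarith)
  have key : (c' u + w * (I * ρ u)) - (c' s + v * (I * ρ s)) =
      ρ s * ((c u + w * I) - (c s + v * I)) + ((c' u - ρ s * c u) - (c' s - ρ s * c s)) +
        w * (I * (ρ u - ρ s)) := by ring
  rw [dist_comm, dist_eq_norm, key]
  have n1 := norm_add₃_le (a := ρ s * ((c u + w * I) - (c s + v * I)))
    (b := (c' u - ρ s * c u) - (c' s - ρ s * c s)) (c := w * (I * (ρ u - ρ s)))
  rw [norm_mul, hρn, one_mul, ← dist_eq_norm, dist_comm] at n1
  rw [Real.norm_eq_abs, abs_of_nonneg (by linarith)] at e1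
  nlinarith

/-- Unrolling the gaps does not increase relative distances. -/
theorem relContracts_of_bending (hc : BentCurve k ζ c) (hc' : BentCurve k ζ' c')
    (hh : HullData l r k m φ) (hb : Bending l r m φ ζ) (hb' : Bending l r m φ ζ')
    {s₀ : ℝ} (hs₀ : s₀ ∈ Ioo l r) {U V : Set ℂ} (hV : IsOpen V) {f : ℂ → ℂ} {R : ℝ} (hR : 0 < R)
    (hUa : ∀ z ∈ U ∩ ball (c s₀) R, graphFn c z.re ≤ z.im)
    (hVa : ∀ z ∈ ball (c' s₀) R, graphFn c' z.re < z.im → z ∈ V)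
    (hf : ∀ z ∈ frontier U ∩ ball (c s₀) R, ∃ s, z = c s ∧ f z = c' s) :
    RelContracts U V f (c s₀) := by
  obtain ⟨P, ρ₀, hρ₀, hP1, hPc, hPa⟩ := exists_hull_retraction hc hh hb hs₀
  set G : ℂ → ℂ := fun z => c' (absInv c z.re) + ((z.im - graphFn c z.re : ℝ) : ℂ) *
    (I * (ζ' (absInv c z.re) * conj (ζ (absInv c z.re)))) with hG
  have hGc : Continuous G := by
    have h1 := hc.continuous_absInv
    have h2 := hc.continuous_graphFn
    have h3 := hc.contζ
    have h4 := hc'.contζ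
    have h5 := hc'.continuous
    fun_prop
  have hGe : ∀ s v : ℝ, G (c s + v * I) = c' s + v * (I * (ζ' s * conj (ζ s))) := fun s v => by
    have : (c s + v * I).re = (c s).re := by simp
    simp only [hG, this, hc.absInv_re, hc.graphFn_re]
    simp
  have hGs : ∀ s, G (c s) = c' s := fun s => by
    have := hGe s 0
    simpa using this
  have hΨc : Continuous (G ∘ P) := hGc.comp hP1.continuous
  have hPs : ∀ᶠ z in 𝓝 (c s₀), dist (G (P z)) (c' s₀) < R / 2 := by
    have : G (P (c s₀)) = c' s₀ := by rw [hPc _ (Ioo_subset_Icc_self hs₀), hGs]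
    have h := hΨc.continuousAt.eventually (ball_mem_nhds ((G ∘ P) (c s₀)) (half_pos hR))
    simpa [this] using h
  have hσ : ∀ᶠ z : ℂ in 𝓝 (c s₀), absInv c z.re ∈ Ioo l r :=
    (hc.continuous_absInv.comp Complex.continuous_re).continuousAt.eventually
      (by simp only [Function.comp, hc.absInv_re]; exact Ioo_mem_nhds hs₀.1 hs₀.2)
  obtain ⟨R₁, hR₁, hball⟩ := Metric.eventually_nhds_iff_ball.1 (hPs.and hσ)
  set R₂ := min (min R ρ₀) R₁ with hR₂
  have hR₂0 : 0 < R₂ := lt_min (lt_min hR hρ₀) hR₁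
  have l1 : R₂ ≤ R := (min_le_left _ _).trans (min_le_left _ _)
  have l2 : R₂ ≤ ρ₀ := (min_le_left _ _).trans (min_le_right _ _)
  have l3 : R₂ ≤ R₁ := min_le_right _ _
  have hP : ∀ p ∈ U ∩ ball (c s₀) R₂, ∃ s ∈ Ioo l r, ∃ v : ℝ, P p = c s + v * I ∧ 0 ≤ v ∧
      v ≤ 2 * φ s := fun p hp =>
    hPa p ((mem_ball.1 hp.2).trans_le l2) (hUa p ⟨hp.1, ball_subset_ball l1 hp.2⟩)
  refine ⟨R₂ / 4, by positivity, fun a ha b hb₁ had hbd hab => ?_⟩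
  have htr := relMetric_transfer hV (U := U) (y := c s₀) hR₂0 (half_pos hR) (Ψ := G ∘ P) (e := I)
    hΨc.continuousOn ?_ ?_ (frontier_subset_closure ha) had (frontier_subset_closure hb₁) hbd hab
  · have hfa : ∀ a ∈ frontier U, dist a (c s₀) < R₂ / 4 → G (P a) = f a := by
      intro a ha had
      have h4 : dist a (c s₀) < R₂ := had.trans (by linarith)
      obtain ⟨s, rfl, hfs⟩ := hf a ⟨ha, mem_ball.2 (h4.trans_le l1)⟩
      have hsm := (hball (c s) (mem_ball.2 (h4.trans_le l3))).2
      rw [hc.absInv_re] at hsm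
      rw [hfs, hPc s (Ioo_subset_Icc_self hsm), hGs]
    rwa [Function.comp, Function.comp, hfa a ha had, hfa b hb₁ hbd] at htr
  · intro ε hε
    obtain ⟨δ, hδ, hest⟩ := exists_unrolling_estimate hc hc' hh hb hb' hε
    refine ⟨δ, hδ, fun p hp q hq hpq => ?_⟩
    have hPd : dist (P p) (P q) ≤ dist p q := by simpa using hP1.dist_le_mul p q
    obtain ⟨s, hs, v, hPp, hv0, hv⟩ := hP p hp
    obtain ⟨u, hu, w, hPq, hw0, hw⟩ := hP q hq
    have := hest s (Ioo_subset_Icc_self hs) u (Ioo_subset_Icc_self hu) v w hv0 hv hw0 hw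
      (by rw [← hPp, ← hPq]; exact hPd.trans_lt hpq)
    rw [← hGe, ← hGe, ← hPp, ← hPq] at this
    exact this.trans (mul_le_mul_of_nonneg_left hPd (by positivity))
  · intro p hp τ hτ0 hτ
    obtain ⟨s, hs, v, hPp, hv0, hv⟩ := hP p hp
    have hd := (hball p (ball_subset_ball l3 hp.2)).1
    have hcone : graphFn c' (G (P p)).re ≤ (G (P p)).im := by
      rw [hPp, hGe]
      refine hc'.graphFn_add_le s ?_
      obtain ⟨a1, a2, a3⟩ := unit_near_bounds (hc.norm_ζ s) (hc.ζ_near s)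
      obtain ⟨b1, b2, b3⟩ := unit_near_bounds (hc'.norm_ζ s) (hc'.ζ_near s)
      set A := ζ s
      set B := ζ' s
      have hre : ((v : ℂ) * (I * (B * conj A))).re = v * (B.re * A.im - B.im * A.re) := by
        simp only [Complex.mul_re, Complex.mul_im, Complex.ofReal_re, Complex.ofReal_im,
          Complex.I_re, Complex.I_im, Complex.conj_re, Complex.conj_im]
        ring
      have him : ((v : ℂ) * (I * (B * conj A))).im = v * (B.re * A.re + B.im * A.im) := by
        simp
      rw [hre, him, abs_mul, abs_of_nonneg hv0]
      refine mul_le_mul_of_nonneg_left ?_ hv0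
      have x1 : |B.re * A.im| ≤ 1 / 8 := by
        rw [abs_mul, abs_of_nonneg (by linarith : 0 ≤ B.re)]
        nlinarith [abs_nonneg A.im]
      have x2 : |B.im * A.re| ≤ 1 / 8 := by
        rw [abs_mul, abs_of_nonneg (by linarith : 0 ≤ A.re)]
        nlinarith [abs_nonneg B.im]
      have x3 : |B.im * A.im| ≤ 1 / 64 := by
        rw [abs_mul]
        nlinarith [abs_nonneg A.im, abs_nonneg B.im]
      have x4 := abs_le.1 x3
      have x5 := abs_sub (B.re * A.im) (B.im * A.re)
      nlinarith
    have hτ' : (G ∘ P) p + τ • I = G (P p) + τ * I := by simp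
    rw [hτ']
    refine hVa _ ?_ ?_
    · rw [mem_ball]
      calc dist (G (P p) + τ * I) (c' s₀) ≤ dist (G (P p) + τ * I) (G (P p)) +
            dist (G (P p)) (c' s₀) := dist_triangle _ _ _
        _ < R / 2 + R / 2 := by
            refine add_lt_add ?_ hd
            rw [dist_eq_norm, add_sub_cancel_left, norm_mul, Complex.norm_I, mul_one,
              Complex.norm_real, Real.norm_eq_abs, abs_of_pos hτ0]
            exact hτ
        _ = R := by ring
    · have : (G (P p) + τ * I).re = (G (P p)).re := by simp
      rw [this]
      have : (G (P p) + τ * I).im = (G (P p)).im + τ := by simp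
      linarith

end WindowContraction

section WindowMove

theorem relContracts_of_isometry {X : Type*} [NormedAddCommGroup X] [NormedSpace ℝ X]
    {U V : Set X} (hV : IsOpen V) {f T : X → X} (hT : Isometry T) {y : X} {R : ℝ} (hR : 0 < R)
    (hUV : ∀ z ∈ U ∩ ball y R, T z ∈ V) (hf : ∀ z ∈ frontier U ∩ ball y R, f z = T z) :
    RelContracts U V f y := by
  refine ⟨R / 4, by positivity, fun a ha b hb had hbd hab => ?_⟩
  have := relMetric_transfer hV (U := U) (y := y) hR one_pos (Ψ := T) (e := 0)
    hT.continuous.continuousOn (fun ε hε => ⟨1, one_pos, fun p _ q _ _ => ?_⟩)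
    (fun p hp τ _ _ => by simpa using hUV p hp)
    (frontier_subset_closure ha) had (frontier_subset_closure hb) hbd hab
  · rwa [hf a ⟨ha, mem_ball.2 (had.trans (by linarith))⟩,
      hf b ⟨hb, mem_ball.2 (hbd.trans (by linarith))⟩]
  · rw [hT.dist_eq]
    nlinarith [dist_nonneg (x := p) (y := q)]

theorem mem_frontier_iff_of_eventually {Z : Type*} [TopologicalSpace Z] {A B : Set Z} {x : Z}
    (h : ∀ᶠ z in 𝓝 x, (z ∈ A ↔ z ∈ B)) : x ∈ frontier A ↔ x ∈ frontier B := by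
  rw [← not_iff_not, notMem_frontier_iff_eventually, notMem_frontier_iff_eventually,
    h.self_of_nhds]
  exact eventually_congr (h.mono fun z hz => by rw [hz])

/-- `U` and `V` agree off `K`, and in `B` they are the regions above two bent curves. -/
structure WindowMove (U V K B : Set ℂ) (T : Set ℝ) (k : ℝ → ℝ) (ζ c ζ' c' : ℝ → ℂ) : Prop where
  curve : BentCurve k ζ c
  curve' : BentCurve k ζ' c'
  isOpen : IsOpen B
  isClosed : IsClosed K
  agree : ∀ z, z ∉ K → (z ∈ U ↔ z ∈ V)
  above : ∀ z ∈ B, z ∈ U ↔ graphFn c z.re < z.im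
  above' : ∀ z ∈ B, z ∈ V ↔ graphFn c' z.re < z.im
  inter_eq : K ∩ frontier U = c '' T
  inter_eq' : K ∩ frontier V = Set.image c' T
  mem : ∀ s ∈ T, c s ∈ B ∧ c' s ∈ B
  off : ∀ s, s ∉ T → c s = c' s
  win : ∀ s₀ ∈ T, ∃ l r m φ, s₀ ∈ Ioo l r ∧ HullData l r k m φ ∧ Bending l r m φ ζ ∧
    Bending l r m φ ζ'

open scoped Classical in
/-- Slide along the curves within `K`. -/
def slide (K : Set ℂ) (c c' : ℝ → ℂ) (z : ℂ) : ℂ :=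
  if z ∈ K then c' (absInv c z.re) else z

namespace WindowMove

variable {U V K B : Set ℂ} {T : Set ℝ} {k : ℝ → ℝ} {ζ c ζ' c' : ℝ → ℂ}

theorem symm (h : WindowMove U V K B T k ζ c ζ' c') : WindowMove V U K B T k ζ' c' ζ c where
  curve := h.curve'
  curve' := h.curve
  isOpen := h.isOpen
  isClosed := h.isClosed
  agree := fun z hz => (h.agree z hz).symm
  above := h.above'
  above' := h.above
  inter_eq := h.inter_eq'
  inter_eq' := h.inter_eq
  mem := fun s hs => (h.mem s hs).symm
  off := fun s hs => (h.off s hs).symm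
  win := fun s hs => by
    obtain ⟨l, r, m, φ, h1, h2, h3, h4⟩ := h.win s hs
    exact ⟨l, r, m, φ, h1, h2, h4, h3⟩

theorem frontier_iff (h : WindowMove U V K B T k ζ c ζ' c') {z : ℂ} (hz : z ∉ K) :
    z ∈ frontier U ↔ z ∈ frontier V :=
  mem_frontier_iff_of_eventually
    ((h.isClosed.isOpen_compl.mem_nhds hz : Kᶜ ∈ 𝓝 z) |> fun hK => by
      filter_upwards [hK] with w hw using h.agree w hw)

theorem eq_curve (h : WindowMove U V K B T k ζ c ζ' c') (hU : IsOpen U) {z : ℂ} (hz : z ∈ B)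
    (hf : z ∈ frontier U) : z = c (absInv c z.re) := by
  have him : z.im = graphFn c z.re := by
    rcases lt_trichotomy z.im (graphFn c z.re) with h1 | h1 | h1
    · exfalso
      refine notMem_frontier_iff_eventually.2 ?_ hf
      have c2 : Continuous fun z : ℂ => graphFn c z.re :=
        h.curve.continuous_graphFn.comp Complex.continuous_re
      filter_upwards [h.isOpen.mem_nhds hz, (isOpen_lt Complex.continuous_im c2).mem_nhds h1]
        with w hw hw2
      have hw2 : w.im < graphFn c w.re := hw2
      exact iff_of_false (fun h' => absurd ((h.above w hw).1 h') (not_lt.2 hw2.le))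
        (fun h' => absurd ((h.above z hz).1 h') (not_lt.2 h1.le))
    · exact h1
    · exact absurd (hU.inter_frontier_eq.subset ⟨(h.above z hz).2 h1, hf⟩) (notMem_empty _)
  rw [h.curve.curve_absInv, ← him, Complex.re_add_im]

theorem slide_curve (h : WindowMove U V K B T k ζ c ζ' c') {s : ℝ} (hs : c s ∈ frontier U) :
    slide K c c' (c s) = c' s := by
  unfold slide
  split_ifs with hK
  · rw [h.curve.absInv_re]
  · refine h.off s fun hsT => hK ?_
    exact (h.inter_eq.symm.subset (mem_image_of_mem c hsT)).1

theorem slide_of_notMem {z : ℂ} (hz : z ∉ K) : slide K c c' z = z := if_neg hz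

theorem mapsTo (h : WindowMove U V K B T k ζ c ζ' c') :
    MapsTo (slide K c c') (frontier U) (frontier V) := by
  intro z hz
  by_cases hK : z ∈ K
  · obtain ⟨s, hs, rfl⟩ := h.inter_eq.subset ⟨hK, hz⟩
    rw [h.slide_curve hz]
    exact (h.inter_eq'.symm.subset (mem_image_of_mem c' hs)).2
  · rw [slide_of_notMem hK]
    exact (h.frontier_iff hK).1 hz

theorem slide_slide (h : WindowMove U V K B T k ζ c ζ' c') {z : ℂ} (hz : z ∈ frontier U) :
    slide K c' c (slide K c c' z) = z := by
  by_cases hK : z ∈ K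
  · obtain ⟨s, hs, rfl⟩ := h.inter_eq.subset ⟨hK, hz⟩
    rw [h.slide_curve hz, h.symm.slide_curve (h.inter_eq'.symm.subset (mem_image_of_mem c' hs)).2]
  · rw [slide_of_notMem hK, slide_of_notMem hK]

theorem continuousOn_slide (h : WindowMove U V K B T k ζ c ζ' c') (hU : IsOpen U) :
    ContinuousOn (slide K c c') (frontier U) := by
  intro z hz
  by_cases hK : z ∈ K
  · obtain ⟨s, hs, rfl⟩ := h.inter_eq.subset ⟨hK, hz⟩
    have hcont : ContinuousAt (fun z : ℂ => c' (absInv c z.re)) (c s) :=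
      (h.curve'.continuous.comp (h.curve.continuous_absInv.comp
        Complex.continuous_re)).continuousAt
    have heq : ∀ w ∈ B ∩ frontier U, slide K c c' w = c' (absInv c w.re) := by
      rintro w ⟨hw, hwf⟩
      have e := h.eq_curve hU hw hwf
      conv_lhs => rw [e]
      exact h.slide_curve (e ▸ hwf)
    refine hcont.continuousWithinAt.congr_of_eventuallyEq ?_ (heq _ ⟨(h.mem s hs).1, hz⟩)
    filter_upwards [self_mem_nhdsWithin, mem_nhdsWithin_of_mem_nhds
      (h.isOpen.mem_nhds (h.mem s hs).1)] with w hw hwB using heq w ⟨hwB, hw⟩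
  · refine continuousWithinAt_id.congr_of_eventuallyEq ?_ (slide_of_notMem hK)
    filter_upwards [mem_nhdsWithin_of_mem_nhds (h.isClosed.isOpen_compl.mem_nhds hK)] with w hw
      using slide_of_notMem hw

theorem relContracts (h : WindowMove U V K B T k ζ c ζ' c') (hU : IsOpen U) (hV : IsOpen V)
    {y : ℂ} (hy : y ∈ frontier U) : RelContracts U V (slide K c c') y := by
  by_cases hK : y ∈ K
  · obtain ⟨s, hs, rfl⟩ := h.inter_eq.subset ⟨hK, hy⟩
    obtain ⟨l, r, m, φ, h1, h2, h3, h4⟩ := h.win s hs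
    obtain ⟨hB, hB'⟩ := h.mem s hs
    obtain ⟨R₁, hR₁, hr₁⟩ := Metric.isOpen_iff.1 h.isOpen _ hB
    obtain ⟨R₂, hR₂, hr₂⟩ := Metric.isOpen_iff.1 h.isOpen _ hB'
    refine relContracts_of_bending h.curve h.curve' h2 h3 h4 h1 hV (lt_min hR₁ hR₂) ?_ ?_ ?_
    · rintro z ⟨hz, hzb⟩
      exact ((h.above z (hr₁ (ball_subset_ball (min_le_left _ _) hzb))).1 hz).le
    · intro z hzb hz
      exact (h.above' z (hr₂ (ball_subset_ball (min_le_right _ _) hzb))).2 hz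
    · rintro z ⟨hz, hzb⟩
      have e := h.eq_curve hU (hr₁ (ball_subset_ball (min_le_left _ _) hzb)) hz
      refine ⟨_, e, ?_⟩
      conv_lhs => rw [e]
      exact h.slide_curve (e ▸ hz)
  · obtain ⟨R, hR, hr⟩ := Metric.isOpen_iff.1 h.isClosed.isOpen_compl y hK
    exact relContracts_of_isometry hV isometry_id hR
      (fun z hz => (h.agree z (hr hz.2)).1 hz.1) fun z hz => slide_of_notMem (hr hz.2)

theorem bdryLocalIsometry (h : WindowMove U V K B T k ζ c ζ' c') (hU : IsOpen U) (hUb : C1Bdry U)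
    (hV : IsOpen V) : BdryLocalIsometry U V (slide K c c') := by
  refine bdryLocalIsometry_of_relContracts hU hUb (g := slide K c' c) ?_
    (fun a ha => h.slide_slide ha) (h.continuousOn_slide hU) (fun y hy => h.relContracts hU hV hy)
    (fun y hy => h.symm.relContracts hV hU (h.mapsTo hy))
  exact InvOn.bijOn ⟨fun a ha => h.slide_slide ha, fun a ha => h.symm.slide_slide ha⟩ h.mapsTo
    h.symm.mapsTo

end WindowMove

end WindowMove

section ShearWindow

theorem windowMove_of_shear {U B K : Set ℂ} {T : Set ℝ} {k χ h : ℝ → ℝ} {ζ c ζ' c' : ℝ → ℂ}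
    (hc : BentCurve k ζ c) (hc' : BentCurve k ζ' c') (hχ : ContDiff ℝ 1 χ) (hh : ContDiff ℝ 1 h)
    (hpos : ∀ x y, 0 < 1 + deriv χ y * h x) (hb : ∀ y, |χ y| ≤ 1)
    (hU : C1Domain U) (hB : IsOpen B) (hK : IsClosed K)
    (hBs : ∀ z, shear χ h z ∈ B ↔ z ∈ B) (hKs : ∀ z, shear χ h z ∈ K ↔ z ∈ K)
    (hoff : ∀ z, z ∉ K → shear χ h z = z)
    (habove : ∀ z ∈ B, z ∈ U ↔ graphFn c z.re < z.im)
    (hχB : ∀ z ∈ B, graphFn c z.re + χ (graphFn c z.re) * h z.re = graphFn c' z.re)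
    (hinter : K ∩ frontier U = c '' T) (hmem : ∀ s ∈ T, c s ∈ B)
    (hoffT : ∀ s, s ∉ T → c s = c' s)
    (hwin : ∀ s₀ ∈ T, ∃ l r m φ, s₀ ∈ Ioo l r ∧ HullData l r k m φ ∧ Bending l r m φ ζ ∧
      Bending l r m φ ζ') :
    WindowMove U (shear χ h '' U) K B T k ζ c ζ' c' := by
  have hbij := shear_bijective (h := h) hχ hb hpos
  have hT : ∀ s, absInv c' (c s).re ∈ T ↔ s ∈ T := by
    intro s
    constructor
    · intro hu
      by_contra hs
      rw [hoffT s hs, hc'.absInv_re] at hu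
      exact hs hu
    · intro hs
      by_contra hu
      have h1 := congrArg Complex.re (hoffT _ hu)
      rw [hc'.re_absInv] at h1
      rw [hc.re_strictMono.injective h1] at hu
      exact hu hs
  have hsc : ∀ s, c s ∈ B → shear χ h (c s) = c' (absInv c' (c s).re) := by
    intro s hs
    rw [hc'.curve_absInv]
    have := hχB _ hs
    rw [hc.graphFn_re] at this
    apply Complex.ext
    · simp
    · simp [this]
  have himg : Set.image c' T = shear χ h '' (c '' T) := by
    ext z
    constructor
    · rintro ⟨s, hs, rfl⟩
      have h1 : absInv c' (c (absInv c (c' s).re)).re = s := by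
        rw [hc.re_absInv, hc'.absInv_re]
      have h2 : absInv c (c' s).re ∈ T := by rw [← hT, h1]; exact hs
      exact ⟨_, mem_image_of_mem c h2, by rw [hsc _ (hmem _ h2), h1]⟩
    · rintro ⟨_, ⟨s, hs, rfl⟩, rfl⟩
      exact ⟨_, (hT s).2 hs, (hsc s (hmem s hs)).symm⟩
  have hUV := (c1Domain_shear hχ hh hb hpos hU).2
  refine ⟨hc, hc', hB, hK, fun z hz => ⟨fun h1 => ⟨z, h1, hoff z hz⟩, ?_⟩, habove, ?_, hinter, ?_,
    fun s hs => ⟨hmem s hs, ?_⟩, hoffT, hwin⟩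
  · rintro ⟨w, hw, rfl⟩
    rw [hKs] at hz
    rwa [hoff w hz]
  · intro z hz
    obtain ⟨w, rfl⟩ := hbij.2 z
    rw [hBs] at hz
    rw [hbij.1.mem_set_image, habove w hz, shear_re, ← hχB w hz, shear_im]
    exact ((shear_section_strictMono hχ hpos w.re).lt_iff_lt (a := graphFn c w.re)
      (b := w.im)).symm
  · rw [himg, ← hinter, image_inter hbij.1, hUV]
    congr 1
    ext z
    constructor
    · intro hz
      obtain ⟨w, rfl⟩ := hbij.2 z
      exact mem_image_of_mem _ ((hKs w).1 hz)
    · rintro ⟨w, hw, rfl⟩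
      exact (hKs w).2 hw
  · have : c' s ∈ Set.image c' T := mem_image_of_mem _ hs
    rw [himg] at this
    obtain ⟨_, ⟨u, hu, rfl⟩, he⟩ := this
    rw [← he, hBs]
    exact hmem u hu

end ShearWindow

section Angles

open Complex (I)
open scoped ComplexConjugate

/-- The curve starting from `p` at time `a` with velocity `1 + k I` turned by the angle `α`. -/
def turned (k α : ℝ → ℝ) (a : ℝ) (p : ℂ) (s : ℝ) : ℂ :=
  p + ∫ t in a..s, Complex.exp (I * α t) * (1 + k t * I)

theorem hasDerivAt_turned {k α : ℝ → ℝ} (hk : Continuous k) (hα : Continuous α) (a : ℝ) (p : ℂ)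
    (s : ℝ) : HasDerivAt (turned k α a p) (Complex.exp (I * α s) * (1 + k s * I)) s := by
  have hc : Continuous fun t : ℝ => Complex.exp (I * α t) * (1 + k t * I) := by fun_prop
  exact (hc.integral_hasStrictDerivAt a s).hasDerivAt.const_add p

theorem bentCurve_turned {k α : ℝ → ℝ} (hk : Continuous k) (hα : Continuous α)
    (hk2 : ∀ s, |k s| ≤ 1 / 2) (hα2 : ∀ s, |α s| ≤ 1 / 8) (a : ℝ) (p : ℂ) :
    BentCurve k (fun s => Complex.exp (I * α s)) (turned k α a p) where
  contk := hk
  contζ := by fun_prop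
  k_le := hk2
  norm_ζ s := Complex.norm_exp_I_mul_ofReal _
  ζ_near s := Real.norm_exp_I_mul_ofReal_sub_one_le.trans (hα2 s)
  hasDeriv := hasDerivAt_turned hk hα a p

theorem turned_im_conj (m m' α α' : ℝ) :
    (conj (Complex.exp (I * α) * (1 + m * I)) * (Complex.exp (I * α') * (1 + m' * I))).im =
      Real.sin (α' - α) * (1 + m * m') + Real.cos (α' - α) * (m' - m) := by
  have h1 : ∀ x : ℝ, Complex.exp (I * x) = Real.cos x + Real.sin x * I := fun x => by
    rw [mul_comm, Complex.exp_mul_I, Complex.ofReal_cos, Complex.ofReal_sin]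
  rw [h1, h1, Real.sin_sub, Real.cos_sub]
  simp only [map_mul, map_add, map_one, Complex.conj_ofReal, Complex.conj_I, Complex.mul_im,
    Complex.mul_re, Complex.add_re, Complex.add_im, Complex.ofReal_re, Complex.ofReal_im,
    Complex.one_re, Complex.one_im, Complex.neg_re, Complex.neg_im, Complex.I_re, Complex.I_im]
  ring

theorem turned_cross_nonpos {m m' α α' : ℝ} (hm : |m| ≤ 1 / 2) (hm' : |m'| ≤ 1 / 2)
    (hle : |α' - α| ≤ (m - m') / 4) :
    (conj (Complex.exp (I * α) * (1 + m * I)) * (Complex.exp (I * α') * (1 + m' * I))).im ≤ 0 := by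
  rw [turned_im_conj]
  set Δ := α' - α
  have h1 := abs_le.1 hm
  have h2 := abs_le.1 hm'
  have h3 : |m * m'| ≤ 1 / 2 * (1 / 2) := by rw [abs_mul]; gcongr
  have h3' := abs_le.1 h3
  have h4 : |Real.sin Δ| ≤ |Δ| := Real.abs_sin_le_abs
  have h5 := Real.one_sub_sq_div_two_le_cos (x := Δ)
  have h6 : |Δ| ≤ 1 / 4 := by linarith
  have h7 : Δ ^ 2 ≤ (1 / 4) ^ 2 := sq_le_sq' (by linarith [(abs_le.1 h6).1]) (abs_le.1 h6).2
  have h8 : Real.sin Δ * (1 + m * m') ≤ |Δ| * (1 + m * m') :=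
    mul_le_mul_of_nonneg_right ((le_abs_self _).trans h4) (by linarith)
  nlinarith [abs_nonneg Δ]

theorem turned_cross_nonpos_of_flat {α α' : ℝ} (h1 : α' ≤ α) (h2 : |α| ≤ 1 / 8) (h3 : |α'| ≤ 1 / 8) :
    (conj (Complex.exp (I * α) * (1 + (0 : ℝ) * I)) *
      (Complex.exp (I * α') * (1 + (0 : ℝ) * I))).im ≤ 0 := by
  rw [turned_im_conj]
  have h2 := abs_le.1 h2
  have h3 := abs_le.1 h3
  have := Real.sin_nonpos_of_nonpos_of_neg_pi_le (x := α' - α) (by linarith)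
    (by linarith [Real.pi_gt_three])
  simpa using this

theorem not_isometric_of_convex {U V : Set ℂ} (hU : Convex ℝ U) (hV : ¬ Convex ℝ V) :
    ¬ ∃ J : ℂ ≃ᵢ ℂ, J '' U = V := by
  rintro ⟨J, rfl⟩
  apply hV
  have : J '' U = J.toRealAffineIsometryEquiv.toAffineEquiv.toAffineMap '' U := rfl
  rw [this]
  exact hU.affine_image _

end Angles

section FlatRay

open Complex (I)

/-- A decreasing angle: zero up to `a`, constant after `b`. -/
def turnAngle (β a b s : ℝ) : ℝ := -β * Real.smoothTransition ((s - a) / (b - a))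

theorem continuous_turnAngle (β a b : ℝ) : Continuous (turnAngle β a b) := by
  unfold turnAngle
  have := Real.smoothTransition.continuous
  fun_prop

theorem contDiff_turnAngle (β a b : ℝ) : ContDiff ℝ 1 (turnAngle β a b) :=
  contDiff_const.mul (Real.smoothTransition.contDiff.comp
    ((contDiff_id.sub contDiff_const).div_const _))

variable {β a b : ℝ}

theorem turnAngle_of_le (hab : a < b) {s : ℝ} (hs : s ≤ a) : turnAngle β a b s = 0 := by
  rw [turnAngle, Real.smoothTransition.zero_of_nonpos, mul_zero]
  exact div_nonpos_of_nonpos_of_nonneg (by linarith) (by linarith)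

theorem turnAngle_of_ge (hab : a < b) {s : ℝ} (hs : b ≤ s) : turnAngle β a b s = -β := by
  rw [turnAngle, Real.smoothTransition.one_of_one_le, mul_one]
  rw [le_div_iff₀ (by linarith)]
  linarith

theorem turnAngle_antitone (hβ : 0 ≤ β) (hab : a < b) : Antitone (turnAngle β a b) := by
  intro s t hst
  have : Real.smoothTransition ((s - a) / (b - a)) ≤ Real.smoothTransition ((t - a) / (b - a)) :=
    Real.smoothTransition.monotone (by
      have : 0 < b - a := by linarith
      gcongr)
  unfold turnAngle
  nlinarith

theorem turnAngle_nonpos (hβ : 0 ≤ β) (s : ℝ) : turnAngle β a b s ≤ 0 := by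
  have := Real.smoothTransition.nonneg ((s - a) / (b - a))
  unfold turnAngle
  nlinarith

theorem abs_turnAngle_le (hβ : 0 ≤ β) (s : ℝ) : |turnAngle β a b s| ≤ β := by
  have h1 := Real.smoothTransition.nonneg ((s - a) / (b - a))
  have h2 := Real.smoothTransition.le_one ((s - a) / (b - a))
  rw [turnAngle, abs_mul, abs_neg, abs_of_nonneg hβ, abs_of_nonneg h1]
  nlinarith

theorem turnAngle_neg (hβ : 0 < β) (hab : a < b) {s : ℝ} (hs : a < s) : turnAngle β a b s < 0 := by
  have := Real.smoothTransition.pos_of_pos (x := (s - a) / (b - a))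
    (div_pos (by linarith) (by linarith))
  unfold turnAngle
  nlinarith

theorem hasDerivAt_turned_im (α : ℝ → ℝ) (hα : Continuous α) (s : ℝ) :
    HasDerivAt (fun s => (turned 0 α 0 0 s).im) (Real.sin (α s)) s := by
  have := hasDerivAt_im (hasDerivAt_turned (k := 0) continuous_const hα 0 0 s)
  convert this using 1
  rw [mul_comm I, Complex.exp_mul_I]
  simp [Complex.sin_ofReal_re]

theorem turned_eq_of_flat {α : ℝ → ℝ} {s : ℝ} (hs : ∀ t ∈ uIcc 0 s, α t = 0) :
    turned 0 α 0 0 s = s := by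
  have : ∫ t in (0:ℝ)..s, Complex.exp (I * α t) * (1 + (0 : ℝ → ℝ) t * I) = ∫ t in (0:ℝ)..s, (1:ℂ) :=
    intervalIntegral.integral_congr fun t ht => by simp [hs t ht]
  rw [turned, this]
  simp

theorem turned_flat (s : ℝ) : turned 0 0 0 0 s = s :=
  turned_eq_of_flat (by simp)

theorem bending_flat {α : ℝ → ℝ} (hα : Antitone α) (hα2 : ∀ s, |α s| ≤ 1 / 8) (l r : ℝ) :
    Bending l r 0 0 (fun s => Complex.exp (I * α s)) where
  loc s _ _ _ hsu h := absurd rfl (h s ⟨le_rfl, hsu⟩)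
  cross s _ u _ hsu := turned_cross_nonpos_of_flat (hα hsu) (hα2 s) (hα2 u)

theorem hullData_flat (l r : ℝ) : HullData l r 0 0 0 where
  nonneg s _ := le_rfl
  hasDeriv s _ := by
    simp
  m_le s _ := by simp

end FlatRay

section FlatRay

open Complex (I)

theorem frontier_iff_of_flat {U B : Set ℂ} (hB : IsOpen B) (h : ∀ z ∈ B, z ∈ U ↔ 0 < z.im) {z : ℂ}
    (hz : z ∈ B) : z ∈ frontier U ↔ z.im = 0 := by
  have : z ∈ frontier U ↔ z ∈ frontier {w : ℂ | 0 < w.im} :=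
    mem_frontier_iff_of_eventually (by
      filter_upwards [hB.mem_nhds hz] with w hw
      exact h w hw)
  rw [this, Complex.frontier_setOfPred_lt_im]
  rfl

/-- The graph of a curve that is straight up to abscissa `a` and then bends downwards. -/
theorem graphFn_turnAngle {β a b : ℝ} (hβ : 0 < β) (hβ2 : β ≤ 1 / 8) (ha : 0 ≤ a) (hab : a < b) :
    ContDiff ℝ 1 (graphFn (turned 0 (turnAngle β a b) 0 0)) ∧
    (∀ x, graphFn (turned 0 (turnAngle β a b) 0 0) x ≤ 0) ∧
    (∀ x ≤ a, graphFn (turned 0 (turnAngle β a b) 0 0) x = 0) ∧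
    (∀ x > a, graphFn (turned 0 (turnAngle β a b) 0 0) x < 0) ∧
    (∀ s ≤ a, turned 0 (turnAngle β a b) 0 0 s = s) ∧
    (∀ s, a < s → a < (turned 0 (turnAngle β a b) 0 0 s).re) := by
  have hα := continuous_turnAngle β a b
  have hα8 : ∀ s, |turnAngle β a b s| ≤ 1 / 8 := fun s => (abs_turnAngle_le hβ.le s).trans hβ2
  have hbc := bentCurve_turned (k := 0) continuous_const hα (by simp) hα8 0 0
  set c := turned 0 (turnAngle β a b) 0 0 with hc
  have h5 : ∀ s ≤ a, c s = s := fun s hs => turned_eq_of_flat fun t ht => by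
    apply turnAngle_of_le hab
    rcases mem_uIcc.1 ht with h | h <;> linarith [h.2]
  have h6 : ∀ s, a < s → a < (c s).re := fun s hs => by
    have := hbc.re_strictMono hs
    simpa [h5 a le_rfl] using this
  have hneg : ∀ s, a < s → (c s).im < 0 := by
    intro s hs
    have : StrictAntiOn (fun s => (c s).im) (Ici a) := by
      apply strictAntiOn_of_deriv_neg (convex_Ici a)
      · exact (Complex.continuous_im.comp hbc.continuous).continuousOn
      · intro x hx
        rw [interior_Ici] at hx
        rw [(hasDerivAt_turned_im _ hα x).deriv]
        have := abs_le.1 (hα8 x)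
        exact Real.sin_neg_of_neg_of_neg_pi_lt (turnAngle_neg hβ hab hx)
          (by linarith [Real.pi_gt_three])
    have := this (self_mem_Ici) hs.le hs
    simpa [h5 a le_rfl] using this
  have h3 : ∀ x ≤ a, graphFn c x = 0 := fun x hx => by
    have := hbc.graphFn_re x
    simpa [h5 x hx] using this
  have h4 : ∀ x > a, graphFn c x < 0 := fun x hx => by
    have h : a < absInv c x := by
      by_contra hcon
      have := hbc.re_absInv x
      rw [h5 _ (le_of_not_gt hcon)] at this
      simp at this
      linarith
    exact hneg _ h
  refine ⟨hbc.contDiff_graphFn, fun x => ?_, h3, h4, h5, h6⟩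
  rcases le_or_gt x a with h | h
  · exact (h3 x h).le
  · exact (h4 x h).le

theorem notDetermined_of_flat_ray {U : Set ℂ} (hU : C1Domain U) (hconv : Convex ℝ U) {τ : ℝ}
    (hτ : 0 < τ) (hflat : ∀ z : ℂ, 0 < z.re → z.im < τ → (z ∈ U ↔ 0 < z.im)) :
    NotDetermined U := by
  obtain ⟨g1, g2, g3, g4, g5, g6⟩ :=
    graphFn_turnAngle (β := 1 / 8) (a := 2) (b := 3) (by norm_num) le_rfl (by norm_num) (by norm_num)
  have hα8 : ∀ s, |turnAngle (1 / 8) 2 3 s| ≤ 1 / 8 := abs_turnAngle_le (by norm_num)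
  have hα := continuous_turnAngle (1 / 8) 2 3
  have hc' := bentCurve_turned (k := 0) continuous_const hα (by simp) hα8 0 0
  have hc := bentCurve_turned (k := 0) (α := 0) continuous_const continuous_const (by simp)
    (by simp) 0 0
  set c' := turned 0 (turnAngle (1 / 8) 2 3) 0 0
  set χ : ℝ → ℝ := fun y => 1 + turnAngle 1 (τ / 3) (2 * τ / 3) y with hχdef
  have hlt : τ / 3 < 2 * τ / 3 := by linarith
  have hχ : ContDiff ℝ 1 χ := contDiff_const.add (contDiff_turnAngle _ _ _)
  have hχanti : Antitone χ := (turnAngle_antitone zero_le_one hlt).const_add 1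
  have hχ' : ∀ y, deriv χ y ≤ 0 := fun y => hχanti.deriv_nonpos
  have hχ0 : ∀ y, 0 ≤ χ y := fun y => by
    have := abs_le.1 (abs_turnAngle_le (β := 1) (a := τ / 3) (b := 2 * τ / 3) zero_le_one y)
    simp only [hχdef]; linarith
  have hχ1 : ∀ y, χ y ≤ 1 := fun y => by
    have := turnAngle_nonpos (β := 1) (a := τ / 3) (b := 2 * τ / 3) zero_le_one y
    simp only [hχdef]; linarith
  have hχl : ∀ y ≤ τ / 3, χ y = 1 := fun y hy => by
    simp [hχdef, turnAngle_of_le hlt hy]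
  have hχr : ∀ y, 2 * τ / 3 ≤ y → χ y = 0 := fun y hy => by
    simp [hχdef, turnAngle_of_ge hlt hy]
  have hpos : ∀ x y, 0 < 1 + deriv χ y * graphFn c' x := fun x y => by
    nlinarith [mul_nonneg_of_nonpos_of_nonpos (hχ' y) (g2 x)]
  have hb : ∀ y, |χ y| ≤ 1 := fun y => abs_le.2 ⟨by linarith [hχ0 y], hχ1 y⟩
  set B : Set ℂ := {z | 0 < z.re ∧ z.im < τ} with hBdef
  have hB : IsOpen B := (isOpen_lt continuous_const Complex.continuous_re).inter
    (isOpen_lt Complex.continuous_im continuous_const)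
  set K : Set ℂ := {z | 1 ≤ z.re ∧ z.im ≤ 2 * τ / 3} with hKdef
  have hK : IsClosed K := (isClosed_le continuous_const Complex.continuous_re).inter
    (isClosed_le Complex.continuous_im continuous_const)
  have hUB : ∀ z ∈ B, z ∈ U ↔ 0 < z.im := fun z hz => hflat z hz.1 hz.2
  have hg0 : ∀ x, graphFn (turned 0 0 0 0) x = 0 := fun x => by
    have := hc.graphFn_re x
    simpa [turned_flat] using this
  have him : ∀ (z : ℂ) (t : ℝ), 2 * τ / 3 ≤ t →
      (z.im + χ z.im * graphFn c' z.re ≤ t ↔ z.im ≤ t) := fun z t ht => by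
    rcases le_total z.im (2 * τ / 3) with h | h
    · have := mul_nonpos_of_nonneg_of_nonpos (hχ0 z.im) (g2 z.re)
      exact ⟨fun _ => by linarith, fun _ => by linarith⟩
    · rw [hχr _ h]; simp
  have him' : ∀ (z : ℂ) (t : ℝ), 2 * τ / 3 ≤ t →
      (z.im + χ z.im * graphFn c' z.re < t ↔ z.im < t) := fun z t ht => by
    rcases le_total z.im (2 * τ / 3) with h | h
    · have := mul_nonpos_of_nonneg_of_nonpos (hχ0 z.im) (g2 z.re)
      rcases h.lt_or_eq with h' | h'
      · exact ⟨fun _ => by linarith, fun _ => by linarith⟩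
      · rw [hχr _ h'.ge]; simp
    · rw [hχr _ h]; simp
  have hmove : WindowMove U (shear χ (graphFn c') '' U) K B (Ici 1) 0
      (fun s => Complex.exp (I * (((0 : ℝ → ℝ) s : ℝ) : ℂ))) (turned 0 0 0 0)
      (fun s => Complex.exp (I * turnAngle (1 / 8) 2 3 s)) c' := by
    refine windowMove_of_shear hc hc' hχ g1 hpos hb hU hB hK ?_ ?_ ?_ ?_ ?_ ?_ ?_ ?_ ?_
    · intro z
      simp only [hBdef, mem_ofPred_eq, shear_re, shear_im, him' z τ (by linarith)]
    · intro z
      simp only [hKdef, mem_ofPred_eq, shear_re, shear_im, him z _ le_rfl]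
    · intro z hz
      have : χ z.im * graphFn c' z.re = 0 := by
        simp only [hKdef, mem_ofPred_eq, not_and_or, not_le] at hz
        rcases hz with h | h
        · rw [g3 _ (by linarith), mul_zero]
        · rw [hχr _ h.le, zero_mul]
      simp [shear, this]
    · intro z hz
      rw [hUB z hz, hg0]
    · intro z hz
      rw [hg0, hχl 0 (by linarith)]
      ring
    · ext z
      constructor
      · rintro ⟨h1, h2⟩
        rw [frontier_iff_of_flat hB hUB ⟨by linarith [h1.1], by linarith [h1.2]⟩] at h2
        exact ⟨z.re, h1.1, by rw [turned_flat]; apply Complex.ext <;> simp [h2]⟩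
      · rintro ⟨s, hs, rfl⟩
        have hs : 1 ≤ s := hs
        rw [turned_flat]
        refine ⟨⟨by simpa using hs, by simp; linarith⟩, ?_⟩
        rw [frontier_iff_of_flat hB hUB ⟨by simp; linarith, by simpa using hτ⟩]
        simp
    · intro s hs
      have hs : 1 ≤ s := hs
      rw [turned_flat]
      exact ⟨by simp; linarith, by simpa using hτ⟩
    · intro s hs
      rw [turned_flat, g5 s (by simp at hs; linarith)]
    · intro s _
      refine ⟨s - 1, s + 1, 0, 0, ⟨by linarith, by linarith⟩, hullData_flat _ _,
        bending_flat (α := 0) antitone_const (by simp) _ _,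
        bending_flat (turnAngle_antitone (by norm_num) (by norm_num)) hα8 _ _⟩
  obtain ⟨hV, -⟩ := c1Domain_shear hχ g1 hb hpos hU
  refine ⟨_, hV, ⟨_, hmove.bdryLocalIsometry hU.1 hU.2.2 hV.1⟩, not_isometric_of_convex hconv ?_⟩
  intro hVc
  have hmem : ∀ x y : ℝ, 1 ≤ x → y < τ → (((x : ℂ) + y * I) ∈ shear χ (graphFn c') '' U ↔
      graphFn c' x < y) := by
    intro x y hx hy
    have := hmove.above' ((x : ℂ) + y * I) ⟨by simp; linarith, by simpa using hy⟩
    simpa using this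
  have h3 := g4 3 (by norm_num)
  set e := min (τ / 2) (-graphFn c' 3 / 2) with he
  have he1 : 0 < e := lt_min (by linarith) (by linarith)
  have he2 : e ≤ τ / 2 := min_le_left _ _
  have he3 : e ≤ -graphFn c' 3 / 2 := min_le_right _ _
  have p1 := (hmem 1 e le_rfl (by linarith)).2 (by rw [g3 1 (by norm_num)]; exact he1)
  have p2 := (hmem 3 (-e) (by norm_num) (by linarith)).2 (by linarith)
  have p3 := hVc p1 p2 (a := 1 / 2) (b := 1 / 2) (by norm_num) (by norm_num) (by norm_num)
  have p4 : ((1 / 2 : ℝ) • (((1 : ℝ) : ℂ) + (e : ℝ) * I) + (1 / 2 : ℝ) • (((3 : ℝ) : ℂ) + ((-e : ℝ) : ℂ) * I))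
      = ((2 : ℝ) : ℂ) + ((0 : ℝ) : ℂ) * I := by
    apply Complex.ext <;> simp <;> ring
  rw [p4, hmem 2 0 (by norm_num) hτ, g3 2 le_rfl] at p3
  exact lt_irrefl _ p3

end FlatRay

section Fan

open Complex (I)
open scoped ComplexConjugate

/-- Bend the straight line by the angle `α` and carry along the lines of direction `e + I`. -/
def fan (α : ℝ → ℝ) (e : ℝ) (z : ℂ) : ℂ :=
  turned 0 α 0 0 (z.re - e * z.im) + z.im * (Complex.exp (I * α (z.re - e * z.im)) * (e + I))

structure FanAngle (α : ℝ → ℝ) (e L τ : ℝ) : Prop where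
  smooth : ContDiff ℝ 1 α
  anti : Antitone α
  small : ∀ s, |α s| * (|e| + 1) ≤ 1 / 16
  lip : ∀ s t, s ≤ t → α s - α t ≤ L * (t - s)
  pos : 0 < τ
  le : τ * (e ^ 2 + 1) * L ≤ 1 / 4

theorem exp_conj_mul_im (a b x : ℝ) (v : ℂ) :
    (conj (Complex.exp (I * a) * (x + I)) * (Complex.exp (I * b) * v)).im =
      Real.cos (b - a) * (x * v.im - v.re) + Real.sin (b - a) * (x * v.re + v.im) := by
  have h1 : ∀ x : ℝ, Complex.exp (I * x) = Real.cos x + Real.sin x * I := fun x => by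
    rw [mul_comm, Complex.exp_mul_I, Complex.ofReal_cos, Complex.ofReal_sin]
  rw [h1, h1, Real.sin_sub, Real.cos_sub]
  simp only [map_mul, map_add, Complex.conj_ofReal, Complex.conj_I, Complex.mul_im,
    Complex.mul_re, Complex.add_re, Complex.add_im, Complex.ofReal_re, Complex.ofReal_im,
    Complex.neg_re, Complex.neg_im, Complex.I_re, Complex.I_im]
  ring

variable {α : ℝ → ℝ} {e L τ : ℝ}

namespace FanAngle

theorem abs_le (h : FanAngle α e L τ) (s : ℝ) : |α s| ≤ 1 / 16 := by
  nlinarith [h.small s, abs_nonneg (α s), abs_nonneg e]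

theorem bentCurve (h : FanAngle α e L τ) :
    BentCurve 0 (fun s => Complex.exp (I * α s)) (turned 0 α 0 0) :=
  bentCurve_turned (k := 0) continuous_const h.smooth.continuous (by simp)
    (fun s => (h.abs_le s).trans (by norm_num)) 0 0

theorem hasDerivAt_curve (h : FanAngle α e L τ) (s : ℝ) :
    HasDerivAt (turned 0 α 0 0) (Complex.exp (I * α s)) s := by
  have := h.bentCurve.hasDeriv s
  simpa using this

theorem abs_sub_le (h : FanAngle α e L τ) (s t : ℝ) : |α t - α s| * (|e| + 1) ≤ 1 / 8 := by
  have h1 := h.small s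
  have h2 := h.small t
  have h3 := abs_sub (α t) (α s)
  nlinarith [abs_nonneg e]

theorem curve_sep (h : FanAngle α e L τ) {s t : ℝ} (hst : s ≤ t) :
    (conj (Complex.exp (I * α s) * (e + I)) * (turned 0 α 0 0 t - turned 0 α 0 0 s)).im ≤
      -(1 / 2) * (t - s) := by
  set w := conj (Complex.exp (I * α s) * (e + I)) with hw
  have : Antitone fun u => (w * turned 0 α 0 0 u).im + 1 / 2 * u := by
    refine antitone_of_hasDerivAt_nonpos (f' := fun u => (w * Complex.exp (I * α u)).im + 1 / 2)
      (fun u => ?_) (fun u => ?_)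
    · have := (hasDerivAt_im ((h.hasDerivAt_curve u).const_mul w)).add
        ((hasDerivAt_id u).const_mul (1 / 2))
      rw [mul_one] at this
      exact this
    · have := exp_conj_mul_im (α s) (α u) e 1
      rw [mul_one] at this
      simp only [Pi.zero_apply]
      rw [hw, this]
      have h1 := h.abs_sub_le s u
      set Δ := α u - α s
      have h5 := Real.one_sub_sq_div_two_le_cos (x := Δ)
      have h6 : |Δ| ≤ 1 / 8 := by nlinarith [abs_nonneg Δ, abs_nonneg e]
      have h7 : Δ ^ 2 ≤ (1 / 8) ^ 2 := sq_le_sq' (by linarith [(_root_.abs_le.1 h6).1]) (_root_.abs_le.1 h6).2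
      have h8 : Real.sin Δ * e ≤ |Δ| * |e| := by
        refine (le_abs_self _).trans ?_
        rw [abs_mul]
        exact mul_le_mul_of_nonneg_right Real.abs_sin_le_abs (abs_nonneg _)
      simp only [Complex.one_re, Complex.one_im, mul_zero, zero_sub, mul_one, add_zero]
      nlinarith [abs_nonneg Δ]
  have := this hst
  simp only at this
  rw [mul_sub, Complex.sub_im]
  linarith

theorem fan_sep (h : FanAngle α e L τ) {z z' : ℂ} (hx : z.re - e * z.im ≤ z'.re - e * z'.im)
    (hτ : -τ ≤ z'.im) :
    (conj (Complex.exp (I * α (z.re - e * z.im)) * (e + I)) * (fan α e z' - fan α e z)).im ≤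
      -(1 / 4) * ((z'.re - e * z'.im) - (z.re - e * z.im)) := by
  have h1 := h.curve_sep hx
  unfold fan
  set x := z.re - e * z.im
  set x' := z'.re - e * z'.im
  set w := conj (Complex.exp (I * α x) * (e + I)) with hw
  have h2 : (w * (Complex.exp (I * α x') * (e + I))).im =
      Real.sin (α x' - α x) * (e ^ 2 + 1) := by
    rw [hw, exp_conj_mul_im]
    simp only [Complex.add_re, Complex.add_im, Complex.ofReal_re, Complex.ofReal_im, Complex.I_re,
      Complex.I_im]
    ring
  have h3 : (w * (Complex.exp (I * α x) * (e + I))).im = 0 := by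
    rw [hw, exp_conj_mul_im]
    simp
  have e1 : w * (turned 0 α 0 0 x' + z'.im * (Complex.exp (I * α x') * (e + I)) -
      (turned 0 α 0 0 x + z.im * (Complex.exp (I * α x) * (e + I)))) =
      w * (turned 0 α 0 0 x' - turned 0 α 0 0 x) +
        ((z'.im : ℂ) * (w * (Complex.exp (I * α x') * (e + I))) -
        (z.im : ℂ) * (w * (Complex.exp (I * α x) * (e + I)))) := by ring
  rw [e1, Complex.add_im, Complex.sub_im, Complex.im_ofReal_mul, Complex.im_ofReal_mul, h2, h3]
  have h4 := h.anti hx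
  have h5 := h.lip x x' hx
  have h6 := h.abs_sub_le x x'
  have h6' : |α x' - α x| ≤ 1 / 8 := by nlinarith [abs_nonneg (α x' - α x), abs_nonneg e]
  have h7 : Real.sin (α x' - α x) ≤ 0 := Real.sin_nonpos_of_nonpos_of_neg_pi_le (by linarith)
    (by linarith [Real.pi_gt_three, (_root_.abs_le.1 h6').1])
  have h8 : -(L * (x' - x)) ≤ Real.sin (α x' - α x) := by
    have h9 : |Real.sin (α x' - α x)| ≤ |α x' - α x| := Real.abs_sin_le_abs
    rw [abs_of_nonpos h7, abs_of_nonpos (by linarith)] at h9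
    linarith
  have h10 : z'.im * (Real.sin (α x' - α x) * (e ^ 2 + 1)) ≤
      -τ * (Real.sin (α x' - α x) * (e ^ 2 + 1)) :=
    mul_le_mul_of_nonpos_right hτ (mul_nonpos_of_nonpos_of_nonneg h7 (by positivity))
  have h11 : τ * (e ^ 2 + 1) * -(L * (x' - x)) ≤ τ * (e ^ 2 + 1) * Real.sin (α x' - α x) :=
    mul_le_mul_of_nonneg_left h8 (by have := h.pos; positivity)
  have h12 := mul_le_mul_of_nonneg_right h.le (by linarith : 0 ≤ x' - x)
  nlinarith

theorem abs_graphFn_sub_le (h : FanAngle α e L τ) (x y : ℝ) :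
    |graphFn (turned 0 α 0 0) x - graphFn (turned 0 α 0 0) y| * (8 * (|e| + 1)) ≤ |x - y| := by
  have key : ‖graphFn (turned 0 α 0 0) x - graphFn (turned 0 α 0 0) y‖ ≤
      1 / (8 * (|e| + 1)) * ‖x - y‖ := by
    refine Convex.norm_image_sub_le_of_norm_hasDerivWithin_le
      (fun u _ => (h.bentCurve.hasDerivAt_graphFn u).hasDerivWithinAt) (fun u _ => ?_) convex_univ
      (mem_univ y) (mem_univ x)
    set s := absInv (turned 0 α 0 0) u
    have e1 : Complex.exp (I * α s) * (1 + ((0 : ℝ → ℝ) s : ℂ) * I) =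
        Complex.exp (α s * I) := by
      rw [mul_comm I]; simp
    rw [e1, Complex.exp_ofReal_mul_I_re, Complex.exp_ofReal_mul_I_im, norm_div]
    have h1 := h.small s
    have h2 := h.abs_le s
    have h3 := Real.one_sub_sq_div_two_le_cos (x := α s)
    have h4 : α s ^ 2 ≤ (1 / 16) ^ 2 :=
      sq_le_sq' (by linarith [(_root_.abs_le.1 h2).1]) (_root_.abs_le.1 h2).2
    have h5 : |Real.sin (α s)| ≤ |α s| := Real.abs_sin_le_abs
    have h6 : (1:ℝ) / 2 ≤ |Real.cos (α s)| := by
      refine le_trans ?_ (le_abs_self _); linarith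
    have he : 0 < |e| + 1 := by positivity
    rw [Real.norm_eq_abs, Real.norm_eq_abs, div_le_div_iff₀ (by linarith) (by positivity)]
    nlinarith
  rw [Real.norm_eq_abs, Real.norm_eq_abs, div_mul_eq_mul_div, one_mul,
    le_div_iff₀ (by positivity)] at key
  exact key

theorem graphFn_fan (h : FanAngle α e L τ) (z : ℂ) :
    (0 ≤ z.im → graphFn (turned 0 α 0 0) (fan α e z).re + z.im / 4 ≤ (fan α e z).im) ∧
    (z.im ≤ 0 → (fan α e z).im ≤ graphFn (turned 0 α 0 0) (fan α e z).re) := by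
  unfold fan
  set x := z.re - e * z.im
  set p := turned 0 α 0 0 x
  have hg := h.bentCurve.graphFn_re x
  set v := Complex.exp (I * α x) * (e + I) with hv
  have h1 : ∀ x : ℝ, Complex.exp (I * x) = Real.cos x + Real.sin x * I := fun x => by
    rw [mul_comm, Complex.exp_mul_I, Complex.ofReal_cos, Complex.ofReal_sin]
  have hvr : v.re = Real.cos (α x) * e - Real.sin (α x) := by rw [hv, h1]; simp [Complex.sin_ofReal_re, Complex.cos_ofReal_re]
  have hvi : v.im = Real.cos (α x) + Real.sin (α x) * e := by rw [hv, h1]; simp [Complex.sin_ofReal_re, Complex.cos_ofReal_re]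
  have h2 := h.abs_le x
  have h2' := h.small x
  have h3 := Real.one_sub_sq_div_two_le_cos (x := α x)
  have h4 : α x ^ 2 ≤ (1 / 16) ^ 2 :=
    sq_le_sq' (by linarith [(_root_.abs_le.1 h2).1]) (_root_.abs_le.1 h2).2
  have h5 : |Real.sin (α x)| ≤ |α x| := Real.abs_sin_le_abs
  have h6 : |Real.sin (α x) * e| ≤ 1 / 16 := by
    rw [abs_mul]; nlinarith [abs_nonneg e, abs_nonneg (α x)]
  have h7 : 1 / 2 ≤ v.im := by rw [hvi]; linarith [(_root_.abs_le.1 h6).1]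
  have h8 : |v.re| ≤ |e| + 1 := by
    rw [hvr]
    refine (abs_sub _ _).trans ?_
    rw [abs_mul]
    have := Real.abs_cos_le_one (α x)
    nlinarith [abs_nonneg e]
  have h9 := h.abs_graphFn_sub_le (p + z.im * v).re p.re
  rw [hg, Complex.add_re, Complex.re_ofReal_mul, add_sub_cancel_left, abs_mul] at h9
  have he : 0 < |e| + 1 := by positivity
  have h10 : |graphFn (turned 0 α 0 0) (p.re + z.im * v.re) - p.im| ≤ |z.im| / 8 := by
    have : |z.im| * |v.re| ≤ |z.im| * (|e| + 1) := by gcongr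
    by_contra hcon
    push Not at hcon
    nlinarith
  have h11 := _root_.abs_le.1 h10
  rw [Complex.add_re, Complex.add_im, Complex.re_ofReal_mul, Complex.im_ofReal_mul]
  constructor
  · intro hz
    rw [abs_of_nonneg hz] at h11
    nlinarith
  · intro hz
    rw [abs_of_nonpos hz] at h11
    nlinarith

end FanAngle

end Fan

section Fan

open Complex (I)
open scoped ComplexConjugate

theorem norm_exp_sub_exp_le (a b : ℝ) :
    ‖Complex.exp (I * a) - Complex.exp (I * b)‖ ≤ |a - b| := by
  have : Complex.exp (I * a) - Complex.exp (I * b) =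
      Complex.exp (I * b) * (Complex.exp (I * (a - b : ℝ)) - 1) := by
    rw [mul_sub, ← Complex.exp_add, mul_one]
    congr 2
    push_cast
    ring
  rw [this, norm_mul, Complex.norm_exp_I_mul_ofReal, one_mul]
  exact Real.norm_exp_I_mul_ofReal_sub_one_le

/-- A map that does not contract too much around each point has injective derivatives. -/
theorem fderiv_injective_of_expanding {Φ : ℂ → ℂ} {L : ℂ →L[ℝ] ℂ} {z : ℂ} {M : ℝ}
    (hL : HasFDerivAt Φ L z) (hM : ∀ᶠ z' in 𝓝 z, ‖z' - z‖ ≤ M * ‖Φ z' - Φ z‖) (v : ℂ)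
    (hv : L v = 0) : v = 0 := by
  by_contra hne
  have hv0 : 0 < ‖v‖ := norm_pos_iff.2 hne
  have hM1 : (0:ℝ) < |M| + 1 := by positivity
  have h1 := hL.isLittleO.def (c := 1 / (2 * (|M| + 1))) (by positivity)
  have h2 : Tendsto (fun t : ℝ => z + t • v) (𝓝[≠] 0) (𝓝 z) := by
    have : Continuous fun t : ℝ => z + t • v := by fun_prop
    have := this.tendsto 0
    simp only [zero_smul, add_zero] at this
    exact this.mono_left nhdsWithin_le_nhds
  obtain ⟨t, ⟨h3, h4⟩, ht⟩ := ((h2.eventually (h1.and hM)).and self_mem_nhdsWithin).exists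
  have ht : t ≠ 0 := ht
  simp only [add_sub_cancel_left, map_smul, hv, smul_zero, sub_zero] at h3 h4
  set D := ‖Φ (z + t • v) - Φ z‖
  have h5 : 0 < ‖t • v‖ := norm_pos_iff.2 (smul_ne_zero ht hne)
  have h6 : M * D ≤ (|M| + 1) * D := by
    have : 0 ≤ D := norm_nonneg _
    nlinarith [le_abs_self M]
  have h7 : (|M| + 1) * D ≤ (|M| + 1) * (1 / (2 * (|M| + 1)) * ‖t • v‖) := by gcongr
  have h8 : (|M| + 1) * (1 / (2 * (|M| + 1)) * ‖t • v‖) = ‖t • v‖ / 2 := by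
    field_simp
  linarith

theorem isClosed_image_of_expanding {Φ : ℂ → ℂ} {F : Set ℂ} (hF : IsClosed F)
    (hΦ : ContinuousOn Φ F)
    (hM : ∀ z ∈ F, ∃ M, ∀ z' ∈ F, ‖z' - z‖ ≤ M * ‖Φ z' - Φ z‖) : IsClosed (Φ '' F) := by
  rcases F.eq_empty_or_nonempty with rfl | ⟨z₀, hz₀⟩
  · simp
  obtain ⟨M, hM⟩ := hM z₀ hz₀
  refine isClosed_of_closure_subset fun w hw => ?_
  have hK : IsCompact (F ∩ closedBall z₀ (|M| * (‖w - Φ z₀‖ + 1))) :=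
    (isCompact_closedBall _ _).inter_left hF
  have hKc := (hK.image_of_continuousOn (hΦ.mono inter_subset_left)).isClosed
  have h1 : w ∈ closure (ball w 1 ∩ Φ '' F) :=
    isOpen_ball.inter_closure ⟨mem_ball_self one_pos, hw⟩
  have h2 : ball w 1 ∩ Φ '' F ⊆ Φ '' (F ∩ closedBall z₀ (|M| * (‖w - Φ z₀‖ + 1))) := by
    rintro _ ⟨h3, z, hz, rfl⟩
    refine ⟨z, ⟨hz, ?_⟩, rfl⟩
    rw [mem_closedBall, dist_eq_norm]
    rw [mem_ball, dist_eq_norm] at h3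
    have h4 : ‖Φ z - Φ z₀‖ ≤ ‖w - Φ z₀‖ + 1 := by
      have := norm_add_le (Φ z - w) (w - Φ z₀)
      rw [sub_add_sub_cancel] at this
      linarith
    calc ‖z - z₀‖ ≤ M * ‖Φ z - Φ z₀‖ := hM z hz
      _ ≤ |M| * ‖Φ z - Φ z₀‖ := by gcongr; exact le_abs_self M
      _ ≤ _ := by gcongr
  have h3 := closure_minimal h2 hKc h1
  exact image_mono inter_subset_left h3

variable {α : ℝ → ℝ} {e L τ : ℝ}

theorem fan_eq (α : ℝ → ℝ) (e : ℝ) (z : ℂ) : fan α e z = turned 0 α 0 0 (z.re - e * z.im) +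
    z.im * (Complex.exp (I * α (z.re - e * z.im)) * (e + I)) := rfl

namespace FanAngle

theorem contDiff_fan (h : FanAngle α e L τ) : ContDiff ℝ 1 (fan α e) := by
  have h0 := h.smooth
  have h1 : ContDiff ℝ 1 (turned 0 α 0 0) := by
    rw [contDiff_one_iff_deriv]
    refine ⟨fun s => (h.hasDerivAt_curve s).differentiableAt, ?_⟩
    have : deriv (turned 0 α 0 0) = fun s : ℝ => Complex.exp (I * α s) :=
      funext fun s => (h.hasDerivAt_curve s).deriv
    rw [this]
    have := h0.continuous
    fun_prop
  have hre : ContDiff ℝ 1 fun z : ℂ => z.re := Complex.reCLM.contDiff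
  have him : ContDiff ℝ 1 fun z : ℂ => z.im := Complex.imCLM.contDiff
  have hof : ContDiff ℝ 1 fun t : ℝ => (t : ℂ) := Complex.ofRealCLM.contDiff
  have hx : ContDiff ℝ 1 fun z : ℂ => z.re - e * z.im := hre.sub (contDiff_const.mul him)
  have hE : ContDiff ℝ 1 fun z : ℂ => Complex.exp (I * α (z.re - e * z.im)) :=
    (contDiff_const.mul (hof.comp (h0.comp hx))).cexp
  exact (h1.comp hx).add ((hof.comp him).mul (hE.mul contDiff_const))

theorem expanding (h : FanAngle α e L τ) {z : ℂ} (hz : -τ ≤ z.im) :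
    ∃ M, ∀ z' : ℂ, -τ ≤ z'.im → ‖z' - z‖ ≤ M * ‖fan α e z' - fan α e z‖ := by
  set n := ‖(e : ℂ) + I‖ with hn
  have hL : 0 ≤ L := by
    have := h.lip 0 1 zero_le_one
    have := h.anti (zero_le_one (α := ℝ))
    linarith
  have hn1 : 1 ≤ n := by
    have := Complex.abs_im_le_norm ((e : ℂ) + I)
    simpa using this
  refine ⟨1 + 8 * n + 4 * n ^ 2 * L * |z.im|, fun z' hz' => ?_⟩
  set D := ‖fan α e z' - fan α e z‖ with hD
  have hD0 : 0 ≤ D := norm_nonneg _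
  have hx : |(z'.re - e * z'.im) - (z.re - e * z.im)| ≤ 4 * n * D := by
    have key : ∀ a b : ℂ, -τ ≤ b.im → a.re - e * a.im ≤ b.re - e * b.im →
        (b.re - e * b.im) - (a.re - e * a.im) ≤ 4 * n * ‖fan α e b - fan α e a‖ := by
      intro a b hb hab
      have h1 := h.fan_sep hab hb
      have h2 := Complex.abs_im_le_norm
        (conj (Complex.exp (I * α (a.re - e * a.im)) * (e + I)) * (fan α e b - fan α e a))
      rw [norm_mul, Complex.norm_conj, norm_mul, Complex.norm_exp_I_mul_ofReal, one_mul] at h2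
      have h3 := (_root_.abs_le.1 h2).1
      linarith
    rcases le_total (z.re - e * z.im) (z'.re - e * z'.im) with hle | hle
    · rw [abs_of_nonneg (by linarith)]
      exact key z z' hz' hle
    · rw [abs_sub_comm, abs_of_nonneg (by linarith), hD, norm_sub_rev]
      exact key z' z hz hle
  rw [fan_eq, fan_eq] at hD
  have hzz : z' - z = (((z'.re - e * z'.im) - (z.re - e * z.im) : ℝ) : ℂ) +
      ((z'.im - z.im : ℝ) : ℂ) * (e + I) := by
    apply Complex.ext <;> simp <;> ring
  set x := z.re - e * z.im
  set x' := z'.re - e * z'.im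
  have hC : ‖turned 0 α 0 0 x' - turned 0 α 0 0 x‖ ≤ |x' - x| := by
    have := Convex.norm_image_sub_le_of_norm_hasDerivWithin_le (C := 1)
      (fun u _ => (h.hasDerivAt_curve u).hasDerivWithinAt)
      (fun u _ => (Complex.norm_exp_I_mul_ofReal _).le) convex_univ (mem_univ x) (mem_univ x')
    simpa using this
  have hE : ‖Complex.exp (I * α x') - Complex.exp (I * α x)‖ ≤ L * |x' - x| := by
    refine (norm_exp_sub_exp_le _ _).trans ?_
    rcases le_total x x' with hle | hle
    · rw [abs_sub_comm, abs_of_nonneg (by linarith [h.anti hle]), abs_of_nonneg (by linarith)]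
      exact h.lip x x' hle
    · rw [abs_of_nonneg (by linarith [h.anti hle]), abs_sub_comm, abs_of_nonneg (by linarith)]
      exact h.lip x' x hle
  have hsplit : ((z'.im - z.im : ℝ) : ℂ) * (Complex.exp (I * α x') * (e + I)) =
      (turned 0 α 0 0 x' + z'.im * (Complex.exp (I * α x') * (e + I)) -
        (turned 0 α 0 0 x + z.im * (Complex.exp (I * α x) * (e + I)))) -
      (turned 0 α 0 0 x' - turned 0 α 0 0 x) -
      z.im * ((Complex.exp (I * α x') - Complex.exp (I * α x)) * (e + I)) := by
    push_cast; ring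
  have hnorm := congrArg norm hsplit
  rw [norm_mul, norm_mul, Complex.norm_exp_I_mul_ofReal, one_mul, Complex.norm_real,
    Real.norm_eq_abs] at hnorm
  have hb : |z'.im - z.im| * n ≤ D + 4 * n * D + |z.im| * (L * (4 * n * D) * n) := by
    rw [hnorm]
    refine (norm_sub_le _ _).trans (add_le_add ((norm_sub_le _ _).trans
      (add_le_add hD.ge (hC.trans hx))) ?_)
    rw [norm_mul, norm_mul, Complex.norm_real, Real.norm_eq_abs]
    gcongr
    exact hE.trans (mul_le_mul_of_nonneg_left hx hL)
  rw [hzz]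
  refine (norm_add_le _ _).trans ?_
  rw [norm_mul, Complex.norm_real, Complex.norm_real, Real.norm_eq_abs, Real.norm_eq_abs]
  calc |x' - x| + |z'.im - z.im| * n
      ≤ 4 * n * D + (D + 4 * n * D + |z.im| * (L * (4 * n * D) * n)) := add_le_add hx hb
    _ = (1 + 8 * n + 4 * n ^ 2 * L * |z.im|) * D := by ring

theorem diffeoOn_fan (h : FanAngle α e L τ) : DiffeoOn (fan α e) {z | -τ < z.im} where
  isOpen := isOpen_lt continuous_const Complex.continuous_im
  contDiffOn := h.contDiff_fan.contDiffOn
  injOn z hz z' hz' heq := by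
    have hz : -τ < z.im := hz
    have hz' : -τ < z'.im := hz'
    obtain ⟨M, hM⟩ := h.expanding hz.le
    have := hM z' hz'.le
    rw [heq, sub_self, norm_zero, mul_zero] at this
    exact (sub_eq_zero.1 (norm_le_zero_iff.1 this)).symm
  deriv z hz := by
    have hz' : -τ < z.im := hz
    obtain ⟨M, hM⟩ := h.expanding hz'.le
    have hd := (h.contDiff_fan.differentiable one_ne_zero z).hasFDerivAt
    obtain ⟨E, hE⟩ := exists_equiv_of_injective (fderiv ℝ (fan α e) z) fun v hv =>
      fderiv_injective_of_expanding hd (M := M) (by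
        filter_upwards [(isOpen_lt continuous_const Complex.continuous_im).mem_nhds hz] with w hw
        exact hM w (le_of_lt hw)) v hv
    exact ⟨E, by rw [hE]; exact hd⟩

end FanAngle

end Fan

section FanDomain

open Complex (I)
open scoped ComplexConjugate

theorem exists_lipschitz_turnAngle {β a b : ℝ} (hab : a < b) :
    ∃ L : ℝ, ∀ s t, s ≤ t → turnAngle β a b s - turnAngle β a b t ≤ L * (t - s) := by
  obtain ⟨K, hK⟩ := ((contDiff_turnAngle β a b).contDiffOn (s := Icc a b)).exists_lipschitzOnWith
    one_ne_zero (convex_Icc a b) isCompact_Icc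
  have hcl : ∀ s, turnAngle β a b (max a (min b s)) = turnAngle β a b s := fun s => by
    rcases le_total s a with h | h
    · rw [min_eq_right (h.trans hab.le), max_eq_left h, turnAngle_of_le hab le_rfl,
        turnAngle_of_le hab h]
    · rcases le_total s b with h' | h'
      · rw [min_eq_right h', max_eq_right h]
      · rw [min_eq_left h', max_eq_right hab.le, turnAngle_of_ge hab le_rfl, turnAngle_of_ge hab h']
  have hmem : ∀ s, max a (min b s) ∈ Icc a b := fun s =>
    ⟨le_max_left _ _, max_le hab.le (min_le_left _ _)⟩
  refine ⟨K, fun s t hst => ?_⟩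
  have h1 := hK.dist_le_mul _ (hmem s) _ (hmem t)
  rw [hcl, hcl, Real.dist_eq, Real.dist_eq, abs_sub_comm (max _ _)] at h1
  have h2 : |max a (min b t) - max a (min b s)| ≤ t - s := by
    have e1 := abs_max_sub_max_le_max a (min b t) a (min b s)
    have e2 := abs_min_sub_min_le_max b t b s
    rw [sub_self, abs_zero, max_eq_right (abs_nonneg (min b t - min b s))] at e1
    rw [sub_self, abs_zero, max_eq_right (abs_nonneg (t - s)), abs_of_nonneg (by linarith : 0 ≤ t - s)] at e2
    exact e1.trans e2
  exact (le_abs_self _).trans (h1.trans (mul_le_mul_of_nonneg_left h2 K.2))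

theorem exists_fanAngle (e : ℝ) {a b : ℝ} (hab : a < b) :
    ∃ β > 0, β ≤ 1 / 8 ∧ ∃ L τ, FanAngle (turnAngle β a b) e L τ := by
  have he : 0 < |e| + 1 := by positivity
  set β := 1 / (16 * (|e| + 1)) with hβ
  have hβ0 : 0 < β := by positivity
  have hβ1 : β * (|e| + 1) = 1 / 16 := by rw [hβ]; field_simp
  obtain ⟨L, hL⟩ := exists_lipschitz_turnAngle hab
  refine ⟨β, hβ0, by nlinarith [abs_nonneg e], |L|, 1 / (4 * (e ^ 2 + 1) * (|L| + 1)),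
    contDiff_turnAngle _ _ _, turnAngle_antitone hβ0.le hab, fun s => ?_, fun s t hst => ?_,
    by positivity, ?_⟩
  · rw [← hβ1]
    exact mul_le_mul_of_nonneg_right (abs_turnAngle_le hβ0.le s) he.le
  · exact (hL s t hst).trans (mul_le_mul_of_nonneg_right (le_abs_self L) (by linarith))
  · have : 1 / (4 * (e ^ 2 + 1) * (|L| + 1)) * (e ^ 2 + 1) * |L| = 1 / 4 * (|L| / (|L| + 1)) := by
      field_simp
    rw [this]
    have : |L| / (|L| + 1) ≤ 1 := by
      rw [div_le_one (by positivity)]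
      linarith
    linarith

theorem isometry_rigid {E : ℂ} (hE : ‖E‖ = 1) (p b : ℂ) : Isometry fun z : ℂ => p + E * (z - b) :=
  Isometry.of_dist_eq fun z w => by
    rw [dist_eq_norm, dist_eq_norm, add_sub_add_left_eq_sub, ← mul_sub, norm_mul, hE, one_mul,
      sub_sub_sub_cancel_right]

/-- Near an open set where a diffeomorphism is rigid, it preserves relative metrics. -/
theorem DiffeoOn.relContracts_of_rigid {Φ : ℂ → ℂ} {O U N : Set ℂ} (h : DiffeoOn Φ O)
    (hU : IsOpen U) (hUO : closure U ⊆ O) (hcl : IsClosed (Φ '' closure U)) {E p b y : ℂ}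
    (hE : ‖E‖ = 1) (hN : IsOpen N) (hΦ : ∀ z ∈ N, Φ z = p + E * (z - b)) (hy : y ∈ frontier U)
    (hyN : y ∈ N) : RelContracts U (Φ '' U) Φ y ∧
      RelContracts (Φ '' U) U (Function.invFunOn Φ O) (Φ y) := by
  have hfO : frontier U ⊆ O := fun z hz => hUO (frontier_subset_closure hz)
  have hUO' : U ⊆ O := subset_closure.trans hUO
  have hV : IsOpen (Φ '' U) := h.isOpen_image hU hUO'
  have hfr := h.frontier_image hU hUO hcl
  have hEE : conj E * E = 1 := by rw [Complex.conj_mul', hE]; simp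
  constructor
  · obtain ⟨R, hR, hRN⟩ := Metric.isOpen_iff.1 hN y hyN
    refine relContracts_of_isometry hV (isometry_rigid hE p b) hR (fun z hz => ?_) fun z hz => ?_
    · rw [← hΦ z (hRN hz.2)]
      exact mem_image_of_mem _ hz.1
    · exact hΦ z (hRN hz.2)
  · have hcont : ContinuousAt (Function.invFunOn Φ O) (Φ y) :=
      h.contDiffOn_inv.continuousOn.continuousAt
        ((h.isOpen_image h.isOpen Subset.rfl).mem_nhds (mem_image_of_mem _ (hfO hy)))
    have hev : ∀ᶠ z in 𝓝 (Φ y), Function.invFunOn Φ O z ∈ N :=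
      hcont.eventually (by rw [h.leftInv (hfO hy)]; exact hN.mem_nhds hyN)
    obtain ⟨R, hR, hRN⟩ := Metric.eventually_nhds_iff_ball.1 hev
    have hinv : ∀ z ∈ N, b + conj E * (Φ z - p) = z := fun z hz => by
      rw [hΦ z hz, add_sub_cancel_left, ← mul_assoc, hEE]
      ring
    refine relContracts_of_isometry hU (isometry_rigid (by rw [Complex.norm_conj, hE]) b p) hR
      ?_ ?_
    · rintro _ ⟨⟨w, hw, rfl⟩, hwR⟩
      have := hRN _ hwR
      rw [h.leftInv (hUO' hw)] at this
      rw [hinv w this]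
      exact hw
    · rintro z ⟨hz, hwR⟩
      rw [hfr] at hz
      obtain ⟨w, hw, rfl⟩ := hz
      have := hRN _ hwR
      rw [h.leftInv (hfO hw)] at this
      rw [h.leftInv (hfO hw), hinv w this]

theorem turned_add (α : ℝ → ℝ) (hα : Continuous α) {b x : ℝ} {γ : ℝ} (hbx : b ≤ x)
    (h : ∀ t, b ≤ t → α t = γ) :
    turned 0 α 0 0 x = turned 0 α 0 0 b + Complex.exp (I * γ) * (x - b) := by
  have hc : Continuous fun t : ℝ => Complex.exp (I * α t) * (1 + ((0 : ℝ → ℝ) t : ℂ) * I) := by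
    simp only [Pi.zero_apply]
    fun_prop
  have h1 := intervalIntegral.integral_add_adjacent_intervals (hc.intervalIntegrable 0 b)
    (hc.intervalIntegrable b x) (μ := MeasureTheory.volume)
  have h2 : ∫ t in b..x, Complex.exp (I * α t) * (1 + ((0 : ℝ → ℝ) t : ℂ) * I) =
      ∫ t in b..x, Complex.exp (I * γ) :=
    intervalIntegral.integral_congr fun t ht => by
      rw [uIcc_of_le hbx] at ht
      simp [h t ht.1]
  unfold turned
  rw [← h1, h2, intervalIntegral.integral_const]
  simp only [Complex.real_smul]
  push_cast
  ring

end FanDomain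

section FanDomain

open Complex (I)
open scoped ComplexConjugate

theorem notDetermined_of_flat_segment {U : Set ℂ} (hU : C1Domain U) (hconv : Convex ℝ U)
    (hup : ∀ z ∈ U, 0 < z.im) {ℓ e : ℝ} (hℓ : 0 < ℓ)
    (hd : ∀ x t : ℝ, 0 < x → x < ℓ → 0 < t → (x : ℂ) + t * (e + I) ∈ U) : NotDetermined U := by
  have hab : ℓ / 3 < 2 * ℓ / 3 := by linarith
  obtain ⟨β, hβ, hβ8, L, τ, hα⟩ := exists_fanAngle e hab
  set α := turnAngle β (ℓ / 3) (2 * ℓ / 3) with hαdef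
  have hα8 : ∀ s, |α s| ≤ 1 / 8 := fun s => (abs_turnAngle_le hβ.le s).trans hβ8
  have hαl : ∀ s ≤ ℓ / 3, α s = 0 := fun s hs => turnAngle_of_le hab hs
  have hαr : ∀ s, 2 * ℓ / 3 ≤ s → α s = -β := fun s hs => turnAngle_of_ge hab hs
  obtain ⟨g1, g2, g3, g4, g5, g6⟩ := graphFn_turnAngle hβ hβ8 (by linarith) hab
  rw [← hαdef] at g1 g2 g3 g4 g5 g6
  have hD := hα.diffeoOn_fan
  set Φ := fan α e with hΦdef
  set O : Set ℂ := {z | -τ < z.im} with hO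
  have hcl0 : closure U ⊆ {z : ℂ | 0 ≤ z.im} :=
    closure_minimal (fun z hz => (hup z hz).le) (isClosed_le continuous_const Complex.continuous_im)
  have hUO : closure U ⊆ O := fun z hz => by
    have h1 : 0 ≤ z.im := hcl0 hz
    have := hα.pos
    show -τ < z.im
    linarith
  have hcl : IsClosed (Φ '' closure U) := by
    refine isClosed_image_of_expanding isClosed_closure hα.contDiff_fan.continuous.continuousOn
      fun z hz => ?_
    obtain ⟨M, hM⟩ := hα.expanding (le_of_lt (hUO hz))
    exact ⟨M, fun z' hz' => hM z' (le_of_lt (hUO hz'))⟩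
  have hV := hD.c1Domain_image hU hUO hcl
  have hfr := hD.frontier_image hU.1 hUO hcl
  have hclV := hD.closure_image hUO hcl
  set V := Φ '' U with hVdef
  have hfO : frontier U ⊆ O := fun z hz => hUO (frontier_subset_closure hz)
  have hUO' : U ⊆ O := subset_closure.trans hUO
  have hcoord : ∀ z : ℂ, z = ((z.re - e * z.im : ℝ) : ℂ) + z.im * (e + I) := fun z => by
    apply Complex.ext
    · simp; ring
    · simp
  have hξ : Continuous fun z : ℂ => z.re - e * z.im :=
    Complex.continuous_re.sub (continuous_const.mul Complex.continuous_im)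
  set S : Set ℂ := {z | 0 < z.re - e * z.im ∧ z.re - e * z.im < ℓ} with hS
  have hSo : IsOpen S := (isOpen_lt continuous_const hξ).inter (isOpen_lt hξ continuous_const)
  have hmem : ∀ z ∈ S, z ∈ U ↔ 0 < z.im := fun z hz =>
    ⟨hup z, fun h => by rw [hcoord z]; exact hd _ _ hz.1 hz.2 h⟩
  have hmemf : ∀ z ∈ S, z ∈ frontier U ↔ z.im = 0 := fun z hz => frontier_iff_of_flat hSo hmem hz
  have hflat : ∀ s : ℝ, Φ s = turned 0 α 0 0 s := fun s => by simp [hΦdef, fan_eq]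
  have hbc := bentCurve_turned (k := 0) (α := 0) continuous_const continuous_const (by simp)
    (by simp) 0 0
  have hg0 : ∀ x, graphFn (turned 0 0 0 0) x = 0 := fun x => by
    have := hbc.graphFn_re x
    simpa [turned_flat] using this
  have hreal : ∀ z ∈ S, z.im = 0 → z = (z.re : ℂ) := fun z _ hz => by
    apply Complex.ext <;> simp [hz]
  have hboth : ∀ y ∈ frontier U, RelContracts U V Φ y ∧
      RelContracts V U (Function.invFunOn Φ O) (Φ y) := by
    intro y hy
    rcases lt_or_ge (y.re - e * y.im) (ℓ / 3) with hy1 | hy1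
    · refine hD.relContracts_of_rigid hU.1 hUO hcl (E := 1) (p := 0) (b := 0) (by simp)
        (isOpen_lt hξ continuous_const) (fun z hz => ?_) hy hy1
      have hz : z.re - e * z.im < ℓ / 3 := hz
      rw [hΦdef, fan_eq, g5 _ hz.le, hαl _ hz.le]
      conv_rhs => rw [hcoord z]
      simp
    rcases lt_or_ge (2 * ℓ / 3) (y.re - e * y.im) with hy2 | hy2
    · refine hD.relContracts_of_rigid hU.1 hUO hcl (E := Complex.exp (I * (-β : ℝ)))
        (p := turned 0 α 0 0 (2 * ℓ / 3)) (b := ((2 * ℓ / 3 : ℝ) : ℂ))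
        (Complex.norm_exp_I_mul_ofReal _)
        (isOpen_lt continuous_const hξ) (fun z hz => ?_) hy hy2
      have hz : 2 * ℓ / 3 < z.re - e * z.im := hz
      rw [hΦdef, fan_eq, turned_add α hα.smooth.continuous hz.le
        (fun t ht => hαr t ht), hαr _ hz.le]
      conv_rhs => rw [hcoord z]
      ring
    have hyS : y ∈ S := ⟨by linarith, by linarith⟩
    have hyim := (hmemf y hyS).1 hy
    obtain ⟨s₀, rfl⟩ : ∃ s : ℝ, y = s := ⟨_, hreal y hyS hyim⟩
    have hwin : s₀ ∈ Ioo (s₀ - 1) (s₀ + 1) := ⟨by linarith, by linarith⟩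
    have hB := bending_flat (turnAngle_antitone hβ.le hab) hα8 (s₀ - 1) (s₀ + 1)
    have hB0 := bending_flat (α := 0) antitone_const (by simp) (s₀ - 1) (s₀ + 1)
    have hyO := hfO hy
    have hcont : ContinuousAt (Function.invFunOn Φ O) (Φ s₀) :=
      hD.contDiffOn_inv.continuousOn.continuousAt
        ((hD.isOpen_image hD.isOpen Subset.rfl).mem_nhds (mem_image_of_mem _ hyO))
    have hev : ∀ᶠ z in 𝓝 (Φ s₀), z ∈ Φ '' O ∧ Function.invFunOn Φ O z ∈ S :=
      Filter.Eventually.and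
        ((hD.isOpen_image hD.isOpen Subset.rfl).mem_nhds (mem_image_of_mem _ hyO))
        (hcont.preimage_mem_nhds (by rw [hD.leftInv hyO]; exact hSo.mem_nhds hyS))
    obtain ⟨R', hR', hRS'⟩ := Metric.eventually_nhds_iff_ball.1 hev
    obtain ⟨R, hR, hRS⟩ := Metric.isOpen_iff.1 hSo _ hyS
    constructor
    · have := relContracts_of_bending hbc hα.bentCurve (hullData_flat _ _) hB0 hB hwin
        (U := U) (V := V) hV.1 (f := Φ) (R := min R R') (lt_min hR hR')
      rw [turned_flat, ← hflat] at this
      apply this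
      · rintro z ⟨hz, -⟩
        rw [hg0]
        exact (hup z hz).le
      · intro z hz hzg
        obtain ⟨⟨w, hw, rfl⟩, hwS⟩ := hRS' z (ball_subset_ball (min_le_right _ _) hz)
        rw [hD.leftInv hw] at hwS
        refine mem_image_of_mem _ ((hmem w hwS).2 ?_)
        by_contra hcon
        exact absurd ((hα.graphFn_fan w).2 (le_of_not_gt hcon)) (not_le.2 hzg)
      · rintro z ⟨hz, hzR⟩
        have hzS := hRS (ball_subset_ball (min_le_left _ _) hzR)
        have := hreal z hzS ((hmemf z hzS).1 hz)
        exact ⟨z.re, by rw [turned_flat]; exact this, by rw [← hflat, ← this]⟩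
    · have := relContracts_of_bending hα.bentCurve hbc (hullData_flat _ _) hB hB0 hwin
        (U := V) (V := U) hU.1 (f := Function.invFunOn Φ O) (R := min R R') (lt_min hR hR')
      rw [turned_flat, ← hflat] at this
      apply this
      · rintro _ ⟨⟨w, hw, rfl⟩, -⟩
        have h1 := hup w hw
        linarith [(hα.graphFn_fan w).1 h1.le]
      · intro z hz hzg
        rw [hg0] at hzg
        exact (hmem z (hRS (ball_subset_ball (min_le_left _ _) hz))).2 hzg
      · rintro z ⟨hz, hzR⟩
        rw [hfr] at hz
        obtain ⟨w, hw, rfl⟩ := hz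
        have hwS := (hRS' _ (ball_subset_ball (min_le_right _ _) hzR)).2
        rw [hD.leftInv (hfO hw)] at hwS ⊢
        have := hreal w hwS ((hmemf w hwS).1 hw)
        exact ⟨w.re, by rw [← hflat, ← this], by rw [turned_flat]; exact this⟩
  have hbij : BijOn Φ (frontier U) (frontier V) := by
    rw [hfr]
    exact (hD.injOn.mono hfO).bijOn_image
  refine ⟨V, hV, ⟨Φ, bdryLocalIsometry_of_relContracts hU.1 hU.2.2 hbij
    (fun a ha => hD.leftInv (hfO ha)) hα.contDiff_fan.continuous.continuousOn
    (fun y hy => (hboth y hy).1) (fun y hy => (hboth y hy).2)⟩, not_isometric_of_convex hconv ?_⟩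
  intro hVc
  have hfl : ∀ s : ℝ, 0 < s → s < ℓ → turned 0 α 0 0 s ∈ closure V := fun s h0 h1 => by
    rw [hclV, ← hflat]
    refine mem_image_of_mem _ (frontier_subset_closure ((hmemf _ ⟨?_, ?_⟩).2 ?_)) <;> simp [h0, h1]
  have hge : ∀ z ∈ closure V, graphFn (turned 0 α 0 0) z.re ≤ z.im := fun z hz => by
    rw [hclV] at hz
    obtain ⟨w, hw, rfl⟩ := hz
    have h1 : 0 ≤ w.im := hcl0 hw
    linarith [(hα.graphFn_fan w).1 h1]
  set q := turned 0 α 0 0 (ℓ / 2) with hq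
  have hq1 : ℓ / 3 < q.re := g6 _ (by linarith)
  have hq2 : q.im < 0 := by
    have := g4 _ hq1
    rwa [hα.bentCurve.graphFn_re] at this
  have hq3 : q.re < 2 * ℓ / 3 := by
    have hle : ‖q - turned 0 α 0 0 (ℓ / 3)‖ ≤ 1 * ‖ℓ / 2 - ℓ / 3‖ :=
      Convex.norm_image_sub_le_of_norm_hasDerivWithin_le
        (fun u _ => (hα.hasDerivAt_curve u).hasDerivWithinAt)
        (fun u _ => (Complex.norm_exp_I_mul_ofReal _).le) convex_univ (mem_univ _) (mem_univ _)
    rw [g5 _ le_rfl, one_mul, Real.norm_eq_abs, abs_of_nonneg (by linarith)] at hle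
    have := (Complex.abs_re_le_norm _).trans hle
    have := (abs_le.1 this).2
    simp at this
    linarith
  have p1 := hfl (2 * ℓ / 3 - q.re) (by linarith) (by linarith)
  rw [g5 _ (by linarith)] at p1
  have p2 := hfl (ℓ / 2) (by linarith) (by linarith)
  have p3 := hge _ (hVc.closure p1 p2 (a := 1 / 2) (b := 1 / 2) (by norm_num) (by norm_num)
    (by norm_num))
  rw [← hq] at p3
  have e1 : ((1 / 2 : ℝ) • ((2 * ℓ / 3 - q.re : ℝ) : ℂ) + (1 / 2 : ℝ) • q).re = ℓ / 3 := by
    simp; ring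
  have e2 : ((1 / 2 : ℝ) • ((2 * ℓ / 3 - q.re : ℝ) : ℂ) + (1 / 2 : ℝ) • q).im = q.im / 2 := by
    simp; ring
  rw [e1, e2, g3 _ le_rfl] at p3
  linarith

end FanDomain

section ConcaveHull

/-- The line of slope `k` through `(x, y)` lies above `g` on `[l, r]` and touches it on both sides
of `x`. -/
structure HullLine (g : ℝ → ℝ) (l r x k y : ℝ) : Prop where
  slope_le : |k| ≤ 1 / 2
  le : ∀ w ∈ Icc l r, g w ≤ y + k * (w - x)
  left : ∃ u ∈ Icc l x, g u = y + k * (u - x)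
  right : ∃ v ∈ Icc x r, g v = y + k * (v - x)

theorem exists_hullLine {g : ℝ → ℝ} {l r x : ℝ} (hg : Continuous g)
    (hg2 : ∀ s u, |g s - g u| ≤ 1 / 2 * |s - u|) (hx : x ∈ Icc l r) :
    ∃ k y, HullLine g l r x k y := by
  have hcl : ∀ a b, IsClosed {k ∈ Icc (-(1 / 2) : ℝ) (1 / 2) | ∃ u ∈ Icc a b, ∀ w ∈ Icc l r,
      g w - k * w ≤ g u - k * u} := by
    intro a b
    have hP : IsClosed {p : ℝ × ℝ | ∀ w ∈ Icc l r, g w - p.1 * w ≤ g p.2 - p.1 * p.2} := by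
      have : {p : ℝ × ℝ | ∀ w ∈ Icc l r, g w - p.1 * w ≤ g p.2 - p.1 * p.2} =
          ⋂ w ∈ Icc l r, {p : ℝ × ℝ | g w - p.1 * w ≤ g p.2 - p.1 * p.2} := by
        ext p
        simp
      rw [this]
      exact isClosed_biInter fun w _ => isClosed_le (by fun_prop) (by fun_prop)
    have hK := ((isCompact_Icc (a := (-(1 / 2) : ℝ)) (b := 1 / 2)).prod
      (isCompact_Icc (a := a) (b := b))).inter_right hP
    convert (hK.image continuous_fst).isClosed using 1
    ext k
    constructor
    · rintro ⟨hk, u, hu, h⟩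
      exact ⟨(k, u), ⟨⟨hk, hu⟩, h⟩, rfl⟩
    · rintro ⟨⟨k, u⟩, ⟨⟨hk, hu⟩, h⟩, rfl⟩
      exact ⟨hk, u, hu, h⟩
  have hlr : l ≤ r := hx.1.trans hx.2
  obtain ⟨k, hk, ⟨-, u, hu, hmu⟩, ⟨-, v, hv, hmv⟩⟩ :=
    isPreconnected_closed_iff.1 (isPreconnected_Icc (a := (-(1 / 2) : ℝ)) (b := 1 / 2))
      _ _ (hcl l x) (hcl x r) (by
        intro k hk
        obtain ⟨u, hu, hmax⟩ := (isCompact_Icc (a := l) (b := r)).exists_isMaxOn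
          ⟨l, le_rfl, hlr⟩ (f := fun u => g u - k * u) (by fun_prop)
        rcases le_total u x with h | h
        · exact Or.inl ⟨hk, u, ⟨hu.1, h⟩, fun w hw => hmax hw⟩
        · exact Or.inr ⟨hk, u, ⟨h, hu.2⟩, fun w hw => hmax hw⟩)
      ⟨1 / 2, by norm_num, by norm_num, l, ⟨le_rfl, hx.1⟩, fun w hw => by
        have := (le_abs_self _).trans (hg2 w l)
        rw [abs_of_nonneg (sub_nonneg.2 hw.1)] at this
        linarith⟩
      ⟨-(1 / 2), by norm_num, by norm_num, r, ⟨hx.2, le_rfl⟩, fun w hw => by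
        have := (le_abs_self _).trans (hg2 w r)
        rw [abs_sub_comm w, abs_of_nonneg (sub_nonneg.2 hw.2)] at this
        linarith⟩
  have huv : g u - k * u = g v - k * v :=
    le_antisymm (hmv u ⟨hu.1, hu.2.trans hx.2⟩) (hmu v ⟨hx.1.trans hv.1, hv.2⟩)
  refine ⟨k, g u - k * u + k * x, abs_le.2 hk, fun w hw => ?_, ⟨u, hu, by ring⟩, v, hv, ?_⟩
  · linarith [hmu w hw]
  · linarith

namespace HullLine

variable {g : ℝ → ℝ} {l r x k y x' k' y' : ℝ}

theorem le_line (h : HullLine g l r x k y) (h' : HullLine g l r x' k' y') :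
    y' ≤ y + k * (x' - x) := by
  obtain ⟨u, hu, hgu⟩ := h'.left
  obtain ⟨v, hv, hgv⟩ := h'.right
  have h1 := h.le u ⟨hu.1, hu.2.trans (hv.1.trans hv.2)⟩
  have h2 := h.le v ⟨hu.1.trans (hu.2.trans hv.1), hv.2⟩
  rw [hgu] at h1
  rw [hgv] at h2
  by_contra! hcon
  rcases eq_or_lt_of_le hu.2 with rfl | h3
  · simp at h1
    linarith
  · nlinarith [hv.1, mul_nonneg (sub_nonneg.2 hu.2) (sub_nonneg.2 hv.1)]

theorem antitone (h : HullLine g l r x k y) (h' : HullLine g l r x' k' y') (hx : x < x') :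
    k' ≤ k := by
  have h1 := h.le_line h'
  have h2 := h'.le_line h
  by_contra! hcon
  nlinarith

/-- Between the touching points the hull coincides with the line. -/
theorem eq_line (h : HullLine g l r x k y) {u v : ℝ} (hu : u ∈ Icc l x) (hv : v ∈ Icc x r)
    (hgu : g u = y + k * (u - x)) (hgv : g v = y + k * (v - x))
    (h' : HullLine g l r x' k' y') (hx' : x' ∈ Icc u v) : y' = y + k * (x' - x) := by
  refine le_antisymm (h.le_line h') ?_
  have h1 := h'.le u ⟨hu.1, hu.2.trans (hv.1.trans hv.2)⟩
  have h2 := h'.le v ⟨hu.1.trans (hu.2.trans hv.1), hv.2⟩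
  rw [hgu] at h1
  rw [hgv] at h2
  by_contra! hcon
  rcases eq_or_lt_of_le hx'.1 with rfl | h3
  · simp at h1
    linarith
  · nlinarith [hx'.2, mul_nonneg (sub_nonneg.2 hx'.1) (sub_nonneg.2 hx'.2)]

end HullLine

variable {g m f : ℝ → ℝ} {l r : ℝ}

theorem hasDerivAt_hull (hg : Differentiable ℝ g)
    (h : ∀ x ∈ Icc l r, HullLine g l r x (m x) (f x)) {x : ℝ} (hx : x ∈ Ioo l r) :
    HasDerivAt f (m x) x := by
  have hx' := Ioo_subset_Icc_self hx
  have hL := h x hx'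
  obtain ⟨u, hu, hgu⟩ := hL.left
  obtain ⟨v, hv, hgv⟩ := hL.right
  have hline : HasDerivAt (fun w => f x + m x * (w - x)) (m x) x := by
    simpa using (((hasDerivAt_id x).sub_const x).const_mul (m x)).const_add (f x)
  have hIoo := Ioo_mem_nhds hx.1 hx.2
  by_cases hc : g x = f x
  · have hge : ∀ w ∈ Ioo l r, g w ≤ f w := fun w hw => by
      simpa using (h w (Ioo_subset_Icc_self hw)).le w (Ioo_subset_Icc_self hw)
    have hd := (hg x).hasDerivAt.sub hline
    have hmax : IsLocalMax (fun w => g w - (f x + m x * (w - x))) x := by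
      filter_upwards [hIoo] with w hw
      have := hL.le w (Ioo_subset_Icc_self hw)
      simp only [sub_self, mul_zero, add_zero, hc]
      linarith
    have h0 : deriv g x - m x = 0 := hmax.hasDerivAt_eq_zero hd
    rw [h0] at hd
    have hz : HasDerivAt (fun w => f w - (f x + m x * (w - x))) 0 x := by
      rw [hasDerivAt_iff_isLittleO] at hd ⊢
      simp only [Pi.sub_apply, sub_self, mul_zero, add_zero, hc, smul_zero, sub_zero] at hd ⊢
      refine Asymptotics.IsBigO.trans_isLittleO (Asymptotics.IsBigO.of_bound 1 ?_) hd
      filter_upwards [hIoo] with w hw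
      have h1 := hge w hw
      have h2 := hL.le_line (h w (Ioo_subset_Icc_self hw))
      rw [one_mul, Real.norm_eq_abs, Real.norm_eq_abs, abs_of_nonpos (by linarith),
        abs_of_nonpos (by linarith)]
      linarith
    have := hz.add hline
    rw [zero_add] at this
    exact this.congr_of_eventuallyEq (Eventually.of_forall fun w => by simp)
  · have hu' : u < x := lt_of_le_of_ne hu.2 fun he => hc (by rw [← he] at hgu ⊢; simpa using hgu)
    have hv' : x < v := lt_of_le_of_ne hv.1 fun he => hc (by rw [he] at hgv ⊢; simpa using hgv)
    refine hline.congr_of_eventuallyEq ?_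
    filter_upwards [Ioo_mem_nhds hu' hv', hIoo] with w hw hw'
    exact hL.eq_line hu hv hgu hgv (h w (Ioo_subset_Icc_self hw')) (Ioo_subset_Icc_self hw)

theorem continuousAt_hull_slope (hg : Differentiable ℝ g)
    (h : ∀ x ∈ Icc l r, HullLine g l r x (m x) (f x)) {x : ℝ} (hx : x ∈ Ioo l r) :
    ContinuousAt m x := by
  have hIoo := Ioo_mem_nhds hx.1 hx.2
  have hd := hasDerivAt_hull hg h hx
  have hslope := hasDerivAt_iff_tendsto_slope.1 hd
  rw [Metric.continuousAt_iff']
  intro ε hε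
  have hev := hslope.eventually (ball_mem_nhds (m x) hε)
  have hlow : ∀ᶠ w in 𝓝 x, m x - ε < m w := by
    obtain ⟨z, ⟨hz, hzI⟩, hxz⟩ := ((hev.filter_mono (nhdsWithin_mono x
      (show Ioi x ⊆ {x}ᶜ from fun z hz => ne_of_gt hz))).and (mem_nhdsWithin_of_mem_nhds hIoo) |>.and
      self_mem_nhdsWithin).exists
    have hxz : x < z := hxz
    have h1 : m x - ε < (f z - f x) / (z - x) := by
      rw [Real.dist_eq, abs_lt, slope_def_field] at hz
      linarith [hz.1]
    have hcont : ContinuousAt (fun w => (f z - f w) / (z - w)) x :=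
      (continuousAt_const.sub hd.continuousAt).div (continuousAt_const.sub continuousAt_id)
        (sub_ne_zero.2 hxz.ne')
    filter_upwards [hcont.eventually (lt_mem_nhds h1), hIoo, Iio_mem_nhds hxz] with w hw hwI hwz
    have h2 := (h w (Ioo_subset_Icc_self hwI)).le_line (h z (Ioo_subset_Icc_self hzI))
    have hwz : w < z := hwz
    refine hw.trans_le ((div_le_iff₀ (by linarith)).2 (by linarith))
  have hup : ∀ᶠ w in 𝓝 x, m w < m x + ε := by
    obtain ⟨z, ⟨hz, hzI⟩, hxz⟩ := ((hev.filter_mono (nhdsWithin_mono x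
      (show Iio x ⊆ {x}ᶜ from fun z hz => ne_of_lt hz))).and (mem_nhdsWithin_of_mem_nhds hIoo) |>.and
      self_mem_nhdsWithin).exists
    have hxz : z < x := hxz
    have h1 : (f z - f x) / (z - x) < m x + ε := by
      rw [Real.dist_eq, abs_lt, slope_def_field] at hz
      linarith [hz.2]
    have hcont : ContinuousAt (fun w => (f z - f w) / (z - w)) x :=
      (continuousAt_const.sub hd.continuousAt).div (continuousAt_const.sub continuousAt_id)
        (sub_ne_zero.2 hxz.ne)
    filter_upwards [hcont.eventually (gt_mem_nhds h1), hIoo, Ioi_mem_nhds hxz] with w hw hwI hwz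
    have h2 := (h w (Ioo_subset_Icc_self hwI)).le_line (h z (Ioo_subset_Icc_self hzI))
    have hwz : z < w := hwz
    refine lt_of_le_of_lt ?_ hw
    rw [le_div_iff_of_neg (by linarith)]
    linarith
  filter_upwards [hlow, hup] with w h1 h2
  rw [Real.dist_eq, abs_lt]
  constructor <;> linarith

theorem hull_slope_eq_of_gap (hg : Differentiable ℝ g)
    (h : ∀ x ∈ Icc l r, HullLine g l r x (m x) (f x)) {s u : ℝ} (hs : s ∈ Ioo l r)
    (hu : u ∈ Ioo l r) (hsu : s ≤ u) (hgap : ∀ x ∈ Icc s u, g x < f x) : m s = m u := by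
  have hL := h s (Ioo_subset_Icc_self hs)
  obtain ⟨a, ha, hga⟩ := hL.left
  obtain ⟨v, hv, hgv⟩ := hL.right
  have ha' : a < s := lt_of_le_of_ne ha.2 fun he => by
    have := hgap s ⟨le_rfl, hsu⟩
    rw [he] at hga
    simp at hga
    linarith
  have hv' : u < v := by
    by_contra! hcon
    have h1 := hgap v ⟨hv.1, hcon⟩
    have h2 := hL.le_line (h v ⟨hs.1.le.trans hv.1, hv.2⟩)
    linarith
  have hd := hasDerivAt_hull hg h hu
  have hline : HasDerivAt (fun w => f s + m s * (w - s)) (m s) u := by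
    simpa using (((hasDerivAt_id u).sub_const s).const_mul (m s)).const_add (f s)
  refine (hline.congr_of_eventuallyEq ?_).unique hd
  filter_upwards [Ioo_mem_nhds (ha'.trans_le hsu) hv', Ioo_mem_nhds hu.1 hu.2] with w hw hw'
  exact hL.eq_line ha hv hga hgv (h w (Ioo_subset_Icc_self hw')) (Ioo_subset_Icc_self hw)

theorem exists_hull {g : ℝ → ℝ} {l r : ℝ} (hg : ContDiff ℝ 1 g) (hg2 : ∀ s, |deriv g s| ≤ 1 / 2)
    (hl : l < 0) (hr : 0 < r) (hle : ∀ x ∈ Icc l r, g x ≤ 0) (h0 : g 0 = 0) (hgr : g r < 0) :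
    ∃ (l' q r' : ℝ) (m φ : ℝ → ℝ), l < l' ∧ l' < 0 ∧ 0 < q ∧ q < r' ∧ r' < r ∧ Continuous m ∧
      Antitone m ∧ (∀ s, |m s| ≤ 1 / 2) ∧ m 0 = 0 ∧ m q < 0 ∧ HullData l' r' (deriv g) m φ ∧
      ∀ s ∈ Icc l' r', ∀ u ∈ Icc l' r', s ≤ u → (∀ x ∈ Icc s u, φ x ≠ 0) → m s = m u := by
  have hgd : Differentiable ℝ g := hg.differentiable one_ne_zero
  have hlip : ∀ s u, |g s - g u| ≤ 1 / 2 * |s - u| := fun s u =>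
    Convex.norm_image_sub_le_of_norm_deriv_le (fun x _ => hgd x) (fun x _ => hg2 x) convex_univ
      (mem_univ u) (mem_univ s)
  have hex : ∀ x, ∃ k y, x ∈ Icc l r → HullLine g l r x k y := fun x => by
    by_cases hx : x ∈ Icc l r
    · obtain ⟨k, y, h⟩ := exists_hullLine hg.continuous hlip hx
      exact ⟨k, y, fun _ => h⟩
    · exact ⟨0, 0, fun h => absurd h hx⟩
  choose m f h using hex
  have hge : ∀ w ∈ Icc l r, g w ≤ f w := fun w hw => by simpa using (h w hw).le w hw
  have h0m : (0 : ℝ) ∈ Icc l r := ⟨hl.le, hr.le⟩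
  have hL0 : HullLine g l r 0 0 0 :=
    ⟨by norm_num, fun w hw => by simpa using hle w hw, ⟨0, ⟨hl.le, le_rfl⟩, by simp [h0]⟩,
      ⟨0, ⟨le_rfl, hr.le⟩, by simp [h0]⟩⟩
  have hf0 : f 0 = 0 := by
    have h1 := hL0.le_line (h 0 h0m)
    have h2 := hge 0 h0m
    simp at h1
    linarith
  have hm0 : m 0 = 0 := by
    refine IsLocalMax.hasDerivAt_eq_zero (f := f) (a := 0) ?_
      (hasDerivAt_hull hgd h ⟨hl, hr⟩)
    filter_upwards [Icc_mem_nhds hl hr] with w hw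
    have := hL0.le_line (h w hw)
    rw [hf0]
    simpa using this
  obtain ⟨ε, hε, hball⟩ := Metric.eventually_nhds_iff_ball.1
    (hg.continuous.continuousAt.eventually (gt_mem_nhds hgr))
  obtain ⟨q, hq, hqr⟩ : ∃ q, max 0 (r - ε) < q ∧ q < r :=
    exists_between (max_lt hr (by linarith))
  have hq0 : 0 < q := (le_max_left _ _).trans_lt hq
  have hqε : r - ε < q := (le_max_right _ _).trans_lt hq
  have hmq : m q < 0 := by
    have hqm : q ∈ Icc l r := ⟨by linarith, hqr.le⟩
    obtain ⟨v, hv, hgv⟩ := (h q hqm).right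
    have h1 := (h q hqm).le_line (h 0 h0m)
    have h2 : g v < 0 := hball v (by rw [mem_ball, Real.dist_eq, abs_lt]; constructor <;>
      linarith [hv.1, hv.2])
    by_contra! hcon
    nlinarith [hv.1, mul_nonneg hcon (sub_nonneg.2 hv.1)]
  obtain ⟨r', hr1, hr2⟩ := exists_between hqr
  have hlr : l / 2 ≤ r' := by linarith
  have hsub : Icc (l / 2) r' ⊆ Ioo l r := fun x hx => ⟨by linarith [hx.1], by linarith [hx.2]⟩
  set p : ℝ → ℝ := fun s => max (l / 2) (min r' s) with hp
  have hpI : ∀ s, p s ∈ Icc (l / 2) r' := fun s => ⟨le_max_left _ _, max_le hlr (min_le_left _ _)⟩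
  have hpe : ∀ s ∈ Icc (l / 2) r', p s = s := fun s hs => by
    simp only [hp]
    rw [min_eq_right hs.2, max_eq_right hs.1]
  have hmonop : Monotone p := fun s t hst => by simp only [hp]; gcongr
  refine ⟨l / 2, q, r', m ∘ p, f - g, by linarith, by linarith, hq0, hr1, hr2, ?_, ?_, ?_, ?_, ?_,
    ⟨?_, ?_, ?_⟩, ?_⟩
  · exact ContinuousOn.comp_continuous (s := Ioo l r)
      (fun x hx => (continuousAt_hull_slope hgd h hx).continuousWithinAt)
      (by simp only [hp]; fun_prop) (fun s => hsub (hpI s))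
  · intro s t hst
    rcases eq_or_lt_of_le (hmonop hst) with he | hlt
    · simp [he]
    · exact (h _ (Ioo_subset_Icc_self (hsub (hpI s)))).antitone
        (h _ (Ioo_subset_Icc_self (hsub (hpI t)))) hlt
  · exact fun s => (h _ (Ioo_subset_Icc_self (hsub (hpI s)))).slope_le
  · rw [Function.comp, hpe 0 ⟨by linarith, by linarith⟩, hm0]
  · rw [Function.comp, hpe q ⟨by linarith, by linarith⟩]
    exact hmq
  · exact fun s hs => sub_nonneg.2 (hge s (Ioo_subset_Icc_self (hsub hs)))
  · intro s hs
    rw [Function.comp, hpe s hs]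
    exact (hasDerivAt_hull hgd h (hsub hs)).sub (hgd s).hasDerivAt
  · exact fun s _ => (h _ (Ioo_subset_Icc_self (hsub (hpI s)))).slope_le
  · intro s hs u hu hsu hgap
    rw [Function.comp, Function.comp, hpe s hs, hpe u hu]
    refine hull_slope_eq_of_gap hgd h (hsub hs) (hsub hu) hsu fun x hx => ?_
    have hxI : x ∈ Icc l r := Ioo_subset_Icc_self (hsub ⟨hs.1.trans hx.1, hx.2.trans hu.2⟩)
    exact lt_of_le_of_ne (hge x hxI) fun he => hgap x hx (by simp [he])

end ConcaveHull

section Swing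

open Complex (I)

/-- The displacement at time `s` of the curve of slope `k` rotated by the angle `η ∘ m`. -/
def swing (k m η : ℝ → ℝ) (s : ℝ) : ℂ :=
  ∫ t in (0 : ℝ)..s, (Complex.exp (I * η (m t)) - 1) * (1 + k t * I)

variable {k m η η' : ℝ → ℝ} {s q x : ℝ}

theorem continuous_swing_integrand (hk : Continuous k) (hm : Continuous m) (hη : Continuous η) :
    Continuous fun t : ℝ => (Complex.exp (I * η (m t)) - 1) * (1 + k t * I) := by
  have : Continuous fun t => η (m t) := hη.comp hm
  fun_prop

theorem swing_congr (hs : 0 ≤ s) (h : ∀ t ∈ Icc 0 s, η (m t) = η' (m t)) :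
    swing k m η s = swing k m η' s :=
  intervalIntegral.integral_congr fun t ht => by
    rw [uIcc_of_le hs] at ht
    simp only [h t ht]

theorem swing_eq_of_zero (hk : Continuous k) (hm : Continuous m) (hη : Continuous η)
    (hsq : s ≤ q) (h : ∀ t ∈ Icc s q, η (m t) = 0) : swing k m η s = swing k m η q := by
  have hc := continuous_swing_integrand hk hm hη
  have h0 : ∫ t in s..q, (Complex.exp (I * η (m t)) - 1) * (1 + k t * I) = 0 := by
    rw [intervalIntegral.integral_congr (g := fun _ => (0 : ℂ))]
    · simp
    · intro t ht
      rw [uIcc_of_le hsq] at ht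
      simp [h t ht]
  have := intervalIntegral.integral_add_adjacent_intervals (hc.intervalIntegrable 0 s)
    (hc.intervalIntegrable s q) (μ := MeasureTheory.volume)
  rw [h0, add_zero] at this
  exact this

theorem swing_sum {ι : Type*} (t : Finset ι) {η : ι → ℝ → ℝ} (hk : Continuous k)
    (hm : Continuous m) (hη : ∀ i, Continuous (η i))
    (hd : ∀ i j, i ≠ j → ∀ x, η i x = 0 ∨ η j x = 0) (s : ℝ) :
    swing k m (fun x => ∑ i ∈ t, η i x) s = ∑ i ∈ t, swing k m (η i) s := by
  have hpt : ∀ x, Complex.exp (I * ((∑ i ∈ t, η i x : ℝ) : ℂ)) - 1 =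
      ∑ i ∈ t, (Complex.exp (I * η i x) - 1) := by
    intro x
    by_cases h : ∃ i ∈ t, η i x ≠ 0
    · obtain ⟨i, hi, hne⟩ := h
      have h0 : ∀ j ∈ t, j ≠ i → η j x = 0 := fun j _ hji => (hd j i hji x).resolve_right hne
      rw [Finset.sum_eq_single_of_mem i hi h0, Finset.sum_eq_single_of_mem i hi]
      intro j hj hji
      simp [h0 j hj hji]
    · push Not at h
      rw [Finset.sum_eq_zero h, Finset.sum_eq_zero]
      · simp
      · intro i hi
        simp [h i hi]
  simp only [swing]
  rw [← intervalIntegral.integral_finsetSum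
    fun i _ => (continuous_swing_integrand hk hm (hη i)).intervalIntegrable _ _]
  simp only [hpt, Finset.sum_mul]

theorem norm_exp_sub_exp_sub_le (a b : ℝ) :
    ‖Complex.exp (I * a) - Complex.exp (I * b) - I * ((a - b : ℝ) : ℂ)‖ ≤
      (|a| + |b|) * |a - b| := by
  have hd : ∀ u : ℝ, HasDerivAt (fun u : ℝ => Complex.exp (I * u) - I * u)
      (I * (Complex.exp (I * u) - 1)) u := fun u => by
    have h1 : HasDerivAt (fun u : ℝ => I * (u : ℂ)) I u := by
      simpa using (Complex.ofRealCLM.hasDerivAt (x := u)).const_mul I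
    exact (h1.cexp.sub h1).congr_deriv (by ring)
  have hle : ‖(Complex.exp (I * a) - I * a) - (Complex.exp (I * b) - I * b)‖ ≤
      (|a| + |b|) * ‖a - b‖ := by
    refine Convex.norm_image_sub_le_of_norm_hasDerivWithin_le (s := uIcc b a)
      (fun u _ => (hd u).hasDerivWithinAt) (fun u hu => ?_) (convex_uIcc b a) left_mem_uIcc
      right_mem_uIcc
    rw [norm_mul, Complex.norm_I, one_mul]
    refine (Real.norm_exp_I_mul_ofReal_sub_one_le).trans ?_
    rw [Real.norm_eq_abs]
    have ha := abs_le.1 (le_refl |a|)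
    have hb := abs_le.1 (le_refl |b|)
    have ha0 := abs_nonneg a
    have hb0 := abs_nonneg b
    exact abs_le.2 (uIcc_subset_Icc (a₂ := -(|a| + |b|)) (b₂ := |a| + |b|)
      ⟨by linarith, by linarith⟩ ⟨by linarith, by linarith⟩ hu)
  refine le_of_eq_of_le ?_ hle
  congr 1
  push_cast
  ring

theorem swing_zero (k m : ℝ → ℝ) (s : ℝ) : swing k m 0 s = 0 := by simp [swing]

theorem hasStrictDerivAt_swing {b : ℝ → ℝ} (hk : Continuous k) (hm : Continuous m)
    (hb : Continuous b) (hk2 : ∀ s, |k s| ≤ 1 / 2) (hb1 : ∀ x, |b x| ≤ 1) (hq : 0 ≤ q) :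
    HasStrictDerivAt (fun t : ℝ => swing k m (fun x => t * b x) q)
      (∫ s in (0 : ℝ)..q, I * b (m s) * (1 + k s * I)) 0 := by
  have hbm : Continuous fun s => b (m s) := hb.comp hm
  have key : ∀ t u : ℝ, ‖swing k m (fun x => t * b x) q - swing k m (fun x => u * b x) q -
      ((t - u : ℝ) : ℂ) * ∫ s in (0 : ℝ)..q, I * b (m s) * (1 + k s * I)‖ ≤
        2 * q * (|t| + |u|) * |t - u| := by
    intro t u
    rw [swing, swing, ← intervalIntegral.integral_sub, ← intervalIntegral.integral_const_mul,
      ← intervalIntegral.integral_sub]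
    rotate_left
    · exact (Continuous.intervalIntegrable (by fun_prop) _ _)
    · exact (Continuous.intervalIntegrable (by fun_prop) _ _)
    · exact (Continuous.intervalIntegrable (by fun_prop) _ _)
    · exact (Continuous.intervalIntegrable (by fun_prop) _ _)
    refine (intervalIntegral.norm_integral_le_of_norm_le_const
      (C := 2 * (|t| + |u|) * |t - u|) fun s _ => ?_).trans (le_of_eq ?_)
    · have h1 := norm_exp_sub_exp_sub_le (t * b (m s)) (u * b (m s))
      have h2 : ‖(1 : ℂ) + k s * I‖ ≤ 2 := by
        refine (norm_add_le _ _).trans ?_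
        simp only [norm_one, norm_mul, Complex.norm_real, Complex.norm_I, mul_one, Real.norm_eq_abs]
        linarith [hk2 s]
      have h3 := hb1 (m s)
      have h4 : (|t * b (m s)| + |u * b (m s)|) * |t * b (m s) - u * b (m s)| ≤
          (|t| + |u|) * |t - u| := by
        rw [← sub_mul, abs_mul, abs_mul, abs_mul, ← add_mul]
        have ha := abs_nonneg (b (m s))
        have hP : 0 ≤ (|t| + |u|) * |t - u| := by positivity
        calc _ = ((|t| + |u|) * |t - u|) * (|b (m s)| * |b (m s)|) := by ring
          _ ≤ ((|t| + |u|) * |t - u|) * 1 := by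
            refine mul_le_mul_of_nonneg_left ?_ hP
            nlinarith
          _ = _ := mul_one _
      calc _ = ‖(Complex.exp (I * ((t * b (m s) : ℝ) : ℂ)) - Complex.exp (I * ((u * b (m s) : ℝ) : ℂ)) -
            I * ((t * b (m s) - u * b (m s) : ℝ) : ℂ)) * (1 + k s * I)‖ := by
            congr 1
            push_cast
            ring
        _ ≤ ((|t| + |u|) * |t - u|) * 2 := by
            rw [norm_mul]
            exact mul_le_mul (h1.trans h4) h2 (norm_nonneg _) (by positivity)
        _ = _ := by ring
    · rw [sub_zero, abs_of_nonneg hq]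
      ring
  rw [hasStrictDerivAt_iff_hasStrictFDerivAt, hasStrictFDerivAt_iff_isLittleO,
    Asymptotics.isLittleO_iff]
  intro ε hε
  have hev : ∀ᶠ p : ℝ × ℝ in 𝓝 (0, 0), 2 * q * (|p.1| + |p.2|) < ε := by
    have : Continuous fun p : ℝ × ℝ => 2 * q * (|p.1| + |p.2|) := by fun_prop
    exact this.continuousAt.eventually (gt_mem_nhds (by simpa using hε))
  filter_upwards [hev] with p hp
  have := key p.1 p.2
  simp only [ContinuousLinearMap.toSpanSingleton_apply, Complex.real_smul]
  refine this.trans ?_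
  rw [Real.norm_eq_abs]
  gcongr

end Swing

section Block

open Complex (I)

/-- The tent of radius `ρ` centred at `c`. -/
def tent (c ρ x : ℝ) : ℝ := max 0 (ρ - |x - c|)

theorem continuous_tent (c ρ : ℝ) : Continuous (tent c ρ) := by
  unfold tent
  fun_prop

theorem tent_nonneg (c ρ x : ℝ) : 0 ≤ tent c ρ x := le_max_left _ _

theorem tent_le {ρ : ℝ} (hρ : 0 ≤ ρ) (c x : ℝ) : tent c ρ x ≤ ρ :=
  max_le hρ (by linarith [abs_nonneg (x - c)])

theorem tent_eq_zero {c ρ x : ℝ} (h : ρ ≤ |x - c|) : tent c ρ x = 0 :=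
  max_eq_left (by linarith)

theorem abs_tent_sub_le (c ρ x y : ℝ) : |tent c ρ x - tent c ρ y| ≤ |x - y| := by
  refine (abs_max_sub_max_le_max _ _ _ _).trans (max_le (by simp) ?_)
  rw [show ρ - |x - c| - (ρ - |y - c|) = |y - c| - |x - c| by ring]
  refine (abs_abs_sub_abs_le_abs_sub _ _).trans (le_of_eq ?_)
  rw [abs_sub_comm]
  congr 1
  ring

/-- A function together with its concave hull over a window. -/
structure HullCurve (g m φ : ℝ → ℝ) (l q r : ℝ) : Prop where
  contDiff : ContDiff ℝ 1 g
  deriv_le : ∀ s, |deriv g s| ≤ 1 / 2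
  map_zero : g 0 = 0
  l_neg : l < 0
  q_pos : 0 < q
  q_lt : q < r
  cont : Continuous m
  anti : Antitone m
  m_le : ∀ s, |m s| ≤ 1 / 2
  m_zero : m 0 = 0
  m_neg : m q < 0
  hull : HullData l r (deriv g) m φ
  gap : ∀ s ∈ Icc l r, ∀ u ∈ Icc l r, s ≤ u → (∀ x ∈ Icc s u, φ x ≠ 0) → m s = m u

namespace HullCurve

variable {g m φ : ℝ → ℝ} {l q r : ℝ}

theorem continuous_deriv (h : HullCurve g m φ l q r) : Continuous (_root_.deriv g) :=
  h.contDiff.continuous_deriv le_rfl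

theorem mem_Ioo (h : HullCurve g m φ l q r) {s : ℝ} (h1 : m q < m s) (h2 : m s < 0) :
    s ∈ Ioo 0 q := by
  constructor
  · by_contra! hcon
    have := h.anti hcon
    rw [h.m_zero] at this
    linarith
  · by_contra! hcon
    linarith [h.anti hcon]

theorem eventually_slope_eq (h : HullCurve g m φ l q r) {s : ℝ} (hs : s ∈ Ioo l r)
    (h0 : φ s ≠ 0) : ∀ᶠ u in 𝓝 s, m u = m s := by
  have hφ := h.hull.hasDeriv s (Ioo_subset_Icc_self hs)
  obtain ⟨δ, hδ, hball⟩ := Metric.eventually_nhds_iff_ball.1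
    ((hφ.continuousAt.eventually_ne h0).and (Ioo_mem_nhds hs.1 hs.2))
  filter_upwards [ball_mem_nhds s hδ] with u hu
  have hseg : ∀ x ∈ uIcc s u, x ∈ ball s δ := fun x hx =>
    (convex_ball s δ).segment_subset (mem_ball_self hδ) hu (by rwa [segment_eq_uIcc])
  have hI : ∀ x ∈ ball s δ, x ∈ Icc l r := fun x hx => Ioo_subset_Icc_self (hball x hx).2
  rcases le_total s u with hsu | hsu
  · rw [uIcc_of_le hsu] at hseg
    exact (h.gap s (hI _ (mem_ball_self hδ)) u (hI _ hu) hsu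
      fun x hx => (hball x (hseg x hx)).1).symm
  · rw [uIcc_of_ge hsu] at hseg
    exact h.gap u (hI _ hu) s (hI _ (mem_ball_self hδ)) hsu
      fun x hx => (hball x (hseg x hx)).1

theorem hasDerivAt_mul (h : HullCurve g m φ l q r) {b : ℝ → ℝ} (hb : Continuous b) {s : ℝ}
    (hs : s ∈ Ioo l r) :
    HasDerivAt (fun u => b (m u) * φ u) (b (m s) * (m s - deriv g s)) s := by
  have hφ := h.hull.hasDeriv s (Ioo_subset_Icc_self hs)
  by_cases h0 : φ s = 0
  · have hmin : IsLocalMin φ s := by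
      filter_upwards [Ioo_mem_nhds hs.1 hs.2] with u hu
      rw [h0]
      exact h.hull.nonneg u (Ioo_subset_Icc_self hu)
    have hmk := hmin.hasDerivAt_eq_zero hφ
    rw [hmk] at hφ ⊢
    rw [mul_zero]
    rw [hasDerivAt_iff_isLittleO] at hφ ⊢
    simp only [h0, smul_zero, sub_zero, mul_zero] at hφ ⊢
    have hO : (fun u => b (m u)) =O[𝓝 s] fun _ => (1 : ℝ) :=
      ((hb.comp h.cont).continuousAt (x := s)).isBigO_one ℝ
    simpa using hO.mul_isLittleO hφ
  · refine (hφ.const_mul (b (m s))).congr_of_eventuallyEq ?_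
    filter_upwards [h.eventually_slope_eq hs h0] with u hu
    rw [hu]

theorem integral_mul_slope (h : HullCurve g m φ l q r) {b : ℝ → ℝ} (hb : Continuous b)
    (hb0 : b 0 = 0) (hbq : b (m q) = 0) :
    ∫ s in (0 : ℝ)..q, b (m s) * deriv g s = ∫ s in (0 : ℝ)..q, b (m s) * m s := by
  have hbm : Continuous fun s => b (m s) := hb.comp h.cont
  have hcd := h.continuous_deriv
  have hcm := h.cont
  have := intervalIntegral.integral_eq_sub_of_hasDerivAt (a := 0) (b := q)
    (f := fun u => b (m u) * φ u) (f' := fun s => b (m s) * (m s - deriv g s))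
    (fun s hs => h.hasDerivAt_mul hb (by
      rw [uIcc_of_le h.q_pos.le] at hs
      exact ⟨h.l_neg.trans_le hs.1, hs.2.trans_lt h.q_lt⟩))
    (Continuous.intervalIntegrable (by fun_prop) _ _)
  simp only [h.m_zero, hb0, hbq, zero_mul, sub_zero, mul_sub] at this
  rw [intervalIntegral.integral_sub (Continuous.intervalIntegrable (by fun_prop) _ _)
    (Continuous.intervalIntegrable (by fun_prop) _ _)] at this
  linarith

/-- The first order displacement caused by a tent of slopes. -/
theorem exists_swing_tent (h : HullCurve g m φ l q r) {c ρ : ℝ} (hρ : 0 < ρ) (hρ1 : ρ ≤ 1)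
    (h1 : m q ≤ c - ρ) (h2 : c + ρ ≤ 0) :
    ∃ A B : ℝ, 0 < A ∧ |B - c * A| ≤ ρ * A ∧
      HasStrictDerivAt (fun t : ℝ => swing (deriv g) m (fun x => t * tent c ρ x) q)
        (-B + A * I) 0 := by
  have hbc := continuous_tent c ρ
  have hbm : Continuous fun s => tent c ρ (m s) := hbc.comp h.cont
  have hcd := h.continuous_deriv
  have hcm := h.cont
  have hz : tent c ρ 0 = 0 := tent_eq_zero (by
    rw [zero_sub, abs_neg, abs_of_neg (by linarith)]; linarith)
  have hzq : tent c ρ (m q) = 0 := tent_eq_zero (by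
    rw [abs_of_nonpos (by linarith)]; linarith)
  have hA : 0 < ∫ s in (0 : ℝ)..q, tent c ρ (m s) := by
    obtain ⟨s, hs, hms⟩ := intermediate_value_Icc' h.q_pos.le h.cont.continuousOn
      (show c ∈ Icc (m q) (m 0) from ⟨by linarith, by rw [h.m_zero]; linarith⟩)
    refine intervalIntegral.integral_pos h.q_pos hbm.continuousOn
      (fun x _ => tent_nonneg _ _ _) ⟨s, hs, ?_⟩
    rw [hms]
    simpa [tent] using hρ
  refine ⟨∫ s in (0 : ℝ)..q, tent c ρ (m s), ∫ s in (0 : ℝ)..q, tent c ρ (m s) * m s, hA, ?_, ?_⟩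
  · rw [← intervalIntegral.integral_const_mul, ← intervalIntegral.integral_const_mul,
      ← intervalIntegral.integral_sub (Continuous.intervalIntegrable (by fun_prop) _ _)
      (Continuous.intervalIntegrable (by fun_prop) _ _)]
    have hint : IntervalIntegrable (fun s => ρ * tent c ρ (m s)) MeasureTheory.volume 0 q :=
      Continuous.intervalIntegrable (by fun_prop) _ _
    refine intervalIntegral.norm_integral_le_of_norm_le
      (f := fun s => tent c ρ (m s) * m s - c * tent c ρ (m s)) h.q_pos.le
      (Eventually.of_forall fun s _ => ?_) hint
    rw [show tent c ρ (m s) * m s - c * tent c ρ (m s) = tent c ρ (m s) * (m s - c) by ring,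
      Real.norm_eq_abs, abs_mul, abs_of_nonneg (tent_nonneg _ _ _), mul_comm]
    rcases le_total ρ |m s - c| with hle | hle
    · rw [tent_eq_zero hle]
      simp
    · exact mul_le_mul_of_nonneg_right hle (tent_nonneg _ _ _)
  · refine (hasStrictDerivAt_swing hcd hcm hbc h.deriv_le (fun x => ?_) h.q_pos.le).congr_deriv ?_
    · rw [abs_of_nonneg (tent_nonneg _ _ _)]
      exact (tent_le hρ.le _ _).trans hρ1
    · rw [← h.integral_mul_slope hbc hz hzq, ← intervalIntegral.integral_ofReal,
        ← intervalIntegral.integral_ofReal, ← intervalIntegral.integral_neg,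
        ← intervalIntegral.integral_mul_const, ← intervalIntegral.integral_add
        (Continuous.intervalIntegrable (by fun_prop) _ _)
        (Continuous.intervalIntegrable (by fun_prop) _ _)]
      refine intervalIntegral.integral_congr fun s _ => ?_
      push_cast
      linear_combination (tent c ρ (m s) : ℂ) * ((deriv g s : ℝ) : ℂ) * Complex.I_mul_I

end HullCurve

end Block

section BlockSolve

open Complex (I)

/-- Two transverse families of displacements compensate any small displacement. -/
theorem image_add_mem_nhds {D₂ D₃ : ℝ → ℂ} {A₂ B₂ A₃ B₃ : ℝ}
    (h₂ : HasStrictDerivAt D₂ (-B₂ + A₂ * I) 0) (h₃ : HasStrictDerivAt D₃ (-B₃ + A₃ * I) 0)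
    (hne : B₂ * A₃ - B₃ * A₂ ≠ 0) (h20 : D₂ 0 = 0) (h30 : D₃ 0 = 0) {ε : ℝ} (hε : 0 < ε) :
    ∀ᶠ w in 𝓝 (0 : ℂ), ∃ t u : ℝ, |t| < ε ∧ |u| < ε ∧ D₂ t + D₃ u = w := by
  have hG : HasStrictFDerivAt (fun p : ℝ × ℝ => D₂ p.1 + D₃ p.2)
      ((ContinuousLinearMap.fst ℝ ℝ ℝ).smulRight (-B₂ + A₂ * I : ℂ) +
        (ContinuousLinearMap.snd ℝ ℝ ℝ).smulRight (-B₃ + A₃ * I : ℂ)) (0, 0) := by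
    have k2 := HasStrictFDerivAt.comp (f := fun p : ℝ × ℝ => p.1) (g := D₂) ((0 : ℝ), (0 : ℝ))
      h₂.hasStrictFDerivAt hasStrictFDerivAt_fst
    have k3 := HasStrictFDerivAt.comp (f := fun p : ℝ × ℝ => p.2) (g := D₃) ((0 : ℝ), (0 : ℝ))
      h₃.hasStrictFDerivAt hasStrictFDerivAt_snd
    refine (k2.add k3).congr_fderiv ?_
    ext <;> simp
  have hsurj := hG.map_nhds_eq_of_surj (by
    rw [LinearMap.range_eq_top]
    intro w
    obtain ⟨t, ht⟩ : ∃ t : ℝ, t = (-w.re * A₃ - w.im * B₃) / (B₂ * A₃ - B₃ * A₂) := ⟨_, rfl⟩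
    obtain ⟨u, hu⟩ : ∃ u : ℝ, u = (w.re * A₂ + w.im * B₂) / (B₂ * A₃ - B₃ * A₂) := ⟨_, rfl⟩
    rw [eq_div_iff hne] at ht hu
    refine ⟨(t, u), ?_⟩
    apply Complex.ext
    · simp
      refine mul_right_cancel₀ hne ?_
      linear_combination (-B₂) * ht - B₃ * hu
    · simp
      refine mul_right_cancel₀ hne ?_
      linear_combination A₂ * ht + A₃ * hu)
  have hW : {p : ℝ × ℝ | |p.1| < ε ∧ |p.2| < ε} ∈ 𝓝 ((0 : ℝ), (0 : ℝ)) := by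
    have ho : IsOpen ({p : ℝ × ℝ | |p.1| < ε} ∩ {p : ℝ × ℝ | |p.2| < ε}) :=
      (isOpen_lt (by fun_prop) (by fun_prop)).inter (isOpen_lt (by fun_prop) (by fun_prop))
    refine IsOpen.mem_nhds ho ?_
    constructor <;> simpa using hε
  have := Filter.image_mem_map (m := fun p : ℝ × ℝ => D₂ p.1 + D₃ p.2) hW
  rw [hsurj] at this
  simp only [h20, h30, add_zero] at this
  filter_upwards [this]
  rintro w ⟨⟨t, u⟩, ⟨h1, h2⟩, rfl⟩
  exact ⟨t, u, h1, h2, rfl⟩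

namespace HullCurve

variable {g m φ : ℝ → ℝ} {l q r : ℝ}

theorem exists_block (h : HullCurve g m φ l q r) {a b δ : ℝ} (ha : m q < a) (hab : a < b)
    (hb : b < 0) (hδ : 0 < δ) : ∃ ξ y₁ y₂ : ℝ, y₁ < y₂ ∧ ∀ y ∈ Icc y₁ y₂, ∃ η : ℝ → ℝ,
      (∀ x x', |η x - η x'| ≤ δ * |x - x'|) ∧ (∀ x, |η x| ≤ δ) ∧ (∀ x, x ∉ Ioo a b → η x = 0) ∧
      swing (deriv g) m η q = 0 ∧
      ∃ s, m s ∈ Ioo a b ∧ (s : ℂ) + g s * I + swing (deriv g) m η s = ξ + y * I := by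
  have hcd := h.continuous_deriv
  have hcm := h.cont
  have hmq := (abs_le.1 (h.m_le q)).1
  obtain ⟨ρ, hρ⟩ : ∃ ρ, ρ = (b - a) / 8 := ⟨_, rfl⟩
  have hρ0 : 0 < ρ := by linarith
  have hρ1 : ρ ≤ 1 := by linarith
  obtain ⟨A₁, B₁, hA₁, hB₁, hD₁⟩ := h.exists_swing_tent (c := b - ρ) hρ0 hρ1 (by linarith)
    (by linarith)
  obtain ⟨A₂, B₂, hA₂, hB₂, hD₂⟩ := h.exists_swing_tent (c := b - 4 * ρ) hρ0 hρ1 (by linarith)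
    (by linarith)
  obtain ⟨A₃, B₃, hA₃, hB₃, hD₃⟩ := h.exists_swing_tent (c := b - 7 * ρ) hρ0 hρ1 (by linarith)
    (by linarith)
  set b₁ := tent (b - ρ) ρ with hb₁
  set b₂ := tent (b - 4 * ρ) ρ with hb₂
  set b₃ := tent (b - 7 * ρ) ρ with hb₃
  have z₁ : ∀ x, x ≤ b - 2 * ρ ∨ b ≤ x → b₁ x = 0 := fun x hx => tent_eq_zero (by
    rw [le_abs]; rcases hx with hx | hx
    · right; linarith
    · left; linarith)
  have z₂ : ∀ x, x ≤ b - 5 * ρ ∨ b - 3 * ρ ≤ x → b₂ x = 0 := fun x hx => tent_eq_zero (by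
    rw [le_abs]; rcases hx with hx | hx
    · right; linarith
    · left; linarith)
  have z₃ : ∀ x, x ≤ a ∨ b - 6 * ρ ≤ x → b₃ x = 0 := fun x hx => tent_eq_zero (by
    rw [le_abs]; rcases hx with hx | hx
    · right; linarith
    · left; linarith)
  have hmul0 : ∀ b' : ℝ → ℝ, swing (deriv g) m (fun x => 0 * b' x) q = 0 := fun b' => by
    simp [swing]
  have hne : B₂ * A₃ - B₃ * A₂ ≠ 0 := by
    have k2 := (abs_le.1 hB₂).1
    have k3 := (abs_le.1 hB₃).2
    have e2 : (b - 5 * ρ) * A₂ ≤ B₂ := by linarith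
    have e3 : B₃ ≤ (b - 6 * ρ) * A₃ := by linarith
    have f2 := mul_le_mul_of_nonneg_right e2 hA₃.le
    have f3 := mul_le_mul_of_nonneg_right e3 hA₂.le
    have := mul_pos hρ0 (mul_pos hA₂ hA₃)
    nlinarith
  have hsol := image_add_mem_nhds hD₂ hD₃ hne (hmul0 _) (hmul0 _) (ε := δ / 3) (by linarith)
  set D₁ : ℝ → ℂ := fun t => swing (deriv g) m (fun x => t * b₁ x) q with hD₁def
  have hD₁c : Continuous D₁ := by
    have hb₁c : Continuous fun s => b₁ (m s) := (continuous_tent _ _).comp hcm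
    refine intervalIntegral.continuous_parametric_intervalIntegral_of_continuous' ?_ 0 q
    have : Continuous fun p : ℝ × ℝ => b₁ (m p.2) := hb₁c.comp continuous_snd
    have h2 : Continuous fun p : ℝ × ℝ => deriv g p.2 := hcd.comp continuous_snd
    have h3 : Continuous fun p : ℝ × ℝ => p.1 * b₁ (m p.2) := continuous_fst.mul this
    simp only [Function.uncurry_def]
    clear_value b₁
    fun_prop
  have hD₁0 : D₁ 0 = 0 := hmul0 _
  obtain ⟨s₀, hs₀, hms₀⟩ := intermediate_value_Icc' h.q_pos.le h.cont.continuousOn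
    (show b - 5 / 2 * ρ ∈ Icc (m q) (m 0) from ⟨by linarith, by rw [h.m_zero]; linarith⟩)
  set sf : ℝ → ℝ := fun τ => s₀ - (D₁ τ).re with hsf
  have hsf0 : sf 0 = s₀ := by simp [hsf, hD₁0]
  have hsfc : Continuous sf := continuous_const.sub (Complex.continuous_re.comp hD₁c)
  set H : ℝ → ℝ := fun τ => g (sf τ) + (D₁ τ).im with hH
  have hHc : Continuous H := (h.contDiff.continuous.comp hsfc).add (Complex.continuous_im.comp hD₁c)
  have hHd : HasDerivAt H (deriv g s₀ * B₁ + A₁) 0 := by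
    have h1 := hD₁.hasDerivAt
    have hre := (hasDerivAt_re h1).const_sub s₀
    have him := hasDerivAt_im h1
    have hg' : HasDerivAt g (deriv g s₀) (sf 0) := by
      rw [hsf0]; exact (h.contDiff.differentiable one_ne_zero s₀).hasDerivAt
    refine ((hg'.comp 0 hre).add him).congr_deriv ?_
    simp
  have hpos : 0 < deriv g s₀ * B₁ + A₁ := by
    have k1 := abs_le.1 hB₁
    have hBA : |B₁| ≤ A₁ := by
      rw [abs_le]
      constructor <;> nlinarith
    have := (abs_mul (deriv g s₀) B₁).trans_le
      (mul_le_mul (h.deriv_le s₀) hBA (abs_nonneg _) (by norm_num))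
    linarith [(abs_le.1 this).1]
  have hev : ∀ᶠ τ in 𝓝 (0 : ℝ), |τ| < δ / 3 ∧ (∃ t u : ℝ, |t| < δ / 3 ∧ |u| < δ / 3 ∧
      swing (deriv g) m (fun x => t * b₂ x) q + swing (deriv g) m (fun x => u * b₃ x) q = -D₁ τ) ∧
      m (sf τ) ∈ Ioo (b - 3 * ρ) (b - 2 * ρ) := by
    refine ((continuous_abs.continuousAt (x := (0 : ℝ))).eventually
      (gt_mem_nhds (by simpa using hδ))).and (Eventually.and ?_ ?_)
    · have : Tendsto (fun τ => -D₁ τ) (𝓝 0) (𝓝 0) := by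
        have h0 : Tendsto D₁ (𝓝 0) (𝓝 (D₁ 0)) := hD₁c.tendsto 0
        rw [hD₁0] at h0
        simpa only [neg_zero] using h0.neg
      exact this.eventually hsol
    · refine (hcm.comp hsfc).continuousAt.preimage_mem_nhds (Ioo_mem_nhds ?_ ?_)
      · simp only [Function.comp, hsf0, hms₀]; linarith
      · simp only [Function.comp, hsf0, hms₀]; linarith
  obtain ⟨ε, hε, hball⟩ := Metric.eventually_nhds_iff_ball.1 hev
  have hslope := (hasDerivAt_iff_tendsto_slope.1 hHd).eventually (lt_mem_nhds hpos)
  obtain ⟨τ₁, ⟨hτs, hτε⟩, hτ0⟩ := ((hslope.filter_mono (nhdsWithin_mono (0 : ℝ)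
    (show Ioi 0 ⊆ {0}ᶜ from fun z hz => ne_of_gt hz))).and
    (mem_nhdsWithin_of_mem_nhds (ball_mem_nhds (0 : ℝ) hε)) |>.and self_mem_nhdsWithin).exists
  have hτ0 : 0 < τ₁ := hτ0
  have hτε : |τ₁| < ε := by simpa using hτε
  have hH1 : H 0 < H τ₁ := by
    rw [slope_def_field, sub_zero] at hτs
    have := (lt_div_iff₀ hτ0).1 hτs
    linarith
  refine ⟨s₀, H 0, H τ₁, hH1, fun y hy => ?_⟩
  obtain ⟨τ, hτ, rfl⟩ := intermediate_value_Icc hτ0.le hHc.continuousOn hy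
  obtain ⟨hτδ, ⟨t, u, ht, hu, htu⟩, hms⟩ := hball τ (by
    rw [mem_ball, Real.dist_eq, sub_zero, abs_of_nonneg hτ.1]
    rw [abs_of_pos hτ0] at hτε
    linarith [hτ.2])
  have hcont : ∀ (w c : ℝ), Continuous fun x => w * tent c ρ x := fun w c =>
    continuous_const.mul (continuous_tent c ρ)
  set F : Fin 3 → ℝ → ℝ := ![fun x => τ * b₁ x, fun x => t * b₂ x, fun x => u * b₃ x] with hF
  have hFc : ∀ i, Continuous (F i) := by
    intro i
    fin_cases i
    · exact hcont _ _
    · exact hcont _ _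
    · exact hcont _ _
  have hdisj : ∀ i j, i ≠ j → ∀ x, F i x = 0 ∨ F j x = 0 := by
    have d12 : ∀ x, b₁ x = 0 ∨ b₂ x = 0 := fun x => by
      rcases le_total x (b - 2 * ρ) with hx | hx
      · exact Or.inl (z₁ x (Or.inl hx))
      · exact Or.inr (z₂ x (Or.inr (by linarith)))
    have d13 : ∀ x, b₁ x = 0 ∨ b₃ x = 0 := fun x => by
      rcases le_total x (b - 2 * ρ) with hx | hx
      · exact Or.inl (z₁ x (Or.inl hx))
      · exact Or.inr (z₃ x (Or.inr (by linarith)))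
    have d23 : ∀ x, b₂ x = 0 ∨ b₃ x = 0 := fun x => by
      rcases le_total x (b - 5 * ρ) with hx | hx
      · exact Or.inl (z₂ x (Or.inl hx))
      · exact Or.inr (z₃ x (Or.inr (by linarith)))
    intro i j hij x
    have e12 := d12 x
    have e13 := d13 x
    have e23 := d23 x
    fin_cases i <;> fin_cases j <;> simp [hF] at hij ⊢ <;> tauto
  have hsum : (fun x => ∑ i ∈ (Finset.univ : Finset (Fin 3)), F i x) =
      fun x => τ * b₁ x + t * b₂ x + u * b₃ x := by
    ext x
    simp [hF, Fin.sum_univ_three]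
  have hηc : Continuous fun x => τ * b₁ x + t * b₂ x + u * b₃ x :=
    ((hcont _ _).add (hcont _ _)).add (hcont _ _)
  refine ⟨fun x => τ * b₁ x + t * b₂ x + u * b₃ x, fun x x' => ?_, fun x => ?_, fun x hx => ?_, ?_,
    sf τ, ⟨by linarith [hms.1], by linarith [hms.2]⟩, ?_⟩
  · have e1 : ∀ w c, |w| < δ / 3 → |w * tent c ρ x - w * tent c ρ x'| ≤ δ / 3 * |x - x'| :=
      fun w c hw => by
        rw [← mul_sub, abs_mul]
        exact mul_le_mul hw.le (abs_tent_sub_le _ _ _ _) (abs_nonneg _) (by linarith)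
    have k1 := e1 τ (b - ρ) hτδ
    have k2 := e1 t (b - 4 * ρ) ht
    have k3 := e1 u (b - 7 * ρ) hu
    have := (abs_add_three (τ * b₁ x - τ * b₁ x') (t * b₂ x - t * b₂ x') (u * b₃ x - u * b₃ x'))
    calc _ = |(τ * b₁ x - τ * b₁ x') + (t * b₂ x - t * b₂ x') + (u * b₃ x - u * b₃ x')| := by
          congr 1; ring
      _ ≤ δ * |x - x'| := by linarith
  · have e1 : ∀ w c, |w| < δ / 3 → |w * tent c ρ x| ≤ δ / 3 := fun w c hw => by
      rw [abs_mul, abs_of_nonneg (tent_nonneg _ _ _)]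
      calc |w| * tent c ρ x ≤ δ / 3 * 1 :=
            mul_le_mul hw.le ((tent_le hρ0.le _ _).trans hρ1) (tent_nonneg _ _ _) (by linarith)
        _ = δ / 3 := mul_one _
    have := abs_add_three (τ * b₁ x) (t * b₂ x) (u * b₃ x)
    linarith [e1 τ (b - ρ) hτδ, e1 t (b - 4 * ρ) ht, e1 u (b - 7 * ρ) hu]
  · have hx' : x ≤ a ∨ b ≤ x := by
      rcases le_or_gt x a with h1 | h1
      · exact Or.inl h1
      · exact Or.inr (not_lt.1 fun h2 => hx ⟨h1, h2⟩)
    have y1 := z₁ x (hx'.imp (fun h => by linarith) id)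
    have y2 := z₂ x (hx'.imp (fun h => by linarith) fun h => by linarith)
    have y3 := z₃ x (hx'.imp id fun h => by linarith)
    simp only [y1, y2, y3, mul_zero, add_zero]
  · rw [← hsum, swing_sum _ hcd hcm hFc hdisj, Fin.sum_univ_three]
    simp only [hF, Matrix.cons_val_zero, Matrix.cons_val_one, Matrix.cons_val]
    rw [add_assoc, htu]
    simp [hD₁def]
  · have hsI := h.mem_Ioo (s := sf τ) (by linarith [hms.1]) (by linarith [hms.2])
    have e1 : swing (deriv g) m (fun x => τ * b₁ x + t * b₂ x + u * b₃ x) (sf τ) = D₁ τ := by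
      rw [swing_congr (η' := fun x => τ * b₁ x) hsI.1.le]
      · refine swing_eq_of_zero hcd hcm (hcont _ _) hsI.2.le fun v hv => ?_
        have := h.anti hv.1
        simp only [z₁ _ (Or.inl (this.trans hms.2.le)), mul_zero]
      · intro v hv
        have hv' := h.anti hv.2
        simp only [z₂ (m v) (Or.inr (by linarith [hms.1])),
          z₃ (m v) (Or.inr (by linarith [hms.1])), mul_zero, add_zero]
    rw [e1]
    apply Complex.ext <;> simp [hsf, hH]

end HullCurve

end BlockSolve

section Family

open Complex (I)

namespace HullCurve

variable {g m φ : ℝ → ℝ} {l q r : ℝ}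

/-- Turning profiles realizing all heights in a seven dimensional box. -/
theorem exists_family (h : HullCurve g m φ l q r) {δ : ℝ} (hδ : 0 < δ) :
    ∃ ξ y₁ y₂ : Fin 7 → ℝ, (∀ i, y₁ i < y₂ i) ∧ ∀ y : Fin 7 → ℝ,
      (∀ i, y i ∈ Icc (y₁ i) (y₂ i)) → ∃ η : ℝ → ℝ,
        (∀ x x', |η x - η x'| ≤ δ * |x - x'|) ∧ (∀ x, |η x| ≤ δ) ∧
        (∀ x, x ∉ Ioo (m q) 0 → η x = 0) ∧ swing (deriv g) m η q = 0 ∧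
        ∀ i, ∃ s ∈ Ioo 0 q, (s : ℂ) + g s * I + swing (deriv g) m η s = ξ i + y i * I := by
  have hcd := h.continuous_deriv
  have hcm := h.cont
  obtain ⟨w, hw⟩ : ∃ w, w = -m q / 8 := ⟨_, rfl⟩
  have hw0 : 0 < w := by
    have := h.m_neg
    linarith
  have hi7 : ∀ i : Fin 7, (i : ℝ) ≤ 6 := fun i => by
    have : (i : ℕ) ≤ 6 := by omega
    exact_mod_cast this
  have hi0 : ∀ i : Fin 7, (0 : ℝ) ≤ (i : ℝ) := fun i => Nat.cast_nonneg _
  have hlow : ∀ i : Fin 7, m q < -w * (i + 3 / 2) := fun i => by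
    have := mul_le_mul_of_nonneg_left (hi7 i) hw0.le
    linarith
  have hup : ∀ i : Fin 7, -w * ((i : ℝ) + 1) < 0 := fun i => by
    have := mul_nonneg hw0.le (hi0 i)
    linarith
  have hsep : ∀ i j : Fin 7, i < j → -w * ((j : ℝ) + 1) ≤ -w * (i + 3 / 2) := fun i j hij => by
    have : (i : ℝ) + 1 ≤ j := by exact_mod_cast hij
    have := mul_le_mul_of_nonneg_left this hw0.le
    linarith
  choose ξ y₁ y₂ hy H using fun i : Fin 7 => h.exists_block (a := -w * (i + 3 / 2))
    (b := -w * (i + 1)) (δ := δ / 7) (hlow i) (by linarith) (hup i) (by linarith)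
  refine ⟨ξ, y₁, y₂, hy, fun y hyI => ?_⟩
  choose η hlip hle hoff hq s hs hval using fun i => H i (y i) (hyI i)
  have hηc : ∀ i, Continuous (η i) := fun i =>
    (LipschitzWith.of_dist_le_mul (K := (δ / 7).toNNReal) fun x x' => by
      rw [Real.coe_toNNReal _ (by linarith)]
      exact hlip i x x').continuous
  have hsum7 : ∀ c : ℝ, ∑ _i : Fin 7, c = 7 * c := fun c => by simp
  have hdisj' : ∀ i j : Fin 7, i < j → ∀ x, η i x = 0 ∨ η j x = 0 := fun i j hij x => by
    rcases le_or_gt x (-w * (i + 3 / 2)) with hx | hx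
    · exact Or.inl (hoff i x fun hx' => absurd hx'.1 (not_lt.2 hx))
    · exact Or.inr (hoff j x fun hx' => by linarith [hx'.2, hsep i j hij])
  have hdisj : ∀ i j : Fin 7, i ≠ j → ∀ x, η i x = 0 ∨ η j x = 0 := fun i j hij x => by
    rcases lt_or_gt_of_ne hij with h1 | h1
    · exact hdisj' i j h1 x
    · exact (hdisj' j i h1 x).symm
  refine ⟨fun x => ∑ i, η i x, fun x x' => ?_, fun x => ?_, fun x hx => ?_, ?_, fun i => ?_⟩
  · rw [← Finset.sum_sub_distrib]
    refine (Finset.abs_sum_le_sum_abs _ _).trans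
      ((Finset.sum_le_sum fun i _ => hlip i x x').trans ?_)
    rw [hsum7]
    linarith
  · refine (Finset.abs_sum_le_sum_abs _ _).trans ((Finset.sum_le_sum fun i _ => hle i x).trans ?_)
    rw [hsum7]
    linarith
  · exact Finset.sum_eq_zero fun i _ => hoff i x fun hx' =>
      hx ⟨(hlow i).trans hx'.1, hx'.2.trans (hup i)⟩
  · rw [swing_sum _ hcd hcm hηc hdisj]
    exact Finset.sum_eq_zero fun i _ => hq i
  · have hsI := h.mem_Ioo ((hlow i).trans (hs i).1) ((hs i).2.trans (hup i))
    refine ⟨s i, hsI, ?_⟩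
    rw [swing_sum _ hcd hcm hηc hdisj, Finset.sum_eq_single i, hval i]
    · intro j _ hji
      rcases lt_or_gt_of_ne hji with h1 | h1
      · rw [swing_eq_of_zero hcd hcm (hηc j) hsI.2.le, hq j]
        exact fun t ht => hoff j _ fun hx => by
          linarith [hx.1, (hs i).2, h.anti ht.1, hsep j i h1]
      · rw [swing_congr (η' := 0) hsI.1.le, swing_zero]
        exact fun t ht => hoff j _ fun hx => by
          linarith [hx.2, (hs i).1, h.anti ht.2, hsep i j h1]
    · exact fun hne => absurd (Finset.mem_univ i) hne

end HullCurve

end Family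

section Rigid

open Complex (I)

theorem isometryEquiv_apply (J : ℂ ≃ᵢ ℂ) (z : ℂ) :
    J z = J 0 + z.re * (J 1 - J 0) + z.im * (J I - J 0) := by
  have h : ∀ w, J.toRealLinearIsometryEquiv w = J w - J 0 := fun w =>
    IsometryEquiv.toRealLinearIsometryEquiv_apply J w
  have hz : z = z.re • (1 : ℂ) + z.im • I := by
    simp [Complex.re_add_im]
  have := congrArg J.toRealLinearIsometryEquiv hz
  rw [map_add, map_smul, map_smul, h, h, h, Complex.real_smul, Complex.real_smul] at this
  linear_combination this

/-- The position of an affine frame under an isometry. -/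
def frameImage (J : ℂ ≃ᵢ ℂ) : ℂ × ℂ × ℂ := (J 0, J 1, J I)

theorem norm_apply_sub_apply_le (J J' : ℂ ≃ᵢ ℂ) (z : ℂ) :
    ‖J' z - J z‖ ≤ (1 + 4 * ‖z‖) * dist (frameImage J') (frameImage J) := by
  set d := dist (frameImage J') (frameImage J) with hd
  have h0 : ‖J' 0 - J 0‖ ≤ d := by
    rw [hd, Prod.dist_eq, ← dist_eq_norm]; exact le_max_left _ _
  have h1 : ‖J' 1 - J 1‖ ≤ d := by
    rw [hd, Prod.dist_eq, Prod.dist_eq, ← dist_eq_norm]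
    exact (le_max_left _ _).trans (le_max_right _ _)
  have h2 : ‖J' I - J I‖ ≤ d := by
    rw [hd, Prod.dist_eq, Prod.dist_eq, ← dist_eq_norm]
    exact (le_max_right _ _).trans (le_max_right _ _)
  have e1 : ‖(z.re : ℂ) * ((J' 1 - J 1) - (J' 0 - J 0))‖ ≤ ‖z‖ * (2 * d) := by
    rw [norm_mul, Complex.norm_real]
    exact mul_le_mul (Complex.abs_re_le_norm z) ((norm_sub_le _ _).trans (by linarith))
      (norm_nonneg _) (norm_nonneg _)
  have e2 : ‖(z.im : ℂ) * ((J' I - J I) - (J' 0 - J 0))‖ ≤ ‖z‖ * (2 * d) := by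
    rw [norm_mul, Complex.norm_real]
    exact mul_le_mul (Complex.abs_im_le_norm z) ((norm_sub_le _ _).trans (by linarith))
      (norm_nonneg _) (norm_nonneg _)
  have : J' z - J z = (J' 0 - J 0) + (z.re : ℂ) * ((J' 1 - J 1) - (J' 0 - J 0)) +
      (z.im : ℂ) * ((J' I - J I) - (J' 0 - J 0)) := by
    rw [isometryEquiv_apply J z, isometryEquiv_apply J' z]
    ring
  rw [this]
  refine (norm_add₃_le).trans ?_
  linarith

/-- A seven parameter family of sets which sees its parameters cannot consist of congruent sets. -/
theorem exists_not_isometric {U : Set ℂ} {y₁ y₂ : Fin 7 → ℝ} (hlt : ∀ i, y₁ i < y₂ i)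
    {p : (Fin 7 → ℝ) → Fin 7 → ℂ} {V : (Fin 7 → ℝ) → Set ℂ} {C ε R : ℝ} (hC : 0 ≤ C) (hε : 0 < ε)
    (hp : ∀ y ∈ Icc y₁ y₂, ∀ i, ‖p y i‖ ≤ R) (hmem : ∀ y ∈ Icc y₁ y₂, ∀ i, p y i ∈ frontier (V y))
    (hloc : ∀ y ∈ Icc y₁ y₂, ∀ y' ∈ Icc y₁ y₂, ∀ i, ∀ z ∈ frontier (V y'), ‖z - p y i‖ < ε →
      |y' i - y i| ≤ C * ‖z - p y i‖) :
    ∃ y ∈ Icc y₁ y₂, ¬∃ J : ℂ ≃ᵢ ℂ, J '' U = V y := by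
  by_contra! hcon
  choose! J hJ using hcon
  have hlt' : y₁ ≤ y₂ := fun i => (hlt i).le
  have hR : 0 ≤ R := (norm_nonneg _).trans (hp y₁ (left_mem_Icc.2 hlt') 0)
  have hfr : ∀ K : ℂ ≃ᵢ ℂ, frontier (K '' U) = K '' frontier U := fun K =>
    (K.toHomeomorph.image_frontier U).symm
  have key : ∀ y ∈ Icc y₁ y₂, ∀ y' ∈ Icc y₁ y₂,
      (1 + 4 * (R + ‖J y 0‖)) * dist (frameImage (J y')) (frameImage (J y)) < ε →
      dist y' y ≤ C * ((1 + 4 * (R + ‖J y 0‖)) * dist (frameImage (J y')) (frameImage (J y))) := by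
    intro y hy y' hy' hd
    refine (dist_pi_le_iff (by positivity)).2 fun i => ?_
    obtain ⟨z, hz⟩ := (J y).surjective (p y i)
    have hzf : z ∈ frontier U := by
      have := hmem y hy i
      rw [← hJ y hy, ← hz] at this
      rwa [hfr, (J y).injective.mem_set_image] at this
    have hz' : J y' z ∈ frontier (V y') := by
      rw [← hJ y' hy', hfr]
      exact mem_image_of_mem _ hzf
    have hzn : ‖z‖ ≤ R + ‖J y 0‖ := by
      have : ‖z‖ = ‖p y i - J y 0‖ := by
        rw [← hz, ← dist_eq_norm, (J y).dist_eq, dist_zero_right]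
      rw [this]
      exact (norm_sub_le _ _).trans (add_le_add_left (hp y hy i) _)
    have hmove : ‖J y' z - p y i‖ ≤
        (1 + 4 * (R + ‖J y 0‖)) * dist (frameImage (J y')) (frameImage (J y)) := by
      rw [← hz]
      refine (norm_apply_sub_apply_le _ _ z).trans (mul_le_mul_of_nonneg_right ?_ dist_nonneg)
      linarith
    exact (hloc y hy y' hy' i _ hz' (hmove.trans_lt hd)).trans (mul_le_mul_of_nonneg_left hmove hC)
  set F : (Fin 7 → ℝ) → ℂ × ℂ × ℂ := fun y => frameImage (J y) with hF
  have hinj : InjOn F (Icc y₁ y₂) := by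
    intro y hy y' hy' hyy
    have h0 : dist (frameImage (J y)) (frameImage (J y')) = 0 := by
      rw [show frameImage (J y) = frameImage (J y') from hyy, dist_self]
    have := key y' hy' y hy (by rw [h0, mul_zero]; exact hε)
    rw [h0, mul_zero, mul_zero] at this
    exact dist_le_zero.1 this
  set G := Function.invFunOn F (Icc y₁ y₂) with hG
  have hGF : ∀ y ∈ Icc y₁ y₂, G (F y) = y := fun y hy => hinj.leftInvOn_invFunOn hy
  have hdim := dimH_image_le_of_locally_lipschitzOn (f := G) (s := F '' Icc y₁ y₂) (by
    rintro _ ⟨y, hy, rfl⟩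
    obtain ⟨M, hM⟩ : ∃ M, M = 1 + 4 * (R + (‖J y 0‖ + 1)) := ⟨_, rfl⟩
    have hM1 : 1 ≤ M := by have := norm_nonneg (J y 0); linarith
    have hr : 0 < min 1 (ε / (2 * M)) := lt_min one_pos (by positivity)
    refine ⟨(C * M).toNNReal, ball (F y) (min 1 (ε / (2 * M))) ∩ F '' Icc y₁ y₂,
      inter_mem (mem_nhdsWithin_of_mem_nhds (ball_mem_nhds _ hr)) self_mem_nhdsWithin, ?_⟩
    refine LipschitzOnWith.of_dist_le_mul ?_
    rintro _ ⟨ha, ⟨a, haI, rfl⟩⟩ _ ⟨hb, ⟨b, hbI, rfl⟩⟩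
    rw [hGF a haI, hGF b hbI, Real.coe_toNNReal _ (by positivity)]
    have hb0 : ‖J b 0‖ ≤ ‖J y 0‖ + 1 := by
      have h1 : dist (J b 0) (J y 0) ≤ dist (F b) (F y) := by
        rw [hF, Prod.dist_eq]; exact le_max_left _ _
      have h2 := (mem_ball.1 hb).trans_le (min_le_left _ _)
      have h3 := norm_sub_norm_le (J b 0) (J y 0)
      rw [dist_eq_norm] at h1
      linarith
    have hbM : 1 + 4 * (R + ‖J b 0‖) ≤ M := by linarith
    have hab : dist (F a) (F b) < ε / M := by
      have h1 := (mem_ball.1 ha).trans_le (min_le_right _ _)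
      have h2 := (mem_ball'.1 hb).trans_le (min_le_right _ _)
      have h3 := dist_triangle (F a) (F y) (F b)
      have h4 : ε / (2 * M) + ε / (2 * M) = ε / M := by
        field_simp
        ring
      linarith
    have h5 : (1 + 4 * (R + ‖J b 0‖)) * dist (F a) (F b) ≤ M * dist (F a) (F b) :=
      mul_le_mul_of_nonneg_right hbM dist_nonneg
    have h6 := (lt_div_iff₀' (by linarith : 0 < M)).1 hab
    refine (key b hbI a haI (h5.trans_lt h6)).trans ?_
    rw [mul_assoc]
    exact mul_le_mul_of_nonneg_left h5 hC)
  have himg : G '' (F '' Icc y₁ y₂) = Icc y₁ y₂ := by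
    rw [image_image]
    exact (image_congr hGF).trans (image_id _)
  rw [himg, Real.dimH_of_nonempty_interior] at hdim
  · have h6 := hdim.trans (dimH_mono (subset_univ _))
    rw [Real.dimH_univ_eq_finrank, Module.finrank_prod, Module.finrank_prod,
      Complex.finrank_real_complex, Module.finrank_fin_fun] at h6
    norm_num at h6
  · rw [← pi_univ_Icc, interior_pi_set finite_univ]
    refine ⟨fun i => (y₁ i + y₂ i) / 2, fun i _ => ?_⟩
    change _ ∈ interior (Icc (y₁ i) (y₂ i))
    rw [interior_Icc]
    constructor <;> linarith [hlt i]

end Rigid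

section HullFamily

open Complex (I)

theorem frontier_iff_of_graph {U B : Set ℂ} {g : ℝ → ℝ} (hg : Continuous g) (hB : IsOpen B)
    (h : ∀ z ∈ B, (z ∈ U ↔ g z.re < z.im)) {z : ℂ} (hz : z ∈ B) :
    z ∈ frontier U ↔ z.im = g z.re := by
  have hgc : Continuous fun w : ℂ => g w.re := hg.comp Complex.continuous_re
  rw [mem_frontier_iff_of_eventually (B := {w : ℂ | g w.re < w.im})
    (by filter_upwards [hB.mem_nhds hz] with w hw using h w hw)]
  constructor
  · exact fun hf => (frontier_lt_subset_eq hgc Complex.continuous_im hf).symm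
  · intro heq
    refine ⟨?_, fun hi => (interior_subset hi).ne heq.symm⟩
    have ht : Tendsto (fun t : ℝ => z + t * I) (𝓝[>] 0) (𝓝 z) := by
      have : Continuous fun t : ℝ => z + t * I := by fun_prop
      have := this.tendsto 0
      rw [Complex.ofReal_zero, zero_mul, add_zero] at this
      exact this.mono_left nhdsWithin_le_nhds
    refine mem_closure_of_tendsto ht ?_
    filter_upwards [self_mem_nhdsWithin] with t ht
    have ht : 0 < t := ht
    simpa [heq] using ht

/-- The graph of `g` with its velocity turned by the angle `η (m s)`. -/
def bent (g m η : ℝ → ℝ) (s : ℝ) : ℂ := (s : ℂ) + g s * I + swing (deriv g) m η s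

namespace HullCurve

variable {g m φ η : ℝ → ℝ} {l q r δ : ℝ}

theorem bentCurve_graph (h : HullCurve g m φ l q r) :
    BentCurve (deriv g) (fun _ => 1) (fun s => (s : ℂ) + g s * I) where
  contk := h.continuous_deriv
  contζ := continuous_const
  k_le := h.deriv_le
  norm_ζ s := norm_one
  ζ_near s := by simp
  hasDeriv s := by
    have h1 := (h.contDiff.differentiable one_ne_zero s).hasDerivAt.ofReal_comp
    have h2 := (hasDerivAt_id s).ofReal_comp
    exact (h2.add (h1.mul_const I)).congr_deriv (by simp)

theorem graphFn_graph (h : HullCurve g m φ l q r) (x : ℝ) :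
    graphFn (fun s => (s : ℂ) + g s * I) x = g x := by
  simpa using h.bentCurve_graph.graphFn_re x

theorem bending_one (h : HullCurve g m φ l q r) : Bending l r m φ (fun _ => 1) where
  loc _ _ _ _ _ _ := rfl
  cross s _ u _ hsu := by
    have := turned_cross_nonpos (α := 0) (α' := 0) (h.m_le s) (h.m_le u)
      (by have := h.anti hsu; simp; linarith)
    simpa using this

theorem bentCurve_bent (h : HullCurve g m φ l q r) (hη : Continuous η) (h8 : ∀ x, |η x| ≤ 1 / 8) :
    BentCurve (deriv g) (fun s => Complex.exp (I * η (m s))) (bent g m η) where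
  contk := h.continuous_deriv
  contζ := by
    have : Continuous fun s => η (m s) := hη.comp h.cont
    exact Complex.continuous_exp.comp (continuous_const.mul (Complex.continuous_ofReal.comp this))
  k_le := h.deriv_le
  norm_ζ s := Complex.norm_exp_I_mul_ofReal _
  ζ_near s := Real.norm_exp_I_mul_ofReal_sub_one_le.trans (h8 _)
  hasDeriv s := by
    have hc := continuous_swing_integrand h.continuous_deriv h.cont hη
    exact ((h.bentCurve_graph.hasDeriv s).add
      (hc.integral_hasStrictDerivAt 0 s).hasDerivAt).congr_deriv (by ring)

theorem bending_bent (h : HullCurve g m φ l q r) (hlip : ∀ x x', |η x - η x'| ≤ 1 / 4 * |x - x'|) :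
    Bending l r m φ (fun s => Complex.exp (I * η (m s))) where
  loc s hs u hu hsu hφ := by simp only [h.gap s hs u hu hsu hφ]
  cross s _ u _ hsu := turned_cross_nonpos (h.m_le s) (h.m_le u) (by
    have h1 := hlip (m u) (m s)
    rw [abs_sub_comm (m u), abs_of_nonneg (sub_nonneg.2 (h.anti hsu))] at h1
    linarith)

theorem swing_eq_zero (h : HullCurve g m φ l q r) (hη : Continuous η)
    (hoff : ∀ x, x ∉ Ioo (m q) 0 → η x = 0) (hq : swing (deriv g) m η q = 0) {s : ℝ}
    (hs : s ∉ Ioo 0 q) : swing (deriv g) m η s = 0 := by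
  rcases le_or_gt s 0 with h0 | h0
  · rw [swing_eq_of_zero h.continuous_deriv h.cont hη h0]
    · simp [swing]
    · intro t ht
      refine hoff _ fun hx => ?_
      have := h.anti ht.2
      rw [h.m_zero] at this
      linarith [hx.2]
  · have hqs : q ≤ s := not_lt.1 fun hlt => hs ⟨h0, hlt⟩
    rw [← swing_eq_of_zero h.continuous_deriv h.cont hη hqs, hq]
    exact fun t ht => hoff _ fun hx => by linarith [h.anti ht.1, hx.1]

theorem norm_swing_le (h : HullCurve g m φ l q r) (hη : Continuous η)
    (hoff : ∀ x, x ∉ Ioo (m q) 0 → η x = 0) (hq : swing (deriv g) m η q = 0)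
    (hle : ∀ x, |η x| ≤ δ) (s : ℝ) : ‖swing (deriv g) m η s‖ ≤ 2 * δ * q := by
  have hδ : 0 ≤ δ := (abs_nonneg _).trans (hle 0)
  by_cases hs : s ∈ Ioo 0 q
  · have := intervalIntegral.norm_integral_le_of_norm_le_const (a := 0) (b := s) (C := 2 * δ)
      (f := fun t => (Complex.exp (I * η (m t)) - 1) * (1 + deriv g t * I)) (fun t _ => by
        rw [norm_mul, mul_comm]
        refine mul_le_mul ?_ (Real.norm_exp_I_mul_ofReal_sub_one_le.trans (hle _)) (norm_nonneg _)
          zero_le_two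
        refine (norm_add_le _ _).trans ?_
        rw [norm_one, norm_mul, Complex.norm_I, Complex.norm_real, Real.norm_eq_abs]
        linarith [h.deriv_le t])
    rw [sub_zero, abs_of_pos hs.1] at this
    exact this.trans (mul_le_mul_of_nonneg_left hs.2.le (by linarith))
  · rw [h.swing_eq_zero hη hoff hq hs, norm_zero]
    have := h.q_pos
    positivity

theorem abs_graphFn_bent_sub_le (h : HullCurve g m φ l q r) (hη : Continuous η)
    (h8 : ∀ x, |η x| ≤ 1 / 8) (hoff : ∀ x, x ∉ Ioo (m q) 0 → η x = 0)
    (hq : swing (deriv g) m η q = 0) (hle : ∀ x, |η x| ≤ δ) (x : ℝ) :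
    |graphFn (bent g m η) x - g x| ≤ 4 * δ * q := by
  have hc := h.bentCurve_bent hη h8
  obtain ⟨s, hs⟩ := hc.re_surjective x
  have hs : (bent g m η s).re = x := hs
  have hw := h.norm_swing_le hη hoff hq hle s
  have e1 := (Complex.abs_re_le_norm _).trans hw
  have e2 := (Complex.abs_im_le_norm _).trans hw
  have e3 := h.bentCurve_graph.abs_graphFn_sub_le s x
  rw [h.graphFn_graph, h.graphFn_graph] at e3
  have e4 : x = s + (swing (deriv g) m η s).re := by rw [← hs]; simp [bent]
  rw [show s - x = -(swing (deriv g) m η s).re by linarith, abs_neg] at e3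
  have e5 : graphFn (bent g m η) x = g s + (swing (deriv g) m η s).im := by
    rw [← hs, hc.graphFn_re]; simp [bent]
  rw [e5]
  have := abs_add_le (g s - g x) (swing (deriv g) m η s).im
  rw [show g s + (swing (deriv g) m η s).im - g x = g s - g x + (swing (deriv g) m η s).im by ring]
  linarith [abs_nonneg (swing (deriv g) m η s).re]

theorem graphFn_bent_eq (h : HullCurve g m φ l q r) (hη : Continuous η)
    (h8 : ∀ x, |η x| ≤ 1 / 8) (hoff : ∀ x, x ∉ Ioo (m q) 0 → η x = 0)
    (hq : swing (deriv g) m η q = 0) {x : ℝ} (hx : x ∉ Ioo 0 q) :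
    graphFn (bent g m η) x = g x := by
  have := (h.bentCurve_bent hη h8).graphFn_re x
  simpa [bent, h.swing_eq_zero hη hoff hq hx] using this

theorem bent_re_mem (h : HullCurve g m φ l q r) (hη : Continuous η)
    (h8 : ∀ x, |η x| ≤ 1 / 8) (hoff : ∀ x, x ∉ Ioo (m q) 0 → η x = 0)
    (hq : swing (deriv g) m η q = 0) {s : ℝ} (hs : s ∈ Ioo 0 q) :
    (bent g m η s).re ∈ Ioo 0 q := by
  have hc := h.bentCurve_bent hη h8
  have h0 := hc.re_strictMono hs.1
  have h1 := hc.re_strictMono hs.2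
  simp only [bent, hq, h.swing_eq_zero hη hoff hq (s := 0) (by simp)] at h0 h1
  constructor
  · simpa [bent] using h0
  · simpa [bent] using h1

/-- The domain obtained by turning the boundary arc. -/
theorem exists_bentDomain (h : HullCurve g m φ l q r) {U : Set ℂ} (hU : C1Domain U) {a b τ M : ℝ}
    (ha : a < 0) (hb : q < b) (hτ : 0 < τ) (hgτ : ∀ x ∈ Icc 0 q, |g x| ≤ τ / 2)
    (habove : ∀ z : ℂ, a < z.re → z.re < b → |z.im| < τ → (z ∈ U ↔ g z.re < z.im))
    {χ : ℝ → ℝ} (hχ : ContDiff ℝ 1 χ) (hχb : ∀ y, |χ y| ≤ 1) (hχ1 : ∀ y, |y| ≤ 5 * τ / 8 → χ y = 1)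
    (hχ0 : ∀ y, 6 * τ / 8 ≤ |y| → χ y = 0) (hχM : ∀ y, |deriv χ y| ≤ M) (hδτ : 4 * δ * q ≤ τ / 8)
    (hδM : M * (4 * δ * q) < 1) (hδ8 : δ ≤ 1 / 8)
    (hlip : ∀ x x', |η x - η x'| ≤ δ * |x - x'|) (hle : ∀ x, |η x| ≤ δ)
    (hoff : ∀ x, x ∉ Ioo (m q) 0 → η x = 0) (hq : swing (deriv g) m η q = 0) :
    ∃ V, C1Domain V ∧ (∃ f, BdryLocalIsometry U V f) ∧
      ∀ z : ℂ, a < z.re → z.re < b → |z.im| < τ →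
        (z ∈ frontier V ↔ z.im = graphFn (bent g m η) z.re) := by
  have hη : Continuous η := (LipschitzWith.of_dist_le_mul (K := δ.toNNReal) fun x x' => by
      rw [Real.coe_toNNReal _ ((abs_nonneg _).trans (hle 0))]
      exact hlip x x').continuous
  have h8 : ∀ x, |η x| ≤ 1 / 8 := fun x => (hle x).trans hδ8
  have hlip4 : ∀ x x', |η x - η x'| ≤ 1 / 4 * |x - x'| := fun x x' =>
    (hlip x x').trans (mul_le_mul_of_nonneg_right (by linarith) (abs_nonneg _))
  have hc' := h.bentCurve_bent hη h8
  have hc := h.bentCurve_graph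
  have hqp := h.q_pos
  set c' := bent g m η
  set u : ℝ → ℝ := fun x => graphFn c' x - g x with hu
  have huc : ContDiff ℝ 1 u := hc'.contDiff_graphFn.sub h.contDiff
  have huD : ∀ x, |u x| ≤ 4 * δ * q := h.abs_graphFn_bent_sub_le hη h8 hoff hq hle
  have hu0 : ∀ x, x ∉ Ioo 0 q → u x = 0 := fun x hx => by
    rw [hu]
    simp only
    rw [h.graphFn_bent_eq hη h8 hoff hq hx, sub_self]
  have hpos : ∀ x y, 0 < 1 + deriv χ y * u x := fun x y => by
    have : |deriv χ y * u x| ≤ M * (4 * δ * q) := by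
      rw [abs_mul]
      exact mul_le_mul (hχM y) (huD x) (abs_nonneg _) ((abs_nonneg _).trans (hχM y))
    linarith [(abs_le.1 this).1]
  have hsmall : ∀ x y, |χ y * u x| ≤ τ / 8 := fun x y => by
    rw [abs_mul]
    calc |χ y| * |u x| ≤ 1 * (τ / 8) :=
          mul_le_mul (hχb y) ((huD x).trans hδτ) (abs_nonneg _) zero_le_one
      _ = τ / 8 := one_mul _
  have hbox : ∀ (t : ℝ) (z : ℂ), 7 * τ / 8 ≤ t → (|z.im + χ z.im * u z.re| ≤ t ↔ |z.im| ≤ t) ∧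
      (|z.im + χ z.im * u z.re| < t ↔ |z.im| < t) := fun t z ht => by
    rcases le_or_gt (6 * τ / 8) |z.im| with hz | hz
    · rw [hχ0 _ hz, zero_mul, add_zero]
      exact ⟨Iff.rfl, Iff.rfl⟩
    · have h1 := abs_add_le z.im (χ z.im * u z.re)
      have h2 := hsmall z.re z.im
      exact ⟨⟨fun _ => by linarith, fun _ => by linarith⟩,
        ⟨fun _ => by linarith, fun _ => by linarith⟩⟩
  set B : Set ℂ := {z | (a < z.re ∧ z.re < b) ∧ |z.im| < τ} with hBdef
  have hB : IsOpen B := ((isOpen_lt continuous_const Complex.continuous_re).inter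
    (isOpen_lt Complex.continuous_re continuous_const)).inter
    (isOpen_lt (continuous_abs.comp Complex.continuous_im) continuous_const)
  set K : Set ℂ := {z | (0 ≤ z.re ∧ z.re ≤ q) ∧ |z.im| ≤ 7 * τ / 8} with hKdef
  have hK : IsClosed K := ((isClosed_le continuous_const Complex.continuous_re).inter
    (isClosed_le Complex.continuous_re continuous_const)).inter
    (isClosed_le (continuous_abs.comp Complex.continuous_im) continuous_const)
  have hUB : ∀ z ∈ B, (z ∈ U ↔ g z.re < z.im) := fun z hz => habove z hz.1.1 hz.1.2 hz.2
  have hBs : ∀ z, shear χ u z ∈ B ↔ z ∈ B := fun z => by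
    simp only [hBdef, mem_ofPred_eq, shear_re, shear_im, (hbox τ z (by linarith)).2]
  have hcB : ∀ s ∈ Icc 0 q, ((s : ℂ) + g s * I) ∈ B := fun s hs => by
    have := hgτ s hs
    refine ⟨by simp; constructor <;> linarith [hs.1, hs.2], ?_⟩
    simp
    linarith
  have hχB : ∀ x, g x + χ (g x) * u x = graphFn c' x := fun x => by
    by_cases hx : x ∈ Ioo 0 q
    · rw [hχ1 _ (by linarith [hgτ x (Ioo_subset_Icc_self hx)])]
      simp [hu]
    · have := hu0 x hx
      rw [this]
      simp only [hu] at this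
      linarith
  have hmove : WindowMove U (shear χ u '' U) K B (Icc 0 q) (deriv g) (fun _ => 1)
      (fun s => (s : ℂ) + g s * I) (fun s => Complex.exp (I * η (m s))) c' := by
    refine windowMove_of_shear hc hc' hχ huc hpos hχb hU hB hK hBs ?_ ?_ ?_ ?_ ?_ hcB ?_ ?_
    · intro z
      simp only [hKdef, mem_ofPred_eq, shear_re, shear_im, (hbox _ z le_rfl).1]
    · intro z hz
      have : χ z.im * u z.re = 0 := by
        by_cases hx : z.re ∈ Ioo 0 q
        · have : ¬ |z.im| ≤ 7 * τ / 8 := fun hle => hz ⟨⟨hx.1.le, hx.2.le⟩, hle⟩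
          rw [hχ0 _ (by linarith), zero_mul]
        · rw [hu0 _ hx, mul_zero]
      simp [shear, this]
    · intro z hz
      rw [hUB z hz, h.graphFn_graph]
    · intro z _
      rw [h.graphFn_graph, hχB]
    · ext z
      constructor
      · rintro ⟨h1, h2⟩
        rw [frontier_iff_of_graph h.contDiff.continuous hB hUB
          ⟨⟨by linarith [h1.1.1], by linarith [h1.1.2]⟩, by linarith [h1.2]⟩] at h2
        exact ⟨z.re, h1.1, by apply Complex.ext <;> simp [h2]⟩
      · rintro ⟨s, hs, rfl⟩
        have := hgτ s hs
        refine ⟨⟨by simpa using hs, by simp; linarith⟩, ?_⟩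
        rw [frontier_iff_of_graph h.contDiff.continuous hB hUB (hcB s hs)]
        simp
    · intro s hs
      have : s ∉ Ioo 0 q := fun h' => hs (Ioo_subset_Icc_self h')
      simp only [c', bent, h.swing_eq_zero hη hoff hq this, add_zero]
    · intro s hs
      exact ⟨l, r, m, φ, ⟨h.l_neg.trans_le hs.1, hs.2.trans_lt h.q_lt⟩, h.hull, h.bending_one,
        h.bending_bent hlip4⟩
  obtain ⟨hV, hfr⟩ := c1Domain_shear hχ huc hχb hpos hU
  refine ⟨_, hV, ⟨_, hmove.bdryLocalIsometry hU.1 hU.2.2 hV.1⟩, fun z h1 h2 h3 => ?_⟩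
  have hbij := shear_bijective (h := u) hχ hχb hpos
  obtain ⟨w, rfl⟩ := hbij.2 z
  have hwB : w ∈ B := (hBs w).1 ⟨⟨h1, h2⟩, h3⟩
  rw [hfr, hbij.1.mem_set_image, frontier_iff_of_graph h.contDiff.continuous hB hUB hwB, shear_re,
    ← hχB]
  constructor
  · intro heq
    rw [shear_im, heq]
  · intro heq
    have : shear χ u w = shear χ u ((w.re : ℂ) + g w.re * I) := by
      apply Complex.ext
      · simp
      · rw [heq]; simp
    have := congrArg Complex.im (hbij.1 this)
    simpa using this

theorem notDetermined (h : HullCurve g m φ l q r) {U : Set ℂ} (hU : C1Domain U) {a b τ : ℝ}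
    (ha : a < 0) (hb : q < b) (hτ : 0 < τ) (hgτ : ∀ x ∈ Icc 0 q, |g x| ≤ τ / 2)
    (habove : ∀ z : ℂ, a < z.re → z.re < b → |z.im| < τ → (z ∈ U ↔ g z.re < z.im)) :
    NotDetermined U := by
  have hqp := h.q_pos
  let χ : ContDiffBump (0 : ℝ) := ⟨5 * τ / 8, 6 * τ / 8, by linarith, by linarith⟩
  have hχ : ContDiff ℝ 1 χ := χ.contDiff
  obtain ⟨M, hM⟩ := χ.hasCompactSupport.deriv.exists_bound_of_continuous
    (hχ.continuous_deriv le_rfl)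
  have hM0 : 0 ≤ M := (norm_nonneg _).trans (hM 0)
  obtain ⟨D, hD⟩ : ∃ D, D = min (τ / 8) (1 / (M + 1)) := ⟨_, rfl⟩
  have hD0 : 0 < D := by rw [hD]; exact lt_min (by linarith) (by positivity)
  obtain ⟨δ, hδ⟩ : ∃ δ, δ = min (1 / 8) (D / (4 * q)) := ⟨_, rfl⟩
  have hδ0 : 0 < δ := by rw [hδ]; exact lt_min (by norm_num) (by positivity)
  have hδD : 4 * δ * q ≤ D := by
    have : δ ≤ D / (4 * q) := hδ ▸ min_le_right _ _
    rw [le_div_iff₀ (by linarith)] at this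
    linarith
  have hδτ : 4 * δ * q ≤ τ / 8 := hδD.trans (hD ▸ min_le_left _ _)
  have hδM : M * (4 * δ * q) < 1 := by
    have h1 : D ≤ 1 / (M + 1) := hD ▸ min_le_right _ _
    rw [le_div_iff₀ (by linarith)] at h1
    have := mul_le_mul_of_nonneg_left hδD hM0
    nlinarith
  have hδ8 : δ ≤ 1 / 8 := hδ ▸ min_le_left _ _
  obtain ⟨ξ, y₁, y₂, hlt, hfam⟩ := h.exists_family hδ0
  have hmemI : ∀ y ∈ Icc y₁ y₂, ∀ i, y i ∈ Icc (y₁ i) (y₂ i) := fun y hy i => ⟨hy.1 i, hy.2 i⟩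
  choose! η hlip hle hoff hq hval using fun (y : Fin 7 → ℝ) (hy : y ∈ Icc y₁ y₂) =>
    hfam y (hmemI y hy)
  have hη : ∀ y ∈ Icc y₁ y₂, Continuous (η y) := fun y hy =>
    (LipschitzWith.of_dist_le_mul (K := δ.toNNReal) fun x x' => by
      rw [Real.coe_toNNReal _ hδ0.le]
      exact hlip y hy x x').continuous
  have h8 : ∀ y ∈ Icc y₁ y₂, ∀ x, |η y x| ≤ 1 / 8 := fun y hy x => (hle y hy x).trans hδ8
  choose! V hV hf hfr using fun (y : Fin 7 → ℝ) (hy : y ∈ Icc y₁ y₂) =>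
    h.exists_bentDomain hU ha hb hτ hgτ habove hχ
      (fun x => abs_le.2 ⟨by linarith [χ.nonneg' x], χ.le_one⟩)
      (fun x hx => χ.one_of_mem_closedBall (by simpa using hx))
      (fun x hx => χ.zero_of_le_dist (by simpa using hx)) hM hδτ hδM hδ8 (hlip y hy) (hle y hy)
      (hoff y hy) (hq y hy)
  have hpt : ∀ y ∈ Icc y₁ y₂, ∀ i, ξ i ∈ Ioo 0 q ∧ y i = graphFn (bent g m (η y)) (ξ i) ∧
      |y i| ≤ 5 * τ / 8 := by
    intro y hy i
    obtain ⟨s, hs, hval⟩ := hval y hy i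
    have hval : bent g m (η y) s = ξ i + y i * I := hval
    have hre : (bent g m (η y) s).re = ξ i := by rw [hval]; simp
    have him : (bent g m (η y) s).im = y i := by rw [hval]; simp
    have h1 := h.bent_re_mem (hη y hy) (h8 y hy) (hoff y hy) (hq y hy) hs
    have h2 := (h.bentCurve_bent (hη y hy) (h8 y hy)).graphFn_re s
    rw [hre] at h1 h2
    rw [him] at h2
    refine ⟨h1, h2.symm, ?_⟩
    have h3 := h.abs_graphFn_bent_sub_le (hη y hy) (h8 y hy) (hoff y hy) (hq y hy) (hle y hy) (ξ i)
    rw [h2] at h3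
    have h4 := hgτ _ (Ioo_subset_Icc_self h1)
    have h5 := abs_sub_abs_le_abs_sub (y i) (g (ξ i))
    linarith
  obtain ⟨ε, hε⟩ : ∃ ε, ε = min (min (-a) (b - q)) (τ / 4) := ⟨_, rfl⟩
  have hε0 : 0 < ε := by
    rw [hε]
    exact lt_min (lt_min (by linarith) (by linarith)) (by linarith)
  have hεa : ε ≤ -a := hε ▸ (min_le_left _ _).trans (min_le_left _ _)
  have hεb : ε ≤ b - q := hε ▸ (min_le_left _ _).trans (min_le_right _ _)
  have hετ : ε ≤ τ / 4 := hε ▸ min_le_right _ _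
  obtain ⟨y, hy, hJ⟩ := exists_not_isometric (U := U) hlt (p := fun y i => (ξ i : ℂ) + y i * I)
    (V := V) (C := 2) (ε := ε) (R := q + τ) zero_le_two hε0 (fun y hy i => by
      obtain ⟨h1, -, h3⟩ := hpt y hy i
      refine (norm_add_le _ _).trans ?_
      rw [norm_mul, Complex.norm_I, Complex.norm_real, Complex.norm_real, Real.norm_eq_abs,
        Real.norm_eq_abs, abs_of_pos h1.1]
      linarith [h1.2]) (fun y hy i => by
      obtain ⟨h1, h2, h3⟩ := hpt y hy i
      refine (hfr y hy _ ?_ ?_ ?_).2 ?_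
      · simp; linarith [h1.1]
      · simp; linarith [h1.2]
      · simp; linarith
      · simpa using h2) (fun y hy y' hy' i z hz hzp => by
      obtain ⟨h1, -, h3⟩ := hpt y hy i
      obtain ⟨-, h2, -⟩ := hpt y' hy' i
      have e1 := Complex.abs_re_le_norm (z - (ξ i + y i * I))
      have e2 := Complex.abs_im_le_norm (z - (ξ i + y i * I))
      simp only [Complex.sub_re, Complex.sub_im, Complex.add_re, Complex.add_im, Complex.ofReal_re,
        Complex.ofReal_im, Complex.re_ofReal_mul, Complex.im_ofReal_mul, Complex.I_re,
        Complex.I_im, mul_zero, mul_one, add_zero, zero_add] at e1 e2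
      have f1 := abs_le.1 (e1.trans hzp.le)
      have f3 := abs_lt.1 (e1.trans_lt hzp)
      have f2 := e2.trans_lt hzp
      have f4 := abs_sub_abs_le_abs_sub z.im (y i)
      have hz' := (hfr y' hy' z (by linarith [h1.1]) (by linarith [h1.2]) (by linarith)).1 hz
      have hs := (h.bentCurve_bent (hη y' hy') (h8 y' hy')).abs_graphFn_sub_le (ξ i) z.re
      rw [← hz', ← h2, abs_sub_comm (ξ i)] at hs
      have := abs_sub_le (y' i) z.im (y i)
      linarith [abs_nonneg (z.re - ξ i)])
  exact ⟨V y, hV y hy, hf y hy, hJ⟩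

end HullCurve

end HullFamily

section LocalGraph

open Complex (I)

theorem ContDiffAt.continuousAt_deriv_of_one {f : ℝ → ℝ} {x : ℝ} (h : ContDiffAt ℝ 1 f x) :
    ContinuousAt (deriv f) x := by
  have h1 := (h.fderiv_right (m := 0) (by norm_num)).continuousAt
  have : deriv f = fun y => fderiv ℝ f y 1 := funext fun y => (fderiv_apply_one_eq_deriv).symm
  rw [this]
  exact h1.clm_apply continuousAt_const

/-- A function which is `C¹` and flat at `0` agrees near `0` with a global `C¹` function of
small slope. -/
theorem exists_contDiff_extension {f : ℝ → ℝ} (h : ContDiffAt ℝ 1 f 0) (h0 : f 0 = 0)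
    (hd : deriv f 0 = 0) :
    ∃ g : ℝ → ℝ, ContDiff ℝ 1 g ∧ (∀ s, |deriv g s| ≤ 1 / 2) ∧ ∀ᶠ x in 𝓝 0, g x = f x := by
  have hs : ∀ᶠ y in 𝓝 0, |deriv f y| < 1 / 2 := by
    have := h.continuousAt_deriv_of_one.abs
    exact this.eventually_lt continuousAt_const (by simp [hd])
  obtain ⟨ε, hε, hball⟩ := Metric.nhds_basis_closedBall.eventually_iff.1
    ((h.eventually (by simp)).and hs)
  have hmem : ∀ t : ℝ, max (-ε) (min ε t) ∈ closedBall (0 : ℝ) ε := fun t => by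
    rw [mem_closedBall, Real.dist_eq, sub_zero, _root_.abs_le]
    exact ⟨le_max_left _ _, max_le (by linarith) (min_le_left _ _)⟩
  set k : ℝ → ℝ := fun t => deriv f (max (-ε) (min ε t)) with hk
  have hkc : Continuous k := by
    have hf : ContinuousOn (deriv f) (closedBall 0 ε) := fun y hy =>
      (hball hy).1.continuousAt_deriv_of_one.continuousWithinAt
    exact hf.comp_continuous (by fun_prop) hmem
  have hder : ∀ s, HasDerivAt (fun x => ∫ t in (0 : ℝ)..x, k t) (k s) s := fun s =>
    (hkc.integral_hasStrictDerivAt 0 s).hasDerivAt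
  have hde : deriv (fun x => ∫ t in (0 : ℝ)..x, k t) = k := funext fun s => (hder s).deriv
  refine ⟨fun x => ∫ t in (0 : ℝ)..x, k t, ?_, fun s => ?_, ?_⟩
  · exact contDiff_one_iff_deriv.2 ⟨fun s => (hder s).differentiableAt, by rwa [hde]⟩
  · rw [hde]
    exact (hball (hmem s)).2.le
  · filter_upwards [closedBall_mem_nhds (0 : ℝ) hε] with x hx
    have hsub : uIcc 0 x ⊆ closedBall (0 : ℝ) ε := by
      rw [← segment_eq_uIcc]
      exact (convex_closedBall (0 : ℝ) ε).segment_subset (mem_closedBall_self hε.le) hx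
    have := intervalIntegral.integral_eq_sub_of_hasDerivAt (f := f) (f' := k) (a := 0) (b := x)
      (fun y hy => by
        have hy' := hsub hy
        have h1 := ((hball hy').1.differentiableAt (by simp)).hasDerivAt
        rw [mem_closedBall, Real.dist_eq, sub_zero, _root_.abs_le] at hy'
        simpa [hk, min_eq_right hy'.2, max_eq_right hy'.1] using h1)
      (hkc.intervalIntegrable _ _)
    rw [this, h0, sub_zero]

/-- The zero set of a function with vertical gradient is locally a graph. -/
theorem exists_local_graph {F : ℂ → ℝ} (hF : ContDiffAt ℝ 1 F 0) (h0 : F 0 = 0)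
    (h1 : fderiv ℝ F 0 1 = 0) (hI : fderiv ℝ F 0 I ≠ 0) :
    ∃ g : ℝ → ℝ, ContDiff ℝ 1 g ∧ (∀ s, |deriv g s| ≤ 1 / 2) ∧ g 0 = 0 ∧
      ∀ᶠ z : ℂ in 𝓝 0, (F z = 0 ↔ z.im = g z.re) := by
  set c := fderiv ℝ F 0 I with hc
  set Φ : ℂ → ℂ := fun z => (z.re : ℂ) + (c⁻¹ * F z : ℝ) * I with hΦ
  have hΦc : ContDiffAt ℝ 1 Φ 0 := by
    have e1 : ContDiffAt ℝ 1 (fun z : ℂ => (z.re : ℂ)) 0 :=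
      (Complex.ofRealCLM.comp Complex.reCLM).contDiff.contDiffAt
    have e2 : ContDiffAt ℝ 1 (fun z : ℂ => ((c⁻¹ * F z : ℝ) : ℂ)) 0 :=
      Complex.ofRealCLM.contDiff.contDiffAt.comp 0 (contDiffAt_const.mul hF)
    exact e1.add (e2.mul contDiffAt_const)
  have hΦd : HasFDerivAt Φ ((ContinuousLinearEquiv.refl ℝ ℂ : ℂ ≃L[ℝ] ℂ) : ℂ →L[ℝ] ℂ) 0 := by
    have hd := (hF.differentiableAt (by simp)).hasFDerivAt
    have e1 : HasFDerivAt (fun z : ℂ => (z.re : ℂ))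
        (Complex.ofRealCLM.comp Complex.reCLM) 0 :=
      (Complex.ofRealCLM.comp Complex.reCLM).hasFDerivAt
    have e2 : HasFDerivAt (fun z : ℂ => ((c⁻¹ * F z : ℝ) : ℂ))
        (Complex.ofRealCLM.comp (c⁻¹ • fderiv ℝ F 0)) 0 :=
      Complex.ofRealCLM.hasFDerivAt.comp 0 (hd.const_mul c⁻¹)
    refine (e1.add (e2.mul_const I)).congr_fderiv ?_
    ext z
    have hz : fderiv ℝ F 0 z = z.im * c := by
      conv_lhs => rw [show z = z.re • (1 : ℂ) + z.im • I by simp [Complex.re_add_im]]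
      rw [map_add, map_smul, map_smul, h1, ← hc]
      simp
    apply Complex.ext <;> simp [hz]
    field_simp
  set e := hΦc.toOpenPartialHomeomorph Φ hΦd one_ne_zero with he
  have hsrc : (0 : ℂ) ∈ e.source := hΦc.mem_toOpenPartialHomeomorph_source hΦd one_ne_zero
  have heΦ : ∀ z, e z = Φ z := fun z => rfl
  have hΦ0 : Φ 0 = 0 := by simp [hΦ, h0]
  have htgt : (0 : ℂ) ∈ e.target := by
    have := e.map_source hsrc
    rwa [heΦ, hΦ0] at this
  have hs0 : e.symm 0 = 0 := by
    have := e.left_inv hsrc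
    rwa [heΦ, hΦ0] at this
  have hsymm : ContDiffAt ℝ 1 e.symm 0 := by
    refine e.contDiffAt_symm htgt (f₀' := ContinuousLinearEquiv.refl ℝ ℂ) ?_ ?_
    · rw [hs0]
      exact hΦd
    · rw [hs0]
      exact hΦc
  have hsd : HasFDerivAt e.symm (ContinuousLinearMap.id ℝ ℂ) 0 := by
    refine e.hasFDerivAt_symm (f' := ContinuousLinearEquiv.refl ℝ ℂ) htgt ?_
    rw [hs0]
    exact hΦd
  set f : ℝ → ℝ := fun x => (e.symm (x : ℂ)).im with hf
  have hfc : ContDiffAt ℝ 1 f 0 := by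
    refine Complex.imCLM.contDiff.contDiffAt.comp 0 (ContDiffAt.comp 0 ?_
      Complex.ofRealCLM.contDiff.contDiffAt)
    simpa using hsymm
  have hfd : deriv f 0 = 0 := by
    have e1 : HasFDerivAt e.symm (ContinuousLinearMap.id ℝ ℂ) ((0 : ℝ) : ℂ) := by
      simpa using hsd
    have e2 := e1.comp_hasDerivAt (0 : ℝ) Complex.ofRealCLM.hasDerivAt
    have e3 := Complex.imCLM.hasFDerivAt.comp_hasDerivAt (0 : ℝ) e2
    have : deriv f 0 = _ := e3.deriv
    rw [this]
    simp
  have hf0 : f 0 = 0 := by simp [hf, hs0]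
  obtain ⟨g, hg, hg2, hgf⟩ := exists_contDiff_extension hfc hf0 hfd
  refine ⟨g, hg, hg2, by rw [hgf.self_of_nhds, hf0], ?_⟩
  have hre : Tendsto (fun z : ℂ => z.re) (𝓝 0) (𝓝 0) := by
    simpa using Complex.continuous_re.tendsto (0 : ℂ)
  have ht : ∀ᶠ z : ℂ in 𝓝 0, (z.re : ℂ) ∈ e.target := by
    have : Tendsto (fun z : ℂ => (z.re : ℂ)) (𝓝 0) (𝓝 0) := by
      simpa using! (Complex.continuous_ofReal.comp Complex.continuous_re).tendsto (0 : ℂ)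
    exact this (e.open_target.mem_nhds htgt)
  filter_upwards [hre hgf, ht, e.open_source.mem_nhds hsrc] with z h2 h3 h4
  have h2' : g z.re = (e.symm (z.re : ℂ)).im := h2
  have h5 : Φ (e.symm z.re) = z.re := e.right_inv h3
  rw [h2']
  constructor
  · intro hz
    have : e z = z.re := by rw [heΦ]; simp [hΦ, hz]
    rw [← this, e.left_inv h4]
  · intro hz
    have h6 : (e.symm (z.re : ℂ)).re = z.re := by
      have := congrArg Complex.re h5
      simpa [hΦ] using this
    have h7 : e.symm (z.re : ℂ) = z := Complex.ext h6 hz.symm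
    have h8 := congrArg Complex.im h5
    rw [h7] at h8
    simpa [hΦ, hI] using h8

/-- A boundary touched from above by a box has horizontal tangent there. -/
theorem C1Bdry.exists_graph {U : Set ℂ} (hU : C1Bdry U) (hUo : IsOpen U) {δ : ℝ} (hδ : 0 < δ)
    (h0 : (0 : ℂ) ∈ frontier U)
    (hbox : ∀ z : ℂ, |z.re| < δ → 0 < z.im → z.im < δ → z ∈ U) :
    ∃ g : ℝ → ℝ, ContDiff ℝ 1 g ∧ (∀ s, |deriv g s| ≤ 1 / 2) ∧ g 0 = 0 ∧
      ∀ᶠ z : ℂ in 𝓝 0, (z ∈ frontier U ↔ z.im = g z.re) := by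
  obtain ⟨W, W', φ, ψ, ℓ, n, hW, hxW, hW', hn, hφ, hψ, m1, m2, i1, i2, e⟩ := hU.exists_chart h0
  set F : ℂ → ℝ := fun z => ℓ (φ z) with hFdef
  have hφ0 : ContDiffAt ℝ 1 φ 0 := hφ.contDiffAt (hW.mem_nhds hxW)
  have hF : ContDiffAt ℝ 1 F 0 := ℓ.contDiff.contDiffAt.comp 0 hφ0
  have hF0 : F 0 = 0 := (e 0 hxW).1 h0
  have hFW : ContinuousOn F W := ℓ.continuous.comp_continuousOn hφ.continuousOn
  have hFd := (hF.differentiableAt (by simp)).hasFDerivAt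
  have hsurj : fderiv ℝ F 0 ≠ 0 := by
    intro h
    have hψ0 := ((hψ.contDiffAt (hW'.mem_nhds (m1 hxW))).differentiableAt
      (by simp)).hasFDerivAt
    have h2 : HasFDerivAt (fun w => F (ψ w)) ((fderiv ℝ F 0).comp (fderiv ℝ ψ (φ 0))) (φ 0) := by
      refine HasFDerivAt.comp (g := F) (φ 0) ?_ hψ0
      rw [i1 0 hxW]
      exact hFd
    have h3 : HasFDerivAt (fun w => F (ψ w)) ℓ (φ 0) := by
      refine ℓ.hasFDerivAt.congr_of_eventuallyEq ?_
      filter_upwards [hW'.mem_nhds (m1 hxW)] with w hw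
      simp [hFdef, i2 w hw]
    have h4 := h2.unique h3
    rw [h, ContinuousLinearMap.zero_comp] at h4
    rw [← h4] at hn
    simp at hn
  have h1 : fderiv ℝ F 0 1 = 0 := by
    by_contra hne
    obtain ⟨ε, hε, hεW⟩ := exists_rect_subset (hW.mem_nhds hxW)
    have hd : HasDerivAt (fun x : ℝ => F x) (fderiv ℝ F 0 1) 0 := by
      have hFd' : HasFDerivAt F (fderiv ℝ F 0) ((0 : ℝ) : ℂ) := by simpa using hFd
      simpa using! hFd'.comp_hasDerivAt (0 : ℝ) Complex.ofRealCLM.hasDerivAt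
    obtain ⟨s, hs, hsε, hsδ, hneg⟩ : ∃ s : ℝ, 0 < s ∧ s < ε ∧ s < δ ∧
        F ((s : ℝ) : ℂ) * F ((-s : ℝ) : ℂ) < 0 := by
      have hsl := hd.tendsto_slope_zero
      simp only [zero_add, Complex.ofReal_zero, hF0, sub_zero, smul_eq_mul] at hsl
      have ht : Tendsto (fun t : ℝ => -t) (𝓝[>] 0) (𝓝[≠] 0) := by
        refine tendsto_nhdsWithin_iff.2 ⟨?_, ?_⟩
        · have : Tendsto (fun t : ℝ => -t) (𝓝 0) (𝓝 0) := by
            simpa using (continuous_neg (G := ℝ)).tendsto 0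
          exact this.mono_left nhdsWithin_le_nhds
        · filter_upwards [self_mem_nhdsWithin] with t ht
          exact neg_ne_zero.2 (ne_of_gt ht)
      have h2 := hsl.comp ht
      have h3 := hsl.mono_left (nhdsWithin_mono (0 : ℝ) (show Ioi (0 : ℝ) ⊆ {0}ᶜ from
        fun z hz => ne_of_gt hz))
      have h4 := (h3.mul h2).eventually (lt_mem_nhds (mul_self_pos.2 hne))
      obtain ⟨s, ⟨hs4, hs0⟩, hs1⟩ := ((h4.and self_mem_nhdsWithin).and
        (Ioo_mem_nhdsGT (lt_min hε hδ))).exists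
      have hs0 : 0 < s := hs0
      refine ⟨s, hs0, hs1.2.trans_le (min_le_left _ _), hs1.2.trans_le (min_le_right _ _), ?_⟩
      simp only [Function.comp] at hs4
      have : s⁻¹ * F ((s : ℝ) : ℂ) * ((-s)⁻¹ * F ((-s : ℝ) : ℂ)) =
          -(s⁻¹ ^ 2 * (F ((s : ℝ) : ℂ) * F ((-s : ℝ) : ℂ))) := by
        rw [inv_neg]; ring
      rw [this] at hs4
      have h5 : 0 < s⁻¹ ^ 2 := by positivity
      by_contra! hcon
      nlinarith [mul_nonneg h5.le hcon]
    have hrect : ∀ x y : ℝ, |x| < ε → |y| < ε → ((x : ℂ) + y * I) ∈ W := fun x y hx hy => by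
      rw [abs_lt] at hx hy
      apply hεW
      simp [rect, hx.1, hx.2, hy.1, hy.2]
    have hcont : ∀ x : ℝ, |x| < ε → ContinuousAt (fun y : ℝ => F ((x : ℂ) + y * I)) 0 := by
      intro x hx
      have hmem := hrect x 0 hx (by simpa using hε)
      exact ContinuousAt.comp (g := F) (f := fun y : ℝ => (x : ℂ) + y * I)
        (hFW.continuousAt (hW.mem_nhds hmem)) (by fun_prop)
    have hev : ∀ᶠ y : ℝ in 𝓝 0,
        F (((s : ℝ) : ℂ) + y * I) * F (((-s : ℝ) : ℂ) + y * I) < 0 := by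
      have hsa : |s| < ε := by rwa [abs_of_pos hs]
      refine ((hcont s hsa).mul (hcont (-s) (by rwa [abs_neg]))).eventually_lt
        continuousAt_const (by simpa using hneg)
    obtain ⟨y, hy1, hy2⟩ := ((hev.filter_mono nhdsWithin_le_nhds).and
      (Ioo_mem_nhdsGT (lt_min hε hδ))).exists
    have hyε : |y| < ε := by rw [abs_of_pos hy2.1]; exact hy2.2.trans_le (min_le_left _ _)
    have hxε : ∀ x ∈ Icc (-s) s, |x| < ε := fun x hx =>
      (abs_le.2 hx).trans_lt hsε
    have hco : ContinuousOn (fun x : ℝ => F ((x : ℂ) + y * I)) (Icc (-s) s) :=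
      hFW.comp (by fun_prop) fun x hx => hrect x y (hxε x hx) hyε
    obtain ⟨x, hx, hx0⟩ : ∃ x ∈ Icc (-s) s, F ((x : ℂ) + y * I) = 0 := by
      rcases mul_neg_iff.1 hy1 with ⟨h3, h4⟩ | ⟨h3, h4⟩
      · exact intermediate_value_Icc (by linarith) hco ⟨h4.le, h3.le⟩
      · exact intermediate_value_Icc' (by linarith) hco ⟨h3.le, h4.le⟩
    have hfr := (e _ (hrect x y (hxε x hx) hyε)).2 hx0
    have hin : ((x : ℂ) + y * I) ∈ U := hbox _ (by simpa using (abs_le.2 hx).trans_lt hsδ)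
      (by simpa using hy2.1) (by simpa using hy2.2.trans_le (min_le_right _ _))
    rw [hUo.frontier_eq] at hfr
    exact hfr.2 hin
  have hI : fderiv ℝ F 0 I ≠ 0 := by
    intro h
    apply hsurj
    ext z
    conv_lhs => rw [show z = z.re • (1 : ℂ) + z.im • I by simp [Complex.re_add_im]]
    rw [map_add, map_smul, map_smul, h1, h]
    simp
  obtain ⟨g, g1, g2, g3, g4⟩ := exists_local_graph hF hF0 h1 hI
  refine ⟨g, g1, g2, g3, ?_⟩
  filter_upwards [g4, hW.mem_nhds hxW] with z h2 h3
  rw [← h2, e z h3]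

end LocalGraph

section Nonconvex

open Complex (I)

theorem abs_le_of_deriv_le_half {g : ℝ → ℝ} (hg : ContDiff ℝ 1 g)
    (hg2 : ∀ s, |deriv g s| ≤ 1 / 2) (h0 : g 0 = 0) (x : ℝ) : |g x| ≤ |x| / 2 := by
  have := Convex.norm_image_sub_le_of_norm_deriv_le (f := g) (C := 1 / 2) (s := univ)
    (x := 0) (y := x) (fun y _ => (hg.differentiable (by simp)).differentiableAt)
    (fun y _ => hg2 y) convex_univ trivial trivial
  rw [h0, sub_zero, sub_zero, Real.norm_eq_abs, Real.norm_eq_abs] at this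
  linarith

/-- A `C¹` domain touched from inside by a half box lies above a graph. -/
theorem C1Domain.exists_epigraph {U : Set ℂ} (hU : C1Domain U) {δ : ℝ} (hδ : 0 < δ)
    (h0 : (0 : ℂ) ∈ frontier U)
    (hbox : ∀ z : ℂ, |z.re| < δ → 0 < z.im → z.im < δ → z ∈ U) :
    ∃ g : ℝ → ℝ, ContDiff ℝ 1 g ∧ (∀ s, |deriv g s| ≤ 1 / 2) ∧ g 0 = 0 ∧
      ∃ ε > 0, ∀ z : ℂ, |z.re| < ε → |z.im| < ε → (z ∈ U ↔ g z.re < z.im) := by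
  obtain ⟨g, hg, hg2, hg0, hev⟩ := hU.2.2.exists_graph hU.1 hδ h0 hbox
  refine ⟨g, hg, hg2, hg0, ?_⟩
  have hgx := abs_le_of_deriv_le_half hg hg2 hg0
  obtain ⟨η, hη, hηs⟩ := exists_rect_subset hev
  obtain ⟨ε, hε, hεη, hεδ⟩ : ∃ ε, 0 < ε ∧ 2 * ε < η ∧ 2 * ε < δ := by
    refine ⟨min η δ / 4, by positivity, ?_, ?_⟩
    · linarith [min_le_left η δ]
    · linarith [min_le_right η δ]
  have hfr : ∀ z : ℂ, |z.re| < ε → |z.im| < 2 * ε → (z ∈ frontier U ↔ z.im = g z.re) := by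
    intro z h1 h2
    rw [abs_lt] at h1 h2
    apply hηs
    simp only [rect, mem_ofPred_eq, Complex.zero_re, Complex.zero_im]
    refine ⟨?_, ?_, ?_, ?_⟩ <;> linarith
  have hstrip : ∀ x t : ℝ, |x| < ε → |t| < ε → |g x + t| < 2 * ε := fun x t hx ht => by
    have := hgx x
    refine (abs_add_le _ _).trans_lt (by linarith [abs_nonneg x])
  set P : ℝ × ℝ → ℂ := fun p => (p.1 : ℂ) + ((g p.1 + p.2 : ℝ) : ℂ) * I with hP
  have hPc : Continuous P := by
    have := hg.continuous
    fun_prop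
  have hPre : ∀ p, (P p).re = p.1 := fun p => by simp [hP]
  have hPim : ∀ p, (P p).im = g p.1 + p.2 := fun p => by simp [hP]
  have hpre : ∀ a b : ℝ, IsPreconnected (P '' (Ioo (-ε) ε ×ˢ Ioo a b)) := fun a b =>
    (isPreconnected_Ioo.prod isPreconnected_Ioo).image P hPc.continuousOn
  have hbdd : ∀ a b : ℝ, Bornology.IsBounded (P '' (Ioo (-ε) ε ×ˢ Ioo a b)) := fun a b =>
    ((isCompact_Icc (a := -ε) (b := ε)).prod (isCompact_Icc (a := a) (b := b))
      |>.image hPc).isBounded.subset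
      (image_mono (prod_mono Ioo_subset_Icc_self Ioo_subset_Icc_self))
  have hdis : ∀ a b : ℝ, -ε ≤ a → b ≤ ε → (0 ∉ Ioo a b) →
      Disjoint (P '' (Ioo (-ε) ε ×ˢ Ioo a b)) (frontier U) := by
    rintro a b ha hb hab
    rw [disjoint_left]
    rintro _ ⟨⟨x, t⟩, ⟨hx, ht⟩, rfl⟩ hf
    have hx' : |x| < ε := abs_lt.2 hx
    have ht' : |t| < ε := abs_lt.2 ⟨ha.trans_lt ht.1, ht.2.trans_le hb⟩
    rw [hfr _ (by rwa [hPre]) (by rw [hPim]; exact hstrip x t hx' ht'), hPim, hPre] at hf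
    have : t = 0 := by simpa using hf
    exact hab (this ▸ ht)
  have hupper : P '' (Ioo (-ε) ε ×ˢ Ioo 0 ε) ⊆ U := by
    rcases subset_or_subset_compl_of_disjoint_frontier (hpre 0 ε)
      (hdis 0 ε (by linarith) le_rfl (by simp)) with h | h
    · exact h
    · exfalso
      have hm : P (0, ε / 2) ∈ P '' (Ioo (-ε) ε ×ˢ Ioo 0 ε) :=
        mem_image_of_mem P ⟨⟨by simpa using hε, hε⟩, by simpa using hε, by linarith⟩
      refine h hm (hbox _ ?_ ?_ ?_)
      · rw [hPre]; simpa using hδ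
      · rw [hPim, hg0]; simpa using hε
      · rw [hPim, hg0]; simp only [zero_add]; linarith
  have hcover : ∀ z : ℂ, |z.re| < ε → z = P (z.re, z.im - g z.re) := fun z _ =>
    Complex.ext (by rw [hPre]) (by rw [hPim]; ring)
  have hlower : P '' (Ioo (-ε) ε ×ˢ Ioo (-ε) 0) ⊆ Uᶜ := by
    rcases subset_or_subset_compl_of_disjoint_frontier (hpre (-ε) 0)
      (hdis (-ε) 0 le_rfl hε.le (by simp)) with h | h
    · exfalso
      refine not_both_sides hU h0 (hpre 0 ε) (hpre (-ε) 0) hupper h ?_ ?_ (hbdd _ _) (hbdd _ _) ?_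
      · exact ((nonempty_Ioo.2 (by linarith)).prod (nonempty_Ioo.2 hε)).image P
      · exact ((nonempty_Ioo.2 (by linarith)).prod (nonempty_Ioo.2 (by linarith))).image P
      · have hc : Continuous fun z : ℂ => z.im - g z.re :=
          Complex.continuous_im.sub (hg.continuous.comp Complex.continuous_re)
        have e1 : ∀ᶠ z : ℂ in 𝓝 0, |z.re| < ε :=
          (Complex.continuous_re.abs.continuousAt).eventually_lt continuousAt_const
            (by simpa using hε)
        have e2 : ∀ᶠ z : ℂ in 𝓝 0, |z.im - g z.re| < ε :=
          (hc.abs.continuousAt).eventually_lt continuousAt_const (by simpa [hg0] using hε)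
        have e3 : ∀ᶠ z : ℂ in 𝓝 0, |z.im| < 2 * ε :=
          (Complex.continuous_im.abs.continuousAt).eventually_lt continuousAt_const
            (by simpa using hε)
        filter_upwards [self_mem_nhdsWithin, mem_nhdsWithin_of_mem_nhds e1,
          mem_nhdsWithin_of_mem_nhds e2, mem_nhdsWithin_of_mem_nhds e3] with z h1 h2 h3 h4
        have hne : z.im - g z.re ≠ 0 := fun h5 => h1 ((hfr z h2 h4).2 (by linarith))
        rw [hcover z h2]
        rw [abs_lt] at h2 h3
        rcases lt_or_gt_of_ne hne with h5 | h5
        · exact Or.inr (mem_image_of_mem P ⟨h2, h3.1, h5⟩)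
        · exact Or.inl (mem_image_of_mem P ⟨h2, h5, h3.2⟩)
    · exact h
  refine ⟨ε / 2, by positivity, fun z h1 h2 => ?_⟩
  have h1' : |z.re| < ε := by linarith
  have h3 : |z.im - g z.re| < ε := by
    have := hgx z.re
    refine (abs_sub _ _).trans_lt (by linarith)
  rcases lt_trichotomy (z.im - g z.re) 0 with h | h | h
  · refine iff_of_false ?_ (by linarith)
    rw [hcover z h1']
    exact hlower (mem_image_of_mem P ⟨abs_lt.1 h1', (abs_lt.1 h3).1, h⟩)
  · refine iff_of_false (fun hz => ?_) (by linarith)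
    have : z ∈ frontier U := (hfr z h1' (by linarith)).2 (by linarith)
    rw [hU.1.frontier_eq] at this
    exact this.2 hz
  · refine iff_of_true ?_ (by linarith)
    rw [hcover z h1']
    exact hupper (mem_image_of_mem P ⟨abs_lt.1 h1', h, (abs_lt.1 h3).2⟩)

/-- A domain touching a segment from above that leaves it at a boundary point. -/
theorem notDetermined_of_inner_segment {U : Set ℂ} (hU : C1Domain U) {δ : ℝ} (hδ : 0 < δ)
    (h0 : (0 : ℂ) ∉ U) (hbox : ∀ z : ℂ, |z.re| < δ → 0 < z.im → z.im < δ → z ∈ U)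
    (hseg : ∀ x : ℝ, 0 < x → x < δ → (x : ℂ) ∈ U) : NotDetermined U := by
  have hfr : (0 : ℂ) ∈ frontier U := by
    rw [hU.1.frontier_eq]
    refine ⟨?_, h0⟩
    have ht : Tendsto (fun x : ℝ => (x : ℂ)) (𝓝[>] 0) (𝓝 0) := by
      have : Tendsto (fun x : ℝ => (x : ℂ)) (𝓝 0) (𝓝 0) := by
        simpa using! Complex.continuous_ofReal.tendsto 0
      exact this.mono_left nhdsWithin_le_nhds
    refine mem_closure_of_tendsto ht ?_
    filter_upwards [Ioo_mem_nhdsGT hδ] with x hx using hseg x hx.1 hx.2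
  obtain ⟨g, hg, hg2, hg0, ε, hε, hgU⟩ := hU.exists_epigraph hδ hfr hbox
  have hgx := abs_le_of_deriv_le_half hg hg2 hg0
  set r := min ε δ / 2 with hr
  have hr0 : 0 < r := by positivity
  have hrε : r < ε := by linarith [min_le_left ε δ, min_le_right ε δ]
  have hrδ : r < δ := by linarith [min_le_left ε δ, min_le_right ε δ]
  have hle : ∀ x ∈ Icc (-r) r, g x ≤ 0 := by
    intro x hx
    by_contra! hpos
    have hx' := abs_le.2 hx
    have h1 := hgx x
    rw [abs_of_pos hpos] at h1
    have hre : ((x : ℂ) + g x * I).re = x := by simp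
    have him : ((x : ℂ) + g x * I).im = g x := by simp
    have h2 := (hgU ((x : ℂ) + g x * I) (by rw [hre]; linarith)
      (by rw [him, abs_of_pos hpos]; linarith)).1
      (hbox _ (by rw [hre]; linarith) (by rwa [him]) (by rw [him]; linarith))
    rw [hre, him] at h2
    exact lt_irrefl _ h2
  have hgr : g r < 0 := by
    have := (hgU (r : ℂ) (by simpa [abs_of_pos hr0] using hrε) (by simpa using hε)).1
      (hseg r hr0 hrδ)
    simpa using this
  obtain ⟨l', q, r', m, φ, h1, h2, h3, h4, h5, h6, h7, h8, h9, h10, h11, h12⟩ :=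
    exists_hull hg hg2 (neg_lt_zero.2 hr0) hr0 hle hg0 hgr
  have hC : HullCurve g m φ l' q r' := ⟨hg, hg2, hg0, h2, h3, h4, h6, h7, h8, h9, h10, h11, h12⟩
  refine hC.notDetermined hU h2 h4 hε (fun x hx => ?_) fun z z1 z2 z3 => ?_
  · have := hgx x
    rw [abs_of_nonneg hx.1] at this
    linarith [hx.2]
  · exact hgU z (abs_lt.2 ⟨by linarith, by linarith⟩) z3

end Nonconvex

section ConvexCase

open Complex (I)
open scoped ComplexConjugate

theorem exists_frame (p : ℂ) {w : ℂ} (hw : w ≠ 0) :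
    ∃ T : ℂ ≃ᵃⁱ[ℝ] ℂ, ∀ z, T z = conj w / ‖w‖ * (z - p) := by
  have hn : (‖w‖ : ℂ) ≠ 0 := by simpa using hw
  let c : Circle := ⟨conj w / ‖w‖, by simp [Submonoid.unitSphere, hw]⟩
  refine ⟨(AffineIsometryEquiv.constVAdd ℝ ℂ (-p)).trans (rotation c).toAffineIsometryEquiv,
    fun z => ?_⟩
  change (c : ℂ) * (-p + z) = _
  simp only [c]
  ring

theorem exists_conj_frame : ∃ T : ℂ ≃ᵃⁱ[ℝ] ℂ, ∀ z, T z = conj z :=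
  ⟨Complex.conjLIE.toAffineIsometryEquiv, fun z => by simp⟩

theorem image_closure_affineIsometryEquiv (T : ℂ ≃ᵃⁱ[ℝ] ℂ) (U : Set ℂ) :
    T '' closure U = closure (T '' U) := T.toHomeomorph.image_closure U

theorem convex_image_affineIsometryEquiv (T : ℂ ≃ᵃⁱ[ℝ] ℂ) {U : Set ℂ} (h : Convex ℝ U) :
    Convex ℝ (T '' U) := h.affine_image T.toAffineEquiv.toAffineMap

theorem Convex.mem_of_eventually_mem_closure {U : Set ℂ} (hc : Convex ℝ U) (ho : IsOpen U)
    (hne : U.Nonempty) {w : ℂ} (h : ∀ᶠ z in 𝓝 w, z ∈ closure U) : w ∈ U := by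
  have := mem_interior_iff_mem_nhds.2 h
  have h2 := hc.interior_closure_eq_interior_of_nonempty_interior (by rwa [ho.interior_eq])
  rw [ho.interior_eq] at h2
  exact h2 ▸ this

theorem combo_mem_closure {U : Set ℂ} (hc : Convex ℝ U) {a b : ℂ} (ha : a ∈ closure U)
    (hb : b ∈ closure U) {t : ℝ} (h0 : 0 ≤ t) (h1 : t ≤ 1) :
    ((1 - t : ℝ) : ℂ) * a + (t : ℂ) * b ∈ closure U := by
  have := hc.closure ha hb (a := 1 - t) (b := t) (by linarith) h0 (by ring)
  simpa only [Complex.real_smul] using this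

theorem notDetermined_of_transverse_recession {U : Set ℂ} (hU : C1Domain U)
    (hconv : Convex ℝ U) (hup : ∀ z ∈ U, 0 < z.im) {ℓ : ℝ} (hℓ : 0 < ℓ) (h0 : 0 ∈ closure U)
    (hℓU : (ℓ : ℂ) ∈ closure U) {d : ℂ} (hd : 0 < d.im)
    (hray : ∀ z ∈ closure U, ∀ t : ℝ, 0 ≤ t → z + t * d ∈ closure U) : NotDetermined U := by
  refine notDetermined_of_flat_segment hU hconv hup (e := d.re / d.im) hℓ fun x t hx0 hxℓ ht => ?_
  refine hconv.mem_of_eventually_mem_closure hU.1 hU.2.1.nonempty ?_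
  set e := d.re / d.im with he
  have hc : Continuous fun z : ℂ => z.re - e * z.im :=
    Complex.continuous_re.sub (continuous_const.mul Complex.continuous_im)
  set w : ℂ := (x : ℂ) + t * (e + I) with hw
  have hwre : w.re - e * w.im = x := by simp [hw]; ring
  have hwim : w.im = t := by simp [hw]
  have e1 : ∀ᶠ z in 𝓝 w, 0 < z.re - e * z.im :=
    continuousAt_const.eventually_lt hc.continuousAt (by rwa [hwre])
  have e2 : ∀ᶠ z in 𝓝 w, z.re - e * z.im < ℓ :=
    hc.continuousAt.eventually_lt continuousAt_const (by rwa [hwre])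
  have e3 : ∀ᶠ z in 𝓝 w, 0 < z.im :=
    continuousAt_const.eventually_lt Complex.continuous_im.continuousAt (by rwa [hwim])
  filter_upwards [e1, e2, e3] with z h1 h2 h3
  have h4 := combo_mem_closure hconv h0 hℓU (t := (z.re - e * z.im) / ℓ) (by positivity)
    ((div_le_one hℓ).2 h2.le)
  have h5 := hray _ h4 (z.im / d.im) (by positivity)
  convert h5 using 1
  have hd' := hd.ne'
  apply Complex.ext
  · simp [he]
    field_simp
    ring
  · simp
    field_simp

theorem notDetermined_of_parallel_recession {U : Set ℂ} (hU : C1Domain U)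
    (hconv : Convex ℝ U) (hup : ∀ z ∈ U, 0 < z.im) (h0 : 0 ∈ closure U)
    (hray : ∀ z ∈ closure U, ∀ t : ℝ, 0 ≤ t → z + t ∈ closure U) : NotDetermined U := by
  obtain ⟨p, hp⟩ := hU.2.1.nonempty
  have hp0 := hup p hp
  set X := max 0 p.re with hX
  obtain ⟨T, hT⟩ := exists_frame (X : ℂ) one_ne_zero
  have hT' : ∀ z, T z = z - X := fun z => by simp [hT]
  refine NotDetermined.of_image T (notDetermined_of_flat_ray (hU.image T)
    (convex_image_affineIsometryEquiv T hconv) hp0 fun z hz1 hz2 => ?_)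
  constructor
  · rintro ⟨w, hw, rfl⟩
    rw [hT']
    simpa using hup w hw
  · intro hz3
    refine ⟨z + X, ?_, by rw [hT']; ring⟩
    refine hconv.mem_of_eventually_mem_closure hU.1 hU.2.1.nonempty ?_
    have e1 : ∀ᶠ w in 𝓝 (z + X), X < w.re :=
      continuousAt_const.eventually_lt Complex.continuous_re.continuousAt (by simpa using hz1)
    have e2 : ∀ᶠ w in 𝓝 (z + X), 0 < w.im :=
      continuousAt_const.eventually_lt Complex.continuous_im.continuousAt (by simpa using hz3)
    have e3 : ∀ᶠ w in 𝓝 (z + X), w.im < p.im :=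
      Complex.continuous_im.continuousAt.eventually_lt continuousAt_const (by simpa using hz2)
    filter_upwards [e1, e2, e3] with w h1 h2 h3
    have h4 := hray 0 h0 w.re (by linarith [le_max_left 0 p.re])
    have h5 := hray p (subset_closure hp) (w.re - p.re) (by linarith [le_max_right 0 p.re])
    have h6 := combo_mem_closure hconv h4 h5 (t := w.im / p.im) (by positivity)
      ((div_le_one hp0).2 h3.le)
    convert h6 using 1
    have hp' := hp0.ne'
    apply Complex.ext
    · simp
      ring
    · simp
      field_simp

theorem notDetermined_of_support {U : Set ℂ} (hU : C1Domain U) (hconv : Convex ℝ U)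
    (hunb : ¬ Bornology.IsBounded U) (hup : ∀ z ∈ U, 0 < z.im) {ℓ : ℝ} (hℓ : 0 < ℓ)
    (h0 : 0 ∈ closure U) (hℓU : (ℓ : ℂ) ∈ closure U) : NotDetermined U := by
  obtain ⟨d, hd0, hd⟩ := not_bounded_iff_exists_ne_zero_mem_asymptoticCone.1 hunb
  have hray : ∀ z ∈ closure U, ∀ t : ℝ, 0 ≤ t → z + t * d ∈ closure U := fun z hz t ht => by
    have := hconv.closure.smul_vadd_mem_of_isClosed_of_mem_asymptoticCone isClosed_closure ht
      (by rwa [asymptoticCone_closure]) hz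
    rw [vadd_eq_add, Complex.real_smul, add_comm] at this
    exact this
  have hcl : ∀ z ∈ closure U, 0 ≤ z.im := fun z hz =>
    closure_minimal (fun w hw => (hup w hw).le)
      (isClosed_le continuous_const Complex.continuous_im) hz
  have hdim : 0 ≤ d.im := by
    have := hcl _ (hray 0 h0 1 zero_le_one)
    simpa using this
  rcases hdim.eq_or_lt with h | h
  · have hdre : d = d.re := Complex.ext (by simp) (by simp [← h])
    have hre0 : d.re ≠ 0 := fun h1 => hd0 (by rw [hdre, h1]; simp)
    rcases lt_or_gt_of_ne hre0 with h1 | h1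
    · obtain ⟨T₁, hT₁⟩ := exists_frame (ℓ : ℂ) (neg_ne_zero.2 one_ne_zero)
      obtain ⟨T₂, hT₂⟩ := exists_conj_frame
      have hT : ∀ z, (T₁.trans T₂) z = ℓ - conj z := fun z => by
        simp [hT₁, hT₂]
      set T := T₁.trans T₂
      refine NotDetermined.of_image T (notDetermined_of_parallel_recession (hU.image T)
        (convex_image_affineIsometryEquiv T hconv) ?_ ?_ ?_)
      · rintro _ ⟨z, hz, rfl⟩
        rw [hT]
        simpa using hup z hz
      · rw [← image_closure_affineIsometryEquiv]
        exact ⟨ℓ, hℓU, by rw [hT]; simp⟩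
      · rw [← image_closure_affineIsometryEquiv]
        rintro _ ⟨z, hz, rfl⟩ t ht
        have h2 := hray z hz (t / -d.re) (div_nonneg ht (by linarith))
        refine ⟨_, h2, ?_⟩
        have h3 : ((t / -d.re : ℝ) : ℂ) * (d.re : ℂ) = -(t : ℂ) := by
          rw [← Complex.ofReal_mul, ← Complex.ofReal_neg]
          congr 1
          field_simp
        rw [← hdre] at h3
        rw [hT, hT, h3, map_add, map_neg, Complex.conj_ofReal]
        ring
    · refine notDetermined_of_parallel_recession hU hconv hup h0 fun z hz t ht => ?_
      have h2 := hray z hz (t / d.re) (by positivity)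
      rw [hdre] at h2
      convert h2 using 2
      rw [← Complex.ofReal_mul, Complex.ofReal_re]
      congr 1
      field_simp
  · exact notDetermined_of_transverse_recession hU hconv hup hℓ h0 hℓU h hray

/-- An unbounded convex domain which is not strictly convex is not determined. -/
theorem notDetermined_of_not_strictlyConvex {U : Set ℂ} (hU : C1Domain U) (hconv : Convex ℝ U)
    (hunb : ¬ Bornology.IsBounded U) {a b : ℂ} (ha : a ∈ closure U) (hb : b ∈ closure U)
    (hab : ¬ openSegment ℝ a b ⊆ U) (hne : a ≠ b) : NotDetermined U := by
  obtain ⟨x, ⟨s, t, hs, ht, hst, hx⟩, hxU⟩ := not_subset.1 hab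
  have hunb' : ∀ T : ℂ ≃ᵃⁱ[ℝ] ℂ, ∀ V : Set ℂ, ¬ Bornology.IsBounded V →
      ¬ Bornology.IsBounded (T '' V) := fun T V hV h => hV <| by
    rw [Metric.isBounded_iff_ediam_ne_top] at h ⊢
    rwa [T.isometry.ediam_image] at h
  have hw : b - a ≠ 0 := sub_ne_zero.2 hne.symm
  obtain ⟨T, hT⟩ := exists_frame a hw
  have hn : 0 < ‖b - a‖ := norm_pos_iff.2 hw
  have hTb : ∀ r : ℝ, T (a + r * (b - a)) = ((r * ‖b - a‖ : ℝ) : ℂ) := fun r => by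
    rw [hT]
    have h1 : (‖b - a‖ : ℂ) ≠ 0 := by simpa using hw
    have h2 := Complex.conj_mul' (b - a)
    push_cast
    field_simp
    linear_combination (r : ℂ) * h2
  refine NotDetermined.of_image T ?_
  set V := T '' U with hV
  have hVc := convex_image_affineIsometryEquiv T hconv
  have hV1 := hU.image T
  have hVu := hunb' T U hunb
  have h0V : (0 : ℂ) ∈ closure V := by
    rw [hV, ← image_closure_affineIsometryEquiv]
    exact ⟨a, ha, by rw [hT]; simp⟩
  have hℓV : ((‖b - a‖ : ℝ) : ℂ) ∈ closure V := by
    rw [hV, ← image_closure_affineIsometryEquiv]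
    refine ⟨b, hb, ?_⟩
    have := hTb 1
    rw [one_mul] at this
    rw [← this]
    simp
  have hxV : ((t * ‖b - a‖ : ℝ) : ℂ) ∉ V := by
    rintro ⟨z, hz, hzx⟩
    rw [← hTb t] at hzx
    apply hxU
    rw [← hx, Complex.real_smul, Complex.real_smul]
    have h1 : (s : ℂ) = 1 - t := by rw [← Complex.ofReal_one, ← Complex.ofReal_sub]; congr 1; linarith
    rw [T.injective hzx] at hz
    convert hz using 1
    rw [h1]
    ring
  obtain ⟨f, hf⟩ := geometric_hahn_banach_point_open hVc hV1.1 hxV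
  have hfr : ∀ r : ℝ, f (r : ℂ) = r * f 1 := fun r => by
    have := f.map_smul r (1 : ℂ)
    simpa using this
  have hfc : ∀ z ∈ closure V, t * ‖b - a‖ * f 1 ≤ f z := fun z hz => by
    rw [← hfr]
    exact closure_minimal (fun w hw => (hf w hw).le)
      (isClosed_le continuous_const f.continuous) hz
  have hf1 : f 1 = 0 := by
    have h1 := hfc 0 h0V
    have h2 := hfc _ hℓV
    rw [hfr] at h2
    rw [map_zero] at h1
    have h3 : 0 < t * ‖b - a‖ := by positivity
    have h4 : 0 < s * ‖b - a‖ := by positivity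
    have h5 : s = 1 - t := by linarith
    rw [h5] at h4
    refine le_antisymm (by by_contra! hc; nlinarith [mul_pos h3 hc]) ?_
    by_contra! hc
    nlinarith [mul_neg_of_pos_of_neg h4 hc]
  have hfI : ∀ z ∈ V, 0 < z.im * f I := fun z hz => by
    have h1 := hf z hz
    rw [hfr, hf1, mul_zero] at h1
    have h2 : f z = z.im * f I := by
      conv_lhs => rw [show z = z.re • (1 : ℂ) + z.im • I by simp [Complex.re_add_im]]
      rw [map_add, map_smul, map_smul, hf1]
      simp
    rwa [h2] at h1
  rcases lt_trichotomy (f I) 0 with h | h | h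
  · obtain ⟨S, hS⟩ := exists_conj_frame
    refine NotDetermined.of_image S (notDetermined_of_support (hV1.image S)
      (convex_image_affineIsometryEquiv S hVc) (hunb' S V hVu) ?_ hn ?_ ?_)
    · rintro _ ⟨z, hz, rfl⟩
      rw [hS, Complex.conj_im]
      have := hfI z hz
      by_contra! hc
      nlinarith
    · rw [← image_closure_affineIsometryEquiv]
      exact ⟨0, h0V, by simp [hS]⟩
    · rw [← image_closure_affineIsometryEquiv]
      exact ⟨_, hℓV, by rw [hS, Complex.conj_ofReal]⟩
  · obtain ⟨z, hz⟩ := hV1.2.1.nonempty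
    have := hfI z hz
    rw [h, mul_zero] at this
    exact absurd this (lt_irrefl _)
  · exact notDetermined_of_support hV1 hVc hVu (fun z hz => pos_of_mul_pos_left (hfI z hz) h.le)
      hn h0V hℓV

end ConvexCase

section Reduction

open Complex (I)
open scoped ComplexConjugate

/-- An open connected set in which two-edge paths can be short-cut is convex. -/
theorem convex_of_forall_segment_subset {X : Type*} [NormedAddCommGroup X] [NormedSpace ℝ X]
    {U : Set X} (ho : IsOpen U) (hc : IsPreconnected U)
    (h : ∀ a b c : X, segment ℝ a b ⊆ U → segment ℝ b c ⊆ U → segment ℝ a c ⊆ U) :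
    Convex ℝ U := by
  refine convex_iff_segment_subset.2 fun a ha b hb => ?_
  have hd : Disjoint U (frontier {x | segment ℝ a x ⊆ U}) := by
    refine disjoint_left.2 fun x hx => notMem_frontier_iff_eventually.2 ?_
    obtain ⟨ε, hε, hball⟩ := Metric.isOpen_iff.1 ho x hx
    filter_upwards [ball_mem_nhds x hε] with z hz
    have hxz : segment ℝ x z ⊆ U :=
      ((convex_ball x ε).segment_subset (mem_ball_self hε) hz).trans hball
    exact ⟨fun h1 => h a z x h1 (by rwa [segment_symm]), fun h1 => h a x z h1 hxz⟩
  have haa : a ∈ {x | segment ℝ a x ⊆ U} := by simpa using ha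
  rcases subset_or_subset_compl_of_disjoint_frontier hc hd with h1 | h1
  · exact h1 hb
  · exact absurd haa (h1 ha)

/-- A triangle whose open part lies in `U` and one of whose sides leaves `U`. -/
theorem notDetermined_of_triangle {U : Set ℂ} (hU : C1Domain U) {A C : ℝ} {β : ℂ} (hA : A < 0)
    (hC : 0 < C) (hβ : 0 < β.im) (h0 : (0 : ℂ) ∉ U)
    (hseg : ∀ x : ℝ, 0 < x → x ≤ C → (x : ℂ) ∈ U)
    (htri : ∀ s v : ℝ, 0 < v → v ≤ s → s ≤ 1 → (A : ℂ) + s * (C - A) + v * (β - C) ∈ U) :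
    NotDetermined U := by
  set s : ℂ → ℝ := fun z => (z.re - A - z.im / β.im * (β.re - C)) / (C - A) with hs
  have hCA : 0 < C - A := by linarith
  have hsc : Continuous s := by
    have h1 := Complex.continuous_re
    have h2 := Complex.continuous_im
    exact ((h1.sub continuous_const).sub ((h2.div_const _).mul continuous_const)).div_const _
  have hs0 : s 0 = -A / (C - A) := by simp [hs]
  have e1 : ∀ᶠ z in 𝓝 (0 : ℂ), s z ≤ 1 := by
    have : s 0 < 1 := by rw [hs0, div_lt_one hCA]; linarith
    filter_upwards [hsc.continuousAt.eventually_lt continuousAt_const this] with z hz using hz.le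
  have e2 : ∀ᶠ z in 𝓝 (0 : ℂ), z.im / β.im < s z := by
    refine (Complex.continuous_im.div_const _).continuousAt.eventually_lt hsc.continuousAt ?_
    rw [hs0]
    simpa using div_pos (neg_pos.2 hA) hCA
  obtain ⟨ε, hε, hεs⟩ := exists_rect_subset (e1.and e2)
  refine notDetermined_of_inner_segment hU (lt_min hε hC) h0 (fun z h1 h2 h3 => ?_)
    fun x h1 h2 => hseg x h1 (h2.le.trans (min_le_right _ _))
  have h1' := abs_lt.1 (h1.trans_le (min_le_left _ _))
  have h3' := h3.trans_le (min_le_left _ _)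
  obtain ⟨h4, h5⟩ : s z ≤ 1 ∧ z.im / β.im < s z := by
    apply hεs
    simp only [rect, mem_ofPred_eq, Complex.zero_re, Complex.zero_im]
    refine ⟨?_, ?_, ?_, ?_⟩ <;> linarith
  convert htri (s z) (z.im / β.im) (by positivity) h5.le h4 using 1
  have e3 : s z * (C - A) = z.re - A - z.im / β.im * (β.re - C) := by
    simp only [hs]
    field_simp
  have e4 : z.im / β.im * β.im = z.im := by field_simp
  apply Complex.ext
  · simp only [Complex.add_re, Complex.mul_re, Complex.sub_re, Complex.ofReal_re,
      Complex.ofReal_im, Complex.sub_im]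
    linear_combination -e3
  · simp only [Complex.add_im, Complex.mul_im, Complex.sub_re, Complex.ofReal_re,
      Complex.ofReal_im, Complex.sub_im]
    linear_combination -e4

theorem exists_first_exit {U : Set ℂ} (ho : IsOpen U) {a b c : ℂ} (hab : segment ℝ a b ⊆ U)
    (hbc : segment ℝ b c ⊆ U) (hac : ¬ segment ℝ a c ⊆ U) :
    ∃ (e : ℂ) (σ : ℝ), 0 < σ ∧ σ < 1 ∧ segment ℝ b e ⊆ U ∧ a + σ * (e - a) ∉ U ∧
      (∀ s : ℝ, σ < s → s ≤ 1 → a + s * (e - a) ∈ U) ∧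
      ∀ s v : ℝ, 0 < v → v ≤ s → s ≤ 1 → a + s * (e - a) + v * (b - e) ∈ U := by
  set P : ℝ × ℝ → ℂ := fun q => a + q.2 * (b + q.1 * (c - b) - a) with hP
  have hPc : Continuous P := by fun_prop
  set K := (Icc (0 : ℝ) 1 ×ˢ Icc (0 : ℝ) 1) ∩ P ⁻¹' Uᶜ with hK
  have hKc : IsCompact K :=
    (isCompact_Icc.prod isCompact_Icc).inter_right (ho.isClosed_compl.preimage hPc)
  have hKn : K.Nonempty := by
    obtain ⟨x, ⟨u, s, hu, hs, hus, rfl⟩, hx⟩ := not_subset.1 hac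
    refine ⟨(1, s), ⟨⟨by simp, hs, by simp; linarith⟩, ?_⟩⟩
    have hu' : (u : ℂ) = 1 - s := by
      rw [← Complex.ofReal_one, ← Complex.ofReal_sub]; congr 1; linarith
    convert hx using 1
    rw [hP, Complex.real_smul, Complex.real_smul, hu']
    congr! 1
    push_cast
    ring
  obtain ⟨⟨t, s₀⟩, hts, htmin⟩ := hKc.exists_isMinOn hKn continuous_fst.continuousOn
  have hFc : IsCompact (K ∩ {q | q.1 = t}) :=
    hKc.inter_right (isClosed_eq continuous_fst continuous_const)
  obtain ⟨⟨t', σ⟩, ⟨hσK, ht'⟩, hσmax⟩ := hFc.exists_isMaxOn ⟨(t, s₀), hts, rfl⟩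
    continuous_snd.continuousOn
  obtain rfl : t' = t := ht'
  obtain ⟨⟨ht, hσ⟩, hPU⟩ := hσK
  have ht : t' ∈ Icc (0 : ℝ) 1 := ht
  have hσ : σ ∈ Icc (0 : ℝ) 1 := hσ
  have hPU : a + σ * (b + t' * (c - b) - a) ∉ U := hPU
  set e := b + t' * (c - b) with he
  have hbe : ∀ τ ∈ Icc (0 : ℝ) 1, b + τ * (e - b) ∈ U := fun τ hτ => by
    apply hbc
    rw [segment_eq_image']
    refine ⟨τ * t', ⟨mul_nonneg hτ.1 ht.1, mul_le_one₀ hτ.2 ht.1 ht.2⟩, ?_⟩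
    beta_reduce
    rw [Complex.real_smul, he]
    push_cast
    ring
  have ha : a ∈ U := hab (left_mem_segment ℝ a b)
  have heU : e ∈ U := by simpa using hbe 1 (by simp)
  have hin : ∀ τ s : ℝ, 0 ≤ τ → τ < t' → 0 ≤ s → s ≤ 1 →
      a + s * (b + τ * (c - b) - a) ∈ U := fun τ s h1 h2 h3 h4 => by
    by_contra hcon
    have := htmin (a := (τ, s)) ⟨⟨⟨h1, h2.le.trans ht.2⟩, h3, h4⟩, hcon⟩
    exact absurd this (not_le.2 h2)
  have ht0 : 0 < t' := by
    refine ht.1.lt_of_ne fun h => hPU ?_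
    apply hab
    rw [segment_eq_image']
    refine ⟨σ, hσ, ?_⟩
    beta_reduce
    rw [Complex.real_smul, he, ← h]
    push_cast
    ring
  refine ⟨e, σ, ?_, ?_, ?_, hPU, ?_, ?_⟩
  · refine hσ.1.lt_of_ne fun h => hPU ?_
    rw [← h]
    simpa using ha
  · refine hσ.2.lt_of_ne fun h => hPU ?_
    rw [h]
    simpa using heU
  · rw [segment_eq_image']
    rintro _ ⟨τ, hτ, rfl⟩
    simpa only [Complex.real_smul] using hbe τ hτ
  · intro s h1 h2
    by_contra hcon
    have := hσmax (a := (t', s)) ⟨⟨⟨ht, hσ.1.trans h1.le, h2⟩, hcon⟩, rfl⟩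
    exact absurd this (not_le.2 h1)
  · intro s v hv hvs hs
    have hs0 : 0 < s := hv.trans_le hvs
    have h1 : v / s ≤ 1 := (div_le_one hs0).2 hvs
    have h2 : 0 < v / s := by positivity
    have h3 := hin ((1 - v / s) * t') s (mul_nonneg (by linarith) ht.1) (by nlinarith) hs0.le hs
    convert h3 using 1
    have h4 : (s : ℂ) ≠ 0 := by exact_mod_cast hs0.ne'
    rw [he]
    push_cast
    field_simp
    ring

/-- A nonconvex domain is not determined. -/
theorem notDetermined_of_not_convex {U : Set ℂ} (hU : C1Domain U) (h : ¬ Convex ℝ U) :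
    NotDetermined U := by
  obtain ⟨a, b, c, hab, hbc, hac⟩ : ∃ a b c : ℂ, segment ℝ a b ⊆ U ∧ segment ℝ b c ⊆ U ∧
      ¬ segment ℝ a c ⊆ U := by
    by_contra! hcon
    exact h (convex_of_forall_segment_subset hU.1 hU.2.1.isPreconnected hcon)
  obtain ⟨e, σ, hσ0, hσ1, hbe, hp, hseg, htri⟩ := exists_first_exit hU.1 hab hbc hac
  have hea : e - a ≠ 0 := fun h0 => hp <| by
    rw [h0]
    simpa using hab (left_mem_segment ℝ a b)
  obtain ⟨T, hT⟩ := exists_frame (a + σ * (e - a)) hea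
  have hn : 0 < ‖e - a‖ := norm_pos_iff.2 hea
  have hTs : ∀ s : ℝ, T (a + s * (e - a)) = (((s - σ) * ‖e - a‖ : ℝ) : ℂ) := fun s => by
    rw [hT]
    have h1 : (‖e - a‖ : ℂ) ≠ 0 := by simpa using hea
    have h2 := Complex.conj_mul' (e - a)
    push_cast
    field_simp
    linear_combination ((s : ℂ) - σ) * h2
  set A : ℝ := (0 - σ) * ‖e - a‖ with hA
  set C : ℝ := (1 - σ) * ‖e - a‖ with hC
  have hTa : T a = A := by rw [hA, ← hTs 0]; simp
  have hTe : T e = C := by rw [hC, ← hTs 1]; simp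
  have hA0 : A < 0 := mul_neg_of_neg_of_pos (by linarith) hn
  have hC0 : 0 < C := mul_pos (by linarith) hn
  refine NotDetermined.of_image T ?_
  have hV := hU.image T
  have hT0 : T (a + σ * (e - a)) = 0 := by rw [hTs]; simp
  have h0 : (0 : ℂ) ∉ T '' U := by
    rintro ⟨z, hz, hz0⟩
    rw [← hT0] at hz0
    exact hp (T.injective hz0 ▸ hz)
  have hVseg : ∀ x : ℝ, 0 < x → x ≤ C → (x : ℂ) ∈ T '' U := fun x h1 h2 => by
    refine ⟨_, hseg (σ + x / ‖e - a‖) (by simpa using div_pos h1 hn) ?_, ?_⟩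
    · have : x / ‖e - a‖ ≤ 1 - σ := (div_le_iff₀ hn).2 h2
      linarith
    · rw [hTs]
      congr 1
      field_simp
      ring
  have hVtri : ∀ s v : ℝ, 0 < v → v ≤ s → s ≤ 1 →
      (A : ℂ) + s * (C - A) + v * (T b - C) ∈ T '' U := fun s v h1 h2 h3 => by
    refine ⟨_, htri s v h1 h2 h3, ?_⟩
    rw [← hTa, ← hTe, hT, hT, hT, hT]
    ring
  have hseg' : ∀ x y : ℂ, segment ℝ x y ⊆ U → segment ℝ (T x) (T y) ⊆ T '' U := fun x y hxy => by
    have := image_segment ℝ T.toAffineEquiv.toAffineMap x y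
    change T '' segment ℝ x y = segment ℝ (T x) (T y) at this
    rw [← this]
    exact image_mono hxy
  rcases lt_trichotomy (T b).im 0 with him | him | him
  · obtain ⟨S, hS⟩ := exists_conj_frame
    refine NotDetermined.of_image S (notDetermined_of_triangle (hV.image S) (β := conj (T b)) hA0
      hC0 (by simpa using him) ?_ ?_ ?_)
    · rintro ⟨z, hz, hz0⟩
      rw [hS, map_eq_zero] at hz0
      exact h0 (hz0 ▸ hz)
    · exact fun x h1 h2 => ⟨x, hVseg x h1 h2, by rw [hS, Complex.conj_ofReal]⟩
    · refine fun s v h1 h2 h3 => ⟨_, hVtri s v h1 h2 h3, ?_⟩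
      rw [hS]
      simp
  · exfalso
    have hb : T b = ((T b).re : ℂ) := Complex.ext (by simp) (by simp [him])
    have hreal : ∀ x y : ℝ, x ≤ 0 → 0 ≤ y → x < y → (0 : ℂ) ∈ segment ℝ (x : ℂ) (y : ℂ) := by
      intro x y hx hy hxy
      rw [segment_eq_image']
      refine ⟨-x / (y - x), ⟨div_nonneg (by linarith) (by linarith),
        (div_le_one (by linarith)).2 (by linarith)⟩, ?_⟩
      beta_reduce
      rw [Complex.real_smul, ← Complex.ofReal_sub, ← Complex.ofReal_mul, ← Complex.ofReal_add,
        div_mul_cancel₀ _ (by linarith)]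
      simp
    rcases le_or_gt (T b).re 0 with h1 | h1
    · have := hseg' b e hbe
      rw [hTe, hb] at this
      exact h0 (this (hreal _ _ h1 hC0.le (by linarith)))
    · have := hseg' a b hab
      rw [hTa, hb] at this
      exact h0 (this (hreal _ _ hA0.le h1.le (by linarith)))
  · exact notDetermined_of_triangle hV hA0 hC0 him h0 hVseg hVtri

theorem notDetermined_of_unbounded {U : Set (EuclideanSpace ℝ (Fin 2))} (hU : C1Domain U)
    (hunb : ¬ Bornology.IsBounded U) (hnconv : ¬ IsStrictlyConvexDomain U) :
    NotDetermined U := by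
  let T : EuclideanSpace ℝ (Fin 2) ≃ᵃⁱ[ℝ] ℂ :=
    Complex.orthonormalBasisOneI.repr.symm.toAffineIsometryEquiv
  have himg : ∀ a b, T '' openSegment ℝ a b = openSegment ℝ (T a) (T b) := fun a b =>
    image_openSegment ℝ T.toAffineEquiv.toAffineMap a b
  have hsegT : ∀ a b, T '' segment ℝ a b = segment ℝ (T a) (T b) := fun a b =>
    image_segment ℝ T.toAffineEquiv.toAffineMap a b
  refine NotDetermined.of_image T ?_
  by_cases hconv : Convex ℝ (T '' U)
  · have hUc : Convex ℝ U := convex_iff_segment_subset.2 fun a ha b hb => by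
      rw [← image_subset_image_iff T.injective, hsegT]
      exact hconv.segment_subset (mem_image_of_mem T ha) (mem_image_of_mem T hb)
    obtain ⟨a, ha, b, hb, hne, hab⟩ : ∃ a ∈ closure U, ∃ b ∈ closure U, a ≠ b ∧
        ¬ openSegment ℝ a b ⊆ U := by
      by_contra! hcon
      exact hnconv ⟨hUc, hcon⟩
    have hcl : T '' closure U = closure (T '' U) := T.toHomeomorph.image_closure U
    refine notDetermined_of_not_strictlyConvex (hU.image T) hconv (fun h => hunb ?_)
      (hcl ▸ mem_image_of_mem T ha) (hcl ▸ mem_image_of_mem T hb) ?_ (T.injective.ne hne)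
    · rw [Metric.isBounded_iff_ediam_ne_top] at h ⊢
      rwa [T.isometry.ediam_image] at h
    · rw [← himg, image_subset_image_iff T.injective]
      exact hab
  · exact notDetermined_of_not_convex (hU.image T) hconv

end Reduction

/-- an unbounded plane domain with smooth boundary which is not
strictly convex is not uniquely determined, in the class of all plane domains
with smooth boundaries, by the condition of local isometry of boundaries in the
relative metrics. -/
theorem unbounded_not_strictly_convex_not_uniquely_determined
    (U : Set (EuclideanSpace ℝ (Fin 2)))
    (hU : IsDomainSet U) (hUunbd : ¬ Bornology.IsBounded U)
    (hUnconv : ¬ IsStrictlyConvexDomain U) (hUb : HasC1Boundary U) :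
    ∃ V : Set (EuclideanSpace ℝ (Fin 2)), IsDomainSet V ∧ HasC1Boundary V ∧
      (∃ f : EuclideanSpace ℝ (Fin 2) → EuclideanSpace ℝ (Fin 2),
        IsBoundaryLocalIsometry U V f) ∧
      ¬ ∃ J : EuclideanSpace ℝ (Fin 2) ≃ᵢ EuclideanSpace ℝ (Fin 2), J '' U = V := by
  rw [← notDetermined_iff]
  exact notDetermined_of_unbounded ⟨hU.1, hU.2, hUb⟩ hUunbd hUnconv

end
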